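/- Let m, n ≥ 2. The set of totally irrational matrices ξ ∈ ℝ^{n×m} that satisfy both Property (B) and Property (C) but are not badly approximable (not Property (A)) is nonempty and has full Hausdorff dimension mn in ℝ^{n×m} ≅ ℝ^{mn}. -/

import Mathlib

open Filter

/-- The sup-norm of the `i`-th integer vector `x i`, viewed in `ℝ^m`. -/
noncomputable def Xval {m : ℕ} (x : ℕ → Fin m → ℤ) (i : ℕ) : ℝ :=
  ‖(fun j => (x i j : ℝ))‖

/-- The sup-norm of the remainder `ξ 𝒙ᵢ − 𝒚ᵢ`. -/
noncomputable def Lval {m n : ℕ} (ξ : Matrix (Fin n) (Fin m) ℝ)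
    (x : ℕ → Fin m → ℤ) (y : ℕ → Fin n → ℤ) (i : ℕ) : ℝ :=
  ‖(ξ.mulVec (fun j => (x i j : ℝ)) - (fun k => (y i k : ℝ)))‖

/-- `ξ` is totally irrational: `‖ξ𝒙 − 𝒚‖ > 0` for every nonzero integer pair `(𝒙,𝒚)`. -/
def TotallyIrrational {m n : ℕ} (ξ : Matrix (Fin n) (Fin m) ℝ) : Prop :=
  ∀ (u : Fin m → ℤ) (v : Fin n → ℤ), (u, v) ≠ 0 →
    0 < ‖(ξ.mulVec (fun j => (u j : ℝ)) - (fun k => (v k : ℝ)))‖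

/-- `(𝒙ᵢ, 𝒚ᵢ)_{i}` is a sequence of best approximation vectors for `ξ`
(with respect to the sup norms). -/
structure IsBestApproxSeq {m n : ℕ} (ξ : Matrix (Fin n) (Fin m) ℝ)
    (x : ℕ → Fin m → ℤ) (y : ℕ → Fin n → ℤ) : Prop where
  nonzero : ∀ i, x i ≠ 0
  first : Xval x 0 = 1
  xStrictMono : StrictMono (Xval x)
  lStrictAnti : StrictAnti (Lval ξ x y)
  best : ∀ (i : ℕ) (u : Fin m → ℤ) (v : Fin n → ℤ), u ≠ 0 →
    ‖(fun j => (u j : ℝ))‖ < Xval x (i + 1) →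
    Lval ξ x y i ≤ ‖(ξ.mulVec (fun j => (u j : ℝ)) - (fun k => (v k : ℝ)))‖

/-- Property (A): `ξ` is badly approximable. -/
def PropA {m n : ℕ} (ξ : Matrix (Fin n) (Fin m) ℝ) : Prop :=
  ∃ c : ℝ, 0 < c ∧ ∀ (u : Fin m → ℤ) (v : Fin n → ℤ), u ≠ 0 →
    c ≤ ‖(fun j => (u j : ℝ))‖ ^ m *
        ‖(ξ.mulVec (fun j => (u j : ℝ)) - (fun k => (v k : ℝ)))‖ ^ n

/-- Property (B): the ratios `X_{i+1}/X_i` are bounded. -/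
def PropB {m : ℕ} (x : ℕ → Fin m → ℤ) : Prop :=
  ∃ M : ℝ, ∀ i : ℕ, Xval x (i + 1) / Xval x i ≤ M

/-- Property (C): the ratios `L_i/L_{i+1}` are bounded. -/
def PropC {m n : ℕ} (ξ : Matrix (Fin n) (Fin m) ℝ)
    (x : ℕ → Fin m → ℤ) (y : ℕ → Fin n → ℤ) : Prop :=
  ∃ M : ℝ, ∀ i : ℕ, Lval ξ x y i / Lval ξ x y (i + 1) ≤ M

/-- The ordinary exponent `ω(ξ) = limsup (−log Lᵢ)/(log Xᵢ)`, as a value in `[0,+∞]`. -/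
noncomputable def ordExp {m n : ℕ} (ξ : Matrix (Fin n) (Fin m) ℝ)
    (x : ℕ → Fin m → ℤ) (y : ℕ → Fin n → ℤ) : EReal :=
  limsup (fun i => ((-Real.log (Lval ξ x y i) / Real.log (Xval x i) : ℝ) : EReal)) atTop

/-- The uniform exponent `ω̂(ξ) = liminf (−log Lᵢ)/(log X_{i+1})`, as a value in `[0,+∞]`. -/
noncomputable def unifExp {m n : ℕ} (ξ : Matrix (Fin n) (Fin m) ℝ)
    (x : ℕ → Fin m → ℤ) (y : ℕ → Fin n → ℤ) : EReal :=
  liminf (fun i => ((-Real.log (Lval ξ x y i) / Real.log (Xval x (i + 1)) : ℝ) : EReal)) atTop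

namespace LatticeFlow

section

open MeasureTheory Matrix

section Lattice

variable {ρ : Type*} [Fintype ρ]

/-- The point of the lattice `h ℤ^ρ` with integer coordinates `z`. -/
def lat {σ : Type*} (h : Matrix σ ρ ℝ) (z : ρ → ℤ) : σ → ℝ := h *ᵥ (fun i => (z i : ℝ))

theorem lat_add {σ : Type*} (h : Matrix σ ρ ℝ) (z z' : ρ → ℤ) :
    lat h (z + z') = lat h z + lat h z' := by
  simp only [lat, ← Matrix.mulVec_add]
  congr 1
  funext i
  simp

variable [DecidableEq ρ]

theorem volume_preimage_box (A : Matrix ρ ρ ℝ) (hA : A.det ≠ 0) (c : ρ → ℝ) :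
    volume {x : ρ → ℝ | ∀ i, |(A *ᵥ x) i| ≤ c i} =
      ENNReal.ofReal |A.det|⁻¹ * ∏ i, ENNReal.ofReal (2 * c i) := by
  have h1 : {x : ρ → ℝ | ∀ i, |(A *ᵥ x) i| ≤ c i} =
      (Matrix.toLin' A) ⁻¹' (Set.Icc (-c) c) := by
    ext x
    simp [Set.mem_Icc, Pi.le_def, abs_le, forall_and]
  have h2 : LinearMap.det (Matrix.toLin' A) ≠ 0 := by rwa [LinearMap.det_toLin']
  rw [h1, Measure.addHaar_preimage_linearMap _ h2, LinearMap.det_toLin', abs_inv,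
    Real.volume_Icc_pi]
  congr 1
  refine Finset.prod_congr rfl fun i _ => ?_
  congr 1
  simp only [Pi.neg_apply]
  ring

/-- Minkowski's theorem on linear forms. -/
theorem exists_lat_le (A : Matrix ρ ρ ℝ) (hA : A.det ≠ 0) (c : ρ → ℝ)
    (hc : ∀ i, 0 < c i) (hdet : |A.det| < ∏ i, c i) :
    ∃ z : ρ → ℤ, z ≠ 0 ∧ ∀ i, |lat A z i| ≤ c i := by
  set b := Pi.basisFun ℝ ρ with hb
  have fund := ZSpan.isAddFundamentalDomain' b (volume : Measure (ρ → ℝ))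
  have : Countable (Submodule.span ℤ (Set.range b)).toAddSubgroup :=
    inferInstanceAs (Countable (Submodule.span ℤ (Set.range b)))
  obtain ⟨x, hx0, hx⟩ := exists_ne_zero_mem_lattice_of_measure_mul_two_pow_lt_measure
    (s := {x : ρ → ℝ | ∀ i, |(A *ᵥ x) i| ≤ c i}) fund
    (by intro x hx i; simpa [Matrix.mulVec_neg] using hx i)
    (by
      intro x hx y hy s t hs ht hst i
      rw [Matrix.mulVec_add, Matrix.mulVec_smul, Matrix.mulVec_smul]
      simp only [Pi.add_apply, Pi.smul_apply, smul_eq_mul]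
      calc |s * (A *ᵥ x) i + t * (A *ᵥ y) i| ≤ |s * (A *ᵥ x) i| + |t * (A *ᵥ y) i| := abs_add_le _ _
        _ = s * |(A *ᵥ x) i| + t * |(A *ᵥ y) i| := by
          rw [abs_mul, abs_mul, abs_of_nonneg hs, abs_of_nonneg ht]
        _ ≤ s * c i + t * c i := by gcongr <;> [exact hx i; exact hy i]
        _ = c i := by rw [← add_mul, hst, one_mul])
    (by
      rw [volume_preimage_box A hA]
      rw [ZSpan.volume_fundamentalDomain]
      have h1 : (Matrix.of ⇑b).det = 1 := by
        have : Matrix.of ⇑b = (1 : Matrix ρ ρ ℝ) := by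
          ext i j
          simp [hb, Pi.basisFun_apply, Matrix.one_apply, Pi.single_apply, eq_comm]
        rw [this, Matrix.det_one]
      rw [h1, abs_one, ENNReal.ofReal_one, one_mul,
        ← ENNReal.ofReal_prod_of_nonneg (fun i _ => by have := hc i; positivity),
        ← ENNReal.ofReal_mul (by positivity), Module.finrank_fintype_fun_eq_card]
      rw [show (2 : ENNReal) ^ Fintype.card ρ = ENNReal.ofReal (2 ^ Fintype.card ρ) by
        rw [ENNReal.ofReal_pow (by norm_num)]; simp]
      have hd : 0 < |A.det| := abs_pos.mpr hA
      have hp : 0 < ∏ i, c i := Finset.prod_pos fun i _ => hc i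
      rw [ENNReal.ofReal_lt_ofReal_iff
        (by rw [Finset.prod_mul_distrib]; simp only [Finset.prod_const]; positivity)]
      rw [Finset.prod_mul_distrib]
      simp only [Finset.prod_const, Finset.card_univ]
      rw [inv_mul_eq_div, lt_div_iff₀ hd]
      gcongr)
  have hmem : ((x : (Submodule.span ℤ (Set.range b)).toAddSubgroup) : ρ → ℝ) ∈
      Submodule.span ℤ (Set.range b) := x.2
  rw [Module.Basis.mem_span_iff_repr_mem] at hmem
  choose z hz using hmem
  have hzx : (fun i => (z i : ℝ)) = (x : ρ → ℝ) := by
    funext i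
    simpa [hb] using hz i
  refine ⟨z, ?_, ?_⟩
  · rintro rfl
    apply hx0
    ext i
    simp [← hzx]
  · exact fun i => by simpa only [lat, hzx] using hx i

theorem exists_functional_of_span_ne_top (S : Set (ρ → ℝ)) (hS : Submodule.span ℝ S ≠ ⊤) :
    ∃ (w : ρ → ℝ) (j : ρ), w j = 1 ∧ (∀ i, |w i| ≤ 1) ∧ ∀ x ∈ S, ∑ i, w i * x i = 0 := by
  obtain ⟨f, hf0, hf⟩ := Submodule.exists_le_ker_of_lt_top _ (lt_top_iff_ne_top.mpr hS)
  have hfx : ∀ x, f x = ∑ i, f (Pi.single i 1) * x i := by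
    intro x
    conv_lhs => rw [← Finset.univ_sum_single x]
    rw [map_sum]
    refine Finset.sum_congr rfl fun i _ => ?_
    rw [show (Pi.single i (x i) : ρ → ℝ) = x i • Pi.single i 1 by
      rw [← Pi.single_smul, smul_eq_mul, mul_one], map_smul, smul_eq_mul, mul_comm]
  have hne : Nonempty ρ := by
    by_contra hcon
    rw [not_nonempty_iff] at hcon
    exact hf0 (LinearMap.ext fun x => by rw [hfx]; simp)
  obtain ⟨j, hj⟩ := Finite.exists_max (fun i => |f (Pi.single i 1)|)
  have hj0 : f (Pi.single j 1) ≠ 0 := by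
    intro h0
    apply hf0
    ext i
    have := hj i
    simp only [h0, abs_zero, abs_nonpos_iff] at this
    simpa using this
  refine ⟨fun i => f (Pi.single i 1) / f (Pi.single j 1), j, div_self hj0, fun i => ?_, ?_⟩
  · rw [abs_div]
    exact div_le_one_of_le₀ (hj i) (abs_nonneg _)
  · intro x hx
    have h1 : f x = 0 := hf (Submodule.subset_span hx)
    rw [hfx] at h1
    simp only [div_mul_eq_mul_div, ← Finset.sum_div, h1, zero_div]

theorem exists_matrix_of_span_eq_top (h : Matrix ρ ρ ℝ) (S : Set (ρ → ℤ))
    (hS : Submodule.span ℝ (lat h '' S) = ⊤) :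
    ∃ Z : Matrix ρ ρ ℤ, Z.det ≠ 0 ∧ ∀ j, (fun i => Z i j) ∈ S := by
  obtain ⟨f, hfS, -, hf⟩ := Submodule.exists_fun_fin_finrank_span_eq ℝ (lat h '' S)
  have hr : Module.finrank ℝ (Submodule.span ℝ (lat h '' S)) = Fintype.card ρ := by
    rw [hS, finrank_top, Module.finrank_fintype_fun_eq_card]
  choose z hzS hz using hfS
  let eq := (Fintype.equivFin ρ).trans (finCongr hr.symm)
  refine ⟨Matrix.of fun i j => z (eq j) i, ?_, fun j => hzS _⟩
  have h1 : LinearIndependent ℝ (fun j : ρ => f (eq j)) := hf.comp _ eq.injective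
  have h2 : (fun j : ρ => f (eq j)) =
      (h * (Matrix.of fun i j => z (eq j) i).map (Int.cast : ℤ → ℝ))ᵀ.row := by
    funext j i
    simp [← hz, lat, Matrix.mulVec, Matrix.mul_apply, dotProduct, mul_comm]
  rw [h2, Matrix.linearIndependent_rows_iff_isUnit, Matrix.isUnit_transpose,
    Matrix.isUnit_iff_isUnit_det, Matrix.det_mul, isUnit_iff_ne_zero] at h1
  intro h0
  apply right_ne_zero_of_mul h1
  have h3 := Int.cast_det (R := ℝ) (Matrix.of fun i j => z (eq j) i)
  rw [h0] at h3
  simpa using h3.symm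

theorem exists_bounded_matrix {e : ℝ} (he : 0 < e) :
    ∃ M : ℝ, 0 < M ∧ ∀ h : Matrix ρ ρ ℝ, |h.det| = 1 → (∀ z ≠ 0, e ≤ ‖lat h z‖) →
      ∃ Z : Matrix ρ ρ ℤ, Z.det ≠ 0 ∧ ∀ j, ‖lat h (fun i => Z i j)‖ ≤ M := by
  set r := Fintype.card ρ
  set δ := e / (2 * (r + 1)) with hδ
  have hδ0 : 0 < δ := by positivity
  have hrδ : r * δ ≤ e / 2 := by
    rw [hδ]
    have : (r : ℝ) * (e / (2 * (r + 1))) = e / 2 * (r / (r + 1)) := by field_simp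
    rw [this]
    have : (r : ℝ) / (r + 1) ≤ 1 := div_le_one_of_le₀ (by linarith) (by positivity)
    nlinarith
  have hδe : δ ≤ e / 2 := by
    rw [hδ]
    exact div_le_div_of_nonneg_left he.le (by norm_num) (by nlinarith [Nat.cast_nonneg (α := ℝ) r])
  refine ⟨4 / δ ^ (r - 1) + e, by positivity, fun h hdet hmin => ?_⟩
  set M := 4 / δ ^ (r - 1) + e with hM
  have hM0 : 0 < M := by positivity
  have hMe : e ≤ M := by rw [hM]; linarith [show 0 < 4 / δ ^ (r - 1) by positivity]
  refine exists_matrix_of_span_eq_top h {z | ‖lat h z‖ ≤ M} ?_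
  by_contra hspan
  obtain ⟨w, j, hwj, hw, hw0⟩ := exists_functional_of_span_ne_top _ hspan
  set A : Matrix ρ ρ ℝ := h.updateRow j (∑ k, w k • h k) with hA
  have hAdet : A.det = h.det := by
    rw [hA, Matrix.det_updateRow_sum, hwj, one_smul]
  have hAlat : ∀ z, lat A z j = ∑ i, w i * lat h z i := by
    intro z
    simp only [lat, hA, Matrix.mulVec, Matrix.updateRow_self]
    rw [sum_dotProduct]
    simp
  have hAlat' : ∀ z i, i ≠ j → lat A z i = lat h z i := by
    intro z i hi
    simp only [lat, hA, Matrix.mulVec, Matrix.updateRow_ne hi]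
  obtain ⟨z, hz0, hz⟩ := exists_lat_le A (by rw [hAdet]; rw [← abs_pos, hdet]; norm_num)
    (Function.update (fun _ => δ) j (M / 2))
    (fun i => by rcases eq_or_ne i j with rfl | hi
                 · simpa using hM0
                 · simpa [hi] using hδ0)
    (by
      rw [hAdet, hdet, Finset.prod_update_of_mem (Finset.mem_univ _), Finset.prod_const,
        Finset.card_sdiff_of_subset (Finset.subset_univ _), Finset.card_singleton,
        Finset.card_univ]
      have : (4 / δ ^ (r - 1)) / 2 * δ ^ (r - 1) = 2 := by field_simp; norm_num
      have h2 : 0 < e / 2 * δ ^ (r - 1) := by positivity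
      have h3 : M / 2 * δ ^ (r - 1) = (4 / δ ^ (r - 1)) / 2 * δ ^ (r - 1) + e / 2 * δ ^ (r - 1) := by
        rw [hM]; ring
      change 1 < M / 2 * δ ^ (r - 1)
      linarith)
  have hzi : ∀ i, i ≠ j → |lat h z i| ≤ δ := by
    intro i hi
    have := hz i
    rwa [hAlat' z i hi, Function.update_of_ne hi] at this
  have hsum : ∑ i, w i * lat h z i = lat h z j + ∑ i ∈ Finset.univ.erase j, w i * lat h z i := by
    rw [← Finset.add_sum_erase _ _ (Finset.mem_univ j), hwj, one_mul]
  have herase : |∑ i ∈ Finset.univ.erase j, w i * lat h z i| ≤ e / 2 := by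
    refine le_trans (Finset.abs_sum_le_sum_abs _ _) ?_
    refine le_trans (Finset.sum_le_card_nsmul _ _ δ fun i hi => ?_) ?_
    · rw [abs_mul]
      have := hzi i (Finset.ne_of_mem_erase hi)
      have := hw i
      calc |w i| * |lat h z i| ≤ 1 * δ := by gcongr
        _ = δ := one_mul _
    · rw [nsmul_eq_mul]
      refine le_trans ?_ hrδ
      gcongr
      exact (Finset.card_le_univ _)
  have hzj : |lat h z j| ≤ M / 2 + e / 2 := by
    have h1 := hz j
    rw [hAlat, Function.update_self, hsum] at h1
    have h2 := abs_sub_abs_le_abs_sub (lat h z j + ∑ i ∈ Finset.univ.erase j, w i * lat h z i)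
      (∑ i ∈ Finset.univ.erase j, w i * lat h z i)
    have h3 := abs_sub (lat h z j + ∑ i ∈ Finset.univ.erase j, w i * lat h z i)
      (∑ i ∈ Finset.univ.erase j, w i * lat h z i)
    rw [add_sub_cancel_right] at h3
    linarith
  have hzS : ‖lat h z‖ ≤ M := by
    refine (pi_norm_le_iff_of_nonneg hM0.le).mpr fun i => ?_
    rw [Real.norm_eq_abs]
    rcases eq_or_ne i j with rfl | hi
    · linarith
    · linarith [hzi i hi]
  have h0 := hw0 _ ⟨z, hzS, rfl⟩
  have hlt : ‖lat h z‖ ≤ e / 2 := by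
    refine (pi_norm_le_iff_of_nonneg (by positivity)).mpr fun i => ?_
    rw [Real.norm_eq_abs]
    rcases eq_or_ne i j with rfl | hi
    · rw [hsum] at h0
      rw [eq_neg_of_add_eq_zero_left h0, abs_neg]
      exact herase
    · linarith [hzi i hi]
  linarith [hmin z hz0]

end Lattice

end

section

open MeasureTheory Matrix

section Counting

variable {ρ : Type*} [Fintype ρ] [DecidableEq ρ]

theorem exists_lat_add_le (h : Matrix ρ ρ ℝ) {Z : Matrix ρ ρ ℤ} (hZ : Z.det ≠ 0) {M : ℝ}
    (hM : ∀ j, ‖lat h (fun i => Z i j)‖ ≤ M) (x : ρ → ℝ) :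
    ∃ z : ρ → ℤ, ‖h *ᵥ x + lat h z‖ ≤ Fintype.card ρ * M := by
  set A : Matrix ρ ρ ℝ := Z.map (Int.cast : ℤ → ℝ) with hA
  have hAdet : IsUnit A.det := by
    rw [isUnit_iff_ne_zero]
    have h3 := Int.cast_det (R := ℝ) Z
    intro h0
    rw [← hA] at h3
    rw [h0] at h3
    exact hZ (by exact_mod_cast h3)
  set c := A⁻¹ *ᵥ x with hc
  have hx : A *ᵥ c = x := by
    rw [hc, Matrix.mulVec_mulVec, Matrix.mul_nonsing_inv _ hAdet, Matrix.one_mulVec]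
  refine ⟨-(Z *ᵥ fun j => ⌊c j⌋), ?_⟩
  have hcast : (fun i => ((-(Z *ᵥ fun j => ⌊c j⌋) : ρ → ℤ) i : ℝ)) =
      -(A *ᵥ fun j => (⌊c j⌋ : ℝ)) := by
    funext i
    simp [hA, Matrix.mulVec, dotProduct]
  have hsum : h *ᵥ x + lat h (-(Z *ᵥ fun j => ⌊c j⌋)) =
      ∑ j, Int.fract (c j) • lat h (fun i => Z i j) := by
    have h1 : h *ᵥ x + lat h (-(Z *ᵥ fun j => ⌊c j⌋)) = (h * A) *ᵥ (fun j => Int.fract (c j)) := by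
      rw [lat, hcast, ← Matrix.mulVec_add, ← Matrix.mulVec_mulVec]
      conv_lhs => rw [← hx]
      rw [← sub_eq_add_neg, ← Matrix.mulVec_sub]
      rfl
    rw [h1]
    funext i
    simp [hA, lat, Matrix.mulVec, dotProduct, Matrix.mul_apply, Finset.sum_apply, mul_comm]
  rw [hsum]
  refine (norm_sum_le _ _).trans ((Finset.sum_le_card_nsmul _ _ M fun j _ => ?_).trans ?_)
  · rw [norm_smul, Real.norm_eq_abs, abs_of_nonneg (Int.fract_nonneg _)]
    calc Int.fract (c j) * ‖lat h (fun i => Z i j)‖ ≤ 1 * ‖lat h (fun i => Z i j)‖ := by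
          gcongr; exact (Int.fract_lt_one _).le
      _ ≤ M := by rw [one_mul]; exact hM j
  · rw [nsmul_eq_mul, Finset.card_univ]

theorem volume_ge_card (t : Set (ρ → ℝ)) (ht : MeasurableSet t) (k : ℕ)
    (hk : ∀ x : ρ → ℝ, ∃ S : Finset (ρ → ℤ), S.card = k ∧ ∀ z ∈ S, x + (fun i => (z i : ℝ)) ∈ t) :
    (k : ENNReal) ≤ volume t := by
  set F : Set (ρ → ℝ) := {x | ∀ i, ⌊x i⌋ = 0} with hF
  have hFvol : volume F = 1 := by
    have : F = Set.univ.pi fun _ => Set.Ico (0 : ℝ) 1 := by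
      ext x
      simp [hF, Int.floor_eq_zero_iff]
    rw [this, Real.volume_pi_Ico]
    simp
  have hcell : ∀ z : ρ → ℤ, MeasurableSet {y : ρ → ℝ | ∀ i, ⌊y i⌋ = z i} := by
    intro z
    rw [show {y : ρ → ℝ | ∀ i, ⌊y i⌋ = z i} = ⋂ i, {y | ⌊y i⌋ = z i} by ext; simp]
    refine MeasurableSet.iInter fun i => ?_
    exact measurableSet_eq_fun (Int.measurable_floor.comp (measurable_pi_apply i)) measurable_const
  have hmeas : ∀ z : ρ → ℤ, MeasurableSet (t ∩ {y : ρ → ℝ | ∀ i, ⌊y i⌋ = z i}) :=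
    fun z => ht.inter (hcell z)
  have hunion : t = ⋃ z : ρ → ℤ, t ∩ {y : ρ → ℝ | ∀ i, ⌊y i⌋ = z i} := by
    ext y
    simp only [Set.mem_iUnion, Set.mem_inter_iff, Set.mem_ofPred_eq]
    exact ⟨fun hy => ⟨fun i => ⌊y i⌋, hy, fun _ => rfl⟩, fun ⟨_, hy, _⟩ => hy⟩
  have hdisj : Pairwise (Function.onFun Disjoint
      fun z : ρ → ℤ => t ∩ {y : ρ → ℝ | ∀ i, ⌊y i⌋ = z i}) := by
    intro z z' hzz
    rw [Function.onFun, Set.disjoint_left]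
    rintro y ⟨-, hy⟩ ⟨-, hy'⟩
    exact hzz (funext fun i => (hy i).symm.trans (hy' i))
  have hvol : volume t = ∑' z : ρ → ℤ, volume (t ∩ {y : ρ → ℝ | ∀ i, ⌊y i⌋ = z i}) := by
    conv_lhs => rw [hunion]
    exact measure_iUnion hdisj hmeas
  have hpiece : ∀ z : ρ → ℤ, volume (t ∩ {y : ρ → ℝ | ∀ i, ⌊y i⌋ = z i}) =
      ∫⁻ x in F, Set.indicator {x | x + (fun i => (z i : ℝ)) ∈ t} 1 x := by
    intro z
    have hm : MeasurableSet {x : ρ → ℝ | x + (fun i => (z i : ℝ)) ∈ t} :=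
      (measurable_id.add_const _) ht
    rw [lintegral_indicator_one hm, Measure.restrict_apply hm,
      ← measure_preimage_add_right volume (fun i => (z i : ℝ))]
    congr 1
    ext x
    simp [hF]
  rw [hvol]
  simp only [hpiece]
  rw [← lintegral_tsum]
  · calc (k : ENNReal) = ∫⁻ _ in F, (k : ENNReal) := by simp [hFvol]
      _ ≤ _ := by
        refine lintegral_mono fun x => ?_
        obtain ⟨S, hS, hSt⟩ := hk x
        calc (k : ENNReal) = ∑ z ∈ S, Set.indicator {x | x + (fun i => (z i : ℝ)) ∈ t}
                (1 : (ρ → ℝ) → ENNReal) x := by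
              rw [Finset.sum_congr rfl (g := fun _ => (1 : ENNReal))
                fun z hz => by simp [Set.indicator, hSt z hz]]
              simp [hS]
          _ ≤ _ := ENNReal.sum_le_tsum S
  · intro z
    exact (measurable_one.indicator ((measurable_id.add_const _) ht)).aemeasurable

/-- The number of points of a unimodular lattice in a ball, in terms of bounded independent
lattice vectors. -/
theorem card_lat_le (h : Matrix ρ ρ ℝ) (hdet : |h.det| = 1) {Z : Matrix ρ ρ ℤ}
    (hZ : Z.det ≠ 0) {M : ℝ} (hM0 : 0 ≤ M) (hM : ∀ j, ‖lat h (fun i => Z i j)‖ ≤ M)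
    {P : ℝ} (hP : 0 ≤ P) (S : Finset (ρ → ℤ)) (hS : ∀ z ∈ S, ‖lat h z‖ ≤ P) :
    (S.card : ℝ) ≤ (2 * (P + Fintype.card ρ * M)) ^ Fintype.card ρ := by
  set R := P + Fintype.card ρ * M with hR
  have hR0 : 0 ≤ R := by positivity
  have hdet0 : h.det ≠ 0 := by rw [← abs_pos, hdet]; norm_num
  have hvol := volume_preimage_box h hdet0 (fun _ => R)
  have hball : {x : ρ → ℝ | ∀ i, |(h *ᵥ x) i| ≤ R} = {x | ‖h *ᵥ x‖ ≤ R} := by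
    ext x
    simp [pi_norm_le_iff_of_nonneg hR0]
  rw [hball, hdet, inv_one, ENNReal.ofReal_one, one_mul, Finset.prod_const, Finset.card_univ,
    ← ENNReal.ofReal_pow (by positivity)] at hvol
  have hmeas : MeasurableSet {x : ρ → ℝ | ‖h *ᵥ x‖ ≤ R} := by
    refine (isClosed_le ?_ continuous_const).measurableSet
    exact (LinearMap.continuous_of_finiteDimensional (Matrix.mulVecLin h)).norm
  have := volume_ge_card _ hmeas S.card (fun x => by
    obtain ⟨z0, hz0⟩ := exists_lat_add_le h hZ hM x
    refine ⟨S.map (addLeftEmbedding z0), by simp, ?_⟩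
    intro z hz
    obtain ⟨z1, hz1, rfl⟩ := Finset.mem_map.mp hz
    have : h *ᵥ (x + fun i => ((addLeftEmbedding z0 z1 i : ℤ) : ℝ)) =
        (h *ᵥ x + lat h z0) + lat h z1 := by
      rw [Matrix.mulVec_add, add_assoc, ← lat_add]
      rfl
    simp only [Set.mem_ofPred_eq, this]
    calc _ ≤ ‖h *ᵥ x + lat h z0‖ + ‖lat h z1‖ := norm_add_le _ _
      _ ≤ Fintype.card ρ * M + P := add_le_add hz0 (hS z1 hz1)
      _ = R := by rw [hR]; ring)
  rw [hvol, ← ENNReal.ofReal_natCast, ENNReal.ofReal_le_ofReal_iff (by positivity)] at this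
  exact this

end Counting

end

section

open Matrix

section Good

variable {ρ : Type*} [Fintype ρ] [DecidableEq ρ]

/-- The shortest vector of the lattice `h ℤ^ρ`, measured relative to its covolume, is not
smaller than a constant determined by `ε`. -/
def Good (ε : ℝ) (h : Matrix ρ ρ ℝ) : Prop :=
  ∀ z : ρ → ℤ, z ≠ 0 → ε * |h.det| ≤ ‖lat h z‖ ^ Fintype.card ρ

theorem Good.mono {ε ε' : ℝ} {h : Matrix ρ ρ ℝ} (hg : Good ε h) (hε : ε' ≤ ε) : Good ε' h :=
  fun z hz => (mul_le_mul_of_nonneg_right hε (abs_nonneg _)).trans (hg z hz)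

theorem lat_smul {σ : Type*} (s : ℝ) (h : Matrix σ ρ ℝ) (z : ρ → ℤ) :
    lat (s • h) z = s • lat h z := by
  simp [lat, Matrix.smul_mulVec]

theorem good_smul {ε s : ℝ} (hs : 0 < s) (h : Matrix ρ ρ ℝ) :
    Good ε (s • h) ↔ Good ε h := by
  refine forall₂_congr fun z _ => ?_
  rw [lat_smul, norm_smul, Real.norm_eq_abs, abs_of_pos hs, mul_pow, Matrix.det_smul, abs_mul,
    abs_of_pos (by positivity), mul_left_comm, mul_le_mul_iff_right₀ (by positivity)]

theorem exists_smul_det_eq_one [Nonempty ρ] (h : Matrix ρ ρ ℝ) (hdet : h.det ≠ 0) :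
    ∃ s : ℝ, 0 < s ∧ s ^ Fintype.card ρ * |h.det| = 1 ∧ |(s • h).det| = 1 := by
  have hd : 0 < |h.det| := abs_pos.mpr hdet
  have key : (|h.det|⁻¹ ^ ((Fintype.card ρ : ℝ)⁻¹)) ^ Fintype.card ρ * |h.det| = 1 := by
    rw [Real.rpow_inv_natCast_pow (by positivity) Fintype.card_ne_zero, inv_mul_cancel₀ hd.ne']
  refine ⟨|h.det|⁻¹ ^ ((Fintype.card ρ : ℝ)⁻¹), by positivity, key, ?_⟩
  rw [Matrix.det_smul, abs_mul, abs_of_pos (by positivity), key]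

theorem Good.le_norm [Nonempty ρ] {ε : ℝ} {h : Matrix ρ ρ ℝ} (hg : Good ε h)
    (hdet : |h.det| = 1) {z : ρ → ℤ} (hz : z ≠ 0) : min ε 1 ≤ ‖lat h z‖ := by
  by_contra! hlt
  have h1 := hg z hz
  rw [hdet, mul_one] at h1
  have h2 : ‖lat h z‖ ^ Fintype.card ρ ≤ ‖lat h z‖ :=
    pow_le_of_le_one (norm_nonneg _) (hlt.le.trans (min_le_right _ _)) Fintype.card_ne_zero
  linarith [min_le_left ε 1]

end Good

section Flow

variable {ι κ : Type*} [Fintype ι] [DecidableEq ι] [Fintype κ] [DecidableEq κ]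

/-- The image of the lattice `h` under `(p, q) ↦ (p, N ^ t (q + η p))`. -/
def flow (N : ℝ) (t : ℕ) (η : Matrix κ ι ℝ) (h : Matrix (ι ⊕ κ) (ι ⊕ κ) ℝ) :
    Matrix (ι ⊕ κ) (ι ⊕ κ) ℝ :=
  fromBlocks 1 0 (N ^ t • η) (N ^ t • 1) * h

variable (N : ℝ) (t : ℕ) (η : Matrix κ ι ℝ) (h : Matrix (ι ⊕ κ) (ι ⊕ κ) ℝ)

theorem det_flow : (flow N t η h).det = (N ^ t) ^ Fintype.card κ * h.det := by
  rw [flow, Matrix.det_mul, Matrix.det_fromBlocks_zero₁₂, Matrix.det_one, one_mul,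
    Matrix.det_smul, Matrix.det_one, mul_one]

theorem flow_smul (s : ℝ) : flow N t η (s • h) = s • flow N t η h := by
  simp [flow]

theorem lat_flow (z : ι ⊕ κ → ℤ) : lat (flow N t η h) z =
    fromBlocks 1 0 (N ^ t • η) (N ^ t • (1 : Matrix κ κ ℝ)) *ᵥ lat h z := by
  rw [lat, flow, ← Matrix.mulVec_mulVec, lat]

@[simp]
theorem lat_flow_inl (z : ι ⊕ κ → ℤ) (i : ι) :
    lat (flow N t η h) z (Sum.inl i) = lat h z (Sum.inl i) := by
  rw [lat_flow, Matrix.fromBlocks_mulVec]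
  simp

@[simp]
theorem lat_flow_inr (z : ι ⊕ κ → ℤ) (k : κ) :
    lat (flow N t η h) z (Sum.inr k) =
      N ^ t * (lat h z (Sum.inr k) + ∑ i, η k i * lat h z (Sum.inl i)) := by
  rw [lat_flow, Matrix.fromBlocks_mulVec]
  simp only [Sum.elim_inr, Pi.add_apply, Matrix.smul_mulVec, Matrix.one_mulVec, Pi.smul_apply,
    Function.comp_apply, smul_eq_mul, Matrix.mulVec, dotProduct]
  ring

end Flow

theorem sum_inv_pow_le {α : Type*} (u : α → ℝ) {M C : ℝ} (hM : 0 < M) (hC : 0 ≤ C) {a b : ℕ}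
    (ha : 1 ≤ a) (J : ℕ) : ∀ (S : Finset α) (R : ℝ), 0 < R → R < M * 2 ^ J →
    (∀ z ∈ S, M ≤ u z ∧ u z ≤ R) →
    (∀ T ⊆ S, ∀ P, M ≤ P → (∀ z ∈ T, u z ≤ P) → (T.card : ℝ) ≤ C * P ^ (a + b)) →
    ∑ z ∈ S, (1 / u z) ^ b ≤ 2 ^ (b + 1) * C * R ^ a := by
  classical
  induction J with
  | zero =>
    intro S R hR hRM hS _
    have : S = ∅ := by
      rw [Finset.eq_empty_iff_forall_notMem]
      intro z hz
      have := hS z hz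
      simp at hRM
      linarith
    rw [this, Finset.sum_empty]
    positivity
  | succ J ih =>
    intro S R hR hRM hS hcount
    rcases lt_or_ge R M with hlt | hge
    · have : S = ∅ := by
        rw [Finset.eq_empty_iff_forall_notMem]
        intro z hz
        have := hS z hz
        linarith
      rw [this, Finset.sum_empty]
      positivity
    rw [← Finset.sum_filter_add_sum_filter_not S (fun z => u z ≤ R / 2)]
    have h1 := ih (S.filter fun z => u z ≤ R / 2) (R / 2) (by positivity)
      (by rw [pow_succ] at hRM; linarith)
      (fun z hz => ⟨(hS z (Finset.mem_filter.mp hz).1).1, (Finset.mem_filter.mp hz).2⟩)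
      (fun T hT => hcount T (hT.trans (Finset.filter_subset _ _)))
    have h2 : ∑ z ∈ S.filter (fun z => ¬ u z ≤ R / 2), (1 / u z) ^ b ≤
        C * R ^ (a + b) * (2 / R) ^ b := by
      refine (Finset.sum_le_card_nsmul _ _ ((2 / R) ^ b) fun z hz => ?_).trans ?_
      · have hz' := (Finset.mem_filter.mp hz).2
        push Not at hz'
        have hu : 0 < u z := lt_trans (by positivity) hz'
        refine pow_le_pow_left₀ (by positivity) ?_ _
        rw [div_le_div_iff₀ hu hR]
        linarith
      · rw [nsmul_eq_mul]
        refine mul_le_mul_of_nonneg_right ?_ (by positivity)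
        exact hcount _ (Finset.filter_subset _ _) R hge
          fun z hz => (hS z (Finset.mem_filter.mp hz).1).2
    have h3 : C * R ^ (a + b) * (2 / R) ^ b = 2 ^ b * C * R ^ a := by
      rw [div_pow, pow_add]
      field_simp
    have h4 : (R / 2) ^ a ≤ R ^ a / 2 := by
      rw [div_pow]
      refine div_le_div_of_nonneg_left (by positivity) (by norm_num) ?_
      exact le_self_pow₀ (by norm_num) (by omega)
    calc _ ≤ 2 ^ (b + 1) * C * (R / 2) ^ a + 2 ^ b * C * R ^ a := by
          rw [← h3]; exact add_le_add h1 h2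
      _ ≤ 2 ^ (b + 1) * C * (R ^ a / 2) + 2 ^ b * C * R ^ a := by gcongr
      _ = _ := by ring

theorem card_le_of_sub_le (T : Finset ℕ) {L : ℝ} (hL : 0 ≤ L)
    (hT : ∀ x ∈ T, ∀ y ∈ T, (x : ℝ) - y ≤ L) : (T.card : ℝ) ≤ L + 1 := by
  rcases T.eq_empty_or_nonempty with rfl | hne
  · simp; linarith
  have hsub : T ⊆ Finset.Icc (T.min' hne) (T.max' hne) := fun x hx =>
    Finset.mem_Icc.mpr ⟨T.min'_le x hx, T.le_max' x hx⟩
  have h1 := Finset.card_le_card hsub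
  rw [Nat.card_Icc] at h1
  have h2 := hT _ (T.max'_mem hne) _ (T.min'_mem hne)
  have h3 : T.min' hne ≤ T.max' hne := T.min'_le _ (T.max'_mem hne)
  have h4 : T.card + T.min' hne ≤ T.max' hne + 1 := by omega
  have h5 : (T.card : ℝ) + T.min' hne ≤ T.max' hne + 1 := by exact_mod_cast h4
  linarith

theorem card_row_le {ι : Type*} [Fintype ι] [DecidableEq ι] (p : ι → ℝ) (c R : ℝ) (K : ℕ)
    (hp : 0 < ‖p‖) (hpR : ‖p‖ ≤ R) :
    ((Finset.univ.filter fun f : ι → Fin K => |c + 16 * ∑ i, (f i : ℝ) * p i| < R).card : ℝ) ≤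
      (K : ℝ) ^ (Fintype.card ι - 1) * (2 * R / ‖p‖) := by
  set A := Finset.univ.filter fun f : ι → Fin K => |c + 16 * ∑ i, (f i : ℝ) * p i| < R with hA
  have hne : Nonempty ι := by
    by_contra hcon
    rw [not_nonempty_iff] at hcon
    simp [Pi.norm_def] at hp
  obtain ⟨j, hj⟩ : ∃ j, ‖p‖ = |p j| := by
    obtain ⟨j, hj⟩ := Finite.exists_max (fun i => ‖p i‖)
    refine ⟨j, le_antisymm ?_ (norm_le_pi_norm p j)⟩
    exact (pi_norm_le_iff_of_nonneg (norm_nonneg _)).mpr hj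
  have hfib : ∀ g ∈ A.image (fun f => fun i : {i // i ≠ j} => f i),
      (A.filter fun f => (fun i : {i // i ≠ j} => f i) = g).card ≤ ⌊2 * R / ‖p‖⌋₊ := by
    intro g _
    refine Nat.le_floor ?_
    set B := A.filter fun f => (fun i : {i // i ≠ j} => f i) = g with hB
    have hBj : ∀ f ∈ B, ∀ f' ∈ B, ∀ i, i ≠ j → f i = f' i := by
      intro f hf f' hf' i hi
      have h1 := congrFun (Finset.mem_filter.mp hf).2 ⟨i, hi⟩
      have h2 := congrFun (Finset.mem_filter.mp hf').2 ⟨i, hi⟩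
      exact h1.trans h2.symm
    have hinj : Set.InjOn (fun f : ι → Fin K => (f j : ℕ)) B := by
      intro f hf f' hf' hff
      funext i
      rcases eq_or_ne i j with rfl | hi
      · exact Fin.ext hff
      · exact hBj f hf f' hf' i hi
    rw [← Finset.card_image_of_injOn hinj]
    have hR : 0 ≤ R := hp.le.trans hpR
    refine (card_le_of_sub_le _ (L := R / ‖p‖) (by positivity) ?_).trans ?_
    · intro x hx y hy
      obtain ⟨f, hf, rfl⟩ := Finset.mem_image.mp hx
      obtain ⟨f', hf', rfl⟩ := Finset.mem_image.mp hy
      have h1 := (Finset.mem_filter.mp (Finset.mem_filter.mp hf).1).2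
      have h2 := (Finset.mem_filter.mp (Finset.mem_filter.mp hf').1).2
      have h3 : (c + 16 * ∑ i, (f i : ℝ) * p i) - (c + 16 * ∑ i, (f' i : ℝ) * p i) =
          16 * (((f j : ℝ) - f' j) * p j) := by
        rw [add_sub_add_left_eq_sub, ← mul_sub, ← Finset.sum_sub_distrib]
        congr 1
        rw [Finset.sum_eq_single j]
        · ring
        · intro i _ hi
          rw [hBj f hf f' hf' i hi, sub_self]
        · simp
      have h4 : |16 * (((f j : ℝ) - f' j) * p j)| < 2 * R := by
        rw [← h3]
        exact (abs_sub _ _).trans_lt (by linarith)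
      rw [abs_mul, abs_mul, ← hj] at h4
      rw [le_div_iff₀ hp]
      have h5 := mul_le_mul_of_nonneg_right (le_abs_self ((f j : ℝ) - f' j)) hp.le
      have h6 : |(16 : ℝ)| = 16 := by norm_num
      rw [h6] at h4
      linarith
    · have : 1 ≤ R / ‖p‖ := by rwa [le_div_iff₀ hp, one_mul]
      rw [mul_div_assoc]
      linarith
  have h1 := Finset.card_le_mul_card_image A _ hfib
  have h2 : (A.image (fun f => fun i : {i // i ≠ j} => f i)).card ≤ K ^ (Fintype.card ι - 1) := by
    refine (Finset.card_le_univ _).trans ?_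
    rw [Fintype.card_fun, Fintype.card_fin, Fintype.card_subtype_compl, Fintype.card_subtype_eq]
  have hR : 0 ≤ R := hp.le.trans hpR
  calc (A.card : ℝ) ≤ ((⌊2 * R / ‖p‖⌋₊ * K ^ (Fintype.card ι - 1) : ℕ) : ℝ) := by
        exact_mod_cast h1.trans (Nat.mul_le_mul_left _ h2)
    _ = (K : ℝ) ^ (Fintype.card ι - 1) * ⌊2 * R / ‖p‖⌋₊ := by push_cast; ring
    _ ≤ _ := by gcongr; exact Nat.floor_le (by positivity)

end

section

open Matrix

variable {ι κ : Type*} [Fintype ι] [DecidableEq ι] [Fintype κ] [DecidableEq κ]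

/-- The matrix of fractions with numerators `E` and denominator `K`. -/
noncomputable def frac {K : ℕ} (E : κ → ι → Fin K) : Matrix κ ι ℝ :=
  Matrix.of fun k i => (E k i : ℝ) / K

theorem lat_flow_frac_inr {K : ℕ} (hK : 0 < K) (E : κ → ι → Fin K)
    (h : Matrix (ι ⊕ κ) (ι ⊕ κ) ℝ) (z : ι ⊕ κ → ℤ) (k : κ) :
    lat (flow (16 * K) 1 (frac E) h) z (Sum.inr k) =
      16 * K * lat h z (Sum.inr k) + 16 * ∑ i, (E k i : ℝ) * lat h z (Sum.inl i) := by
  have hK' : (K : ℝ) ≠ 0 := by positivity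
  rw [lat_flow_inr, pow_one, mul_add]
  congr 1
  rw [Finset.mul_sum, Finset.mul_sum]
  refine Finset.sum_congr rfl fun i _ => ?_
  simp only [frac, Matrix.of_apply]
  field_simp

/-- If a lattice vector becomes short after one step, then its `ι`-part is not small. -/
theorem bounds_of_lat_flow_frac_lt [Nonempty ι] {K : ℕ} (hK : 0 < K) (E : κ → ι → Fin K)
    (h : Matrix (ι ⊕ κ) (ι ⊕ κ) ℝ) (z : ι ⊕ κ → ℤ) {e R : ℝ} (he : 0 < e) (hez : e ≤ ‖lat h z‖)
    (hR : R / (16 * K) ≤ e / 2) (hz : ‖lat (flow (16 * K) 1 (frac E) h) z‖ < R) :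
    e / (2 * Fintype.card ι) ≤ ‖fun i => lat h z (Sum.inl i)‖ ∧
      ‖lat h z‖ ≤ 2 * Fintype.card ι * ‖fun i => lat h z (Sum.inl i)‖ := by
  set u := ‖fun i => lat h z (Sum.inl i)‖ with hu
  set a := (Fintype.card ι : ℝ) with ha
  have ha1 : 1 ≤ a := by
    rw [ha]; exact_mod_cast Fintype.card_pos (α := ι)
  have hK' : (0 : ℝ) < K := by positivity
  have hp : ∀ i, |lat h z (Sum.inl i)| ≤ u := fun i =>
    norm_le_pi_norm (fun i => lat h z (Sum.inl i)) i
  have hu0 : 0 ≤ u := norm_nonneg _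
  have hq : ∀ k, |lat h z (Sum.inr k)| ≤ e / 2 + a * u := by
    intro k
    have h1 := (norm_le_pi_norm _ (Sum.inr k)).trans_lt hz
    rw [Real.norm_eq_abs, lat_flow_frac_inr hK] at h1
    have h2 : |∑ i, (E k i : ℝ) * lat h z (Sum.inl i)| ≤ K * (a * u) := by
      refine (Finset.abs_sum_le_sum_abs _ _).trans
        ((Finset.sum_le_card_nsmul _ _ (K * u) fun i _ => ?_).trans ?_)
      · rw [abs_mul, Nat.abs_cast]
        gcongr
        · exact (E k i).2.le
        · exact hp i
      · rw [nsmul_eq_mul, Finset.card_univ, ← ha]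
        exact le_of_eq (by ring)
    have h3 : |16 * K * lat h z (Sum.inr k)| ≤ R + 16 * (K * (a * u)) := by
      have h4 := abs_sub (16 * K * lat h z (Sum.inr k) + 16 * ∑ i, (E k i : ℝ) * lat h z (Sum.inl i))
        (16 * ∑ i, (E k i : ℝ) * lat h z (Sum.inl i))
      rw [add_sub_cancel_right] at h4
      rw [abs_mul 16 (∑ i, (E k i : ℝ) * lat h z (Sum.inl i)),
          abs_of_pos (by norm_num : (0:ℝ) < 16)]
        at h4
      linarith
    rw [abs_mul, abs_of_pos (by positivity)] at h3
    rw [div_le_iff₀ (by positivity)] at hR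
    have h5 : 16 * K * |lat h z (Sum.inr k)| ≤ 16 * K * (e / 2 + a * u) := by linarith
    exact le_of_mul_le_mul_left h5 (by positivity)
  have hbound : ∀ B, u ≤ B → e / 2 + a * u ≤ B → ‖lat h z‖ ≤ B := by
    intro B h1 h2
    refine (pi_norm_le_iff_of_nonneg (hu0.trans h1)).mpr ?_
    rintro (i | k)
    · exact (hp i).trans h1
    · exact (hq k).trans h2
  have hau : u ≤ a * u := le_mul_of_one_le_left hu0 ha1
  have h1 : e / (2 * a) ≤ u := by
    by_contra! hlt
    rw [lt_div_iff₀ (by positivity)] at hlt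
    rcases le_total u (e / 2 + a * u) with hle | hle
    · have := hbound _ hle le_rfl
      linarith
    · linarith
  refine ⟨h1, hbound _ (by linarith) ?_⟩
  rw [div_le_iff₀ (by positivity)] at h1
  linarith

theorem card_lat_flow_frac_lt_le {K : ℕ} (hK : 0 < K)
    (h : Matrix (ι ⊕ κ) (ι ⊕ κ) ℝ) (z : ι ⊕ κ → ℤ) {R : ℝ}
    (hz : 0 < ‖fun i => lat h z (Sum.inl i)‖) (hzR : ‖fun i => lat h z (Sum.inl i)‖ ≤ R)
    (T : Finset (κ → ι → Fin K))
    (hT : ∀ E ∈ T, ‖lat (flow (16 * K) 1 (frac E) h) z‖ < R) :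
    (T.card : ℝ) ≤ ((K : ℝ) ^ (Fintype.card ι - 1) * (2 * R / ‖fun i => lat h z (Sum.inl i)‖)) ^
      Fintype.card κ := by
  have hsub : T ⊆ Fintype.piFinset fun k => Finset.univ.filter fun f : ι → Fin K =>
      |16 * K * lat h z (Sum.inr k) + 16 * ∑ i, (f i : ℝ) * lat h z (Sum.inl i)| < R := by
    intro E hE
    rw [Fintype.mem_piFinset]
    intro k
    rw [Finset.mem_filter]
    refine ⟨Finset.mem_univ _, ?_⟩
    rw [← lat_flow_frac_inr hK]
    exact (norm_le_pi_norm _ (Sum.inr k)).trans_lt (hT E hE)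
  have h1 := Finset.card_le_card hsub
  rw [Fintype.card_piFinset] at h1
  refine (Nat.cast_le.mpr h1).trans ?_
  rw [Nat.cast_prod]
  refine (Finset.prod_le_prod (fun _ _ => Nat.cast_nonneg _) fun k _ =>
    card_row_le (fun i => lat h z (Sum.inl i)) _ R K hz hzR).trans ?_
  rw [Finset.prod_const, Finset.card_univ]

theorem exists_root (n : ℕ) (hn : n ≠ 0) {x : ℝ} (hx : 0 < x) : ∃ y : ℝ, 0 < y ∧ y ^ n = x :=
  ⟨x ^ ((n : ℝ)⁻¹), by positivity, Real.rpow_inv_natCast_pow hx.le hn⟩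

theorem card_not_good_flow_le_of_det_eq_one [Nonempty ι] [Nonempty κ] :
    ∃ ε₀ : ℝ, 0 < ε₀ ∧ ∀ ε : ℝ, 0 < ε → ∃ K₀ : ℕ, ∀ K ≥ K₀, ∀ h : Matrix (ι ⊕ κ) (ι ⊕ κ) ℝ,
      |h.det| = 1 → Good ε h → ∀ T : Finset (κ → ι → Fin K),
      (∀ E ∈ T, ¬ Good ε₀ (flow (16 * K) 1 (frac E) h)) →
      2 * (T.card : ℝ) ≤ (K : ℝ) ^ (Fintype.card ι * Fintype.card κ) := by
  classical
  set a := Fintype.card ι with ha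
  set b := Fintype.card κ with hb
  have ha1 : 1 ≤ a := Fintype.card_pos
  have hb1 : 1 ≤ b := Fintype.card_pos
  have ha1' : (1 : ℝ) ≤ a := by exact_mod_cast ha1
  have hcard : Fintype.card (ι ⊕ κ) = a + b := Fintype.card_sum
  set C0 : ℝ := (2 * (2 * a + (a + b))) ^ (a + b) with hC0
  have hC0pos : 0 < C0 := by positivity
  set ε₀ : ℝ := 1 / (4 * (32 ^ b * 2 ^ (b + 1) * C0)) with hε₀
  refine ⟨ε₀, by positivity, fun ε hε => ?_⟩
  set e := min ε 1 with he
  have he0 : 0 < e := lt_min hε one_pos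
  obtain ⟨M, hM0, hM⟩ := exists_bounded_matrix (ρ := ι ⊕ κ) he0
  set e1 := e / (2 * a) with he1
  have he10 : 0 < e1 := by positivity
  set C1 : ℝ := (2 * (2 * a * M + (a + b) * M)) ^ (a + b) with hC1
  have hC1pos : 0 < C1 := by positivity
  set τ := min (e / 2) (e1 / (32 * (4 * C1 + 1))) with hτ
  have hτ0 : 0 < τ := by positivity
  refine ⟨⌈ε₀ / τ ^ (a + b)⌉₊ + 1, fun K hK h hdet hgood T hT => ?_⟩
  have hKpos : 0 < K := by omega
  have hKpos' : (0 : ℝ) < K := by positivity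
  have hK1 : (1 : ℝ) ≤ K := by exact_mod_cast hKpos
  have hε₀pos : 0 < ε₀ := by positivity
  set N : ℝ := 16 * K with hN
  have hN0 : 0 < N := by positivity
  have hN1 : 1 ≤ N := by linarith
  have hNK : ε₀ / τ ^ (a + b) ≤ N := by
    have h1 := Nat.le_ceil (ε₀ / τ ^ (a + b))
    have h2 : ((⌈ε₀ / τ ^ (a + b)⌉₊ + 1 : ℕ) : ℝ) ≤ K := by exact_mod_cast hK
    push_cast at h2
    linarith
  obtain ⟨R, hR0, hR⟩ := exists_root (a + b) (by omega) (x := ε₀ * N ^ b) (by positivity)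
  have hRτ : R / N ≤ τ := by
    rw [← pow_le_pow_iff_left₀ (by positivity) hτ0.le (n := a + b) (by omega), div_pow, hR,
      div_le_iff₀ (by positivity)]
    rw [div_le_iff₀ (by positivity)] at hNK
    have h1 : N ≤ N ^ a := le_self_pow₀ hN1 (by omega)
    calc ε₀ * N ^ b ≤ N * τ ^ (a + b) * N ^ b := by gcongr
      _ ≤ N ^ a * τ ^ (a + b) * N ^ b := by gcongr
      _ = τ ^ (a + b) * N ^ (a + b) := by rw [pow_add]; ring
  have hex : ∀ E : κ → ι → Fin K, ∃ z : ι ⊕ κ → ℤ, E ∈ T →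
      z ≠ 0 ∧ ‖lat (flow N 1 (frac E) h) z‖ < R := by
    intro E
    by_cases hE : E ∈ T
    · have := hT E hE
      simp only [Good, not_forall, not_le] at this
      obtain ⟨z, hz0, hz⟩ := this
      rw [det_flow, hcard, abs_mul, hdet, mul_one, pow_one, abs_of_pos (by positivity), ← hb,
        ← hR] at hz
      exact ⟨z, fun _ => ⟨hz0, lt_of_pow_lt_pow_left₀ _ hR0.le hz⟩⟩
    · exact ⟨0, fun h => absurd h hE⟩
  choose w hw using hex
  set u : (ι ⊕ κ → ℤ) → ℝ := fun z => ‖fun i => lat h z (Sum.inl i)‖ with hu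
  set S := T.image w with hS
  have hSprop : ∀ z ∈ S, e1 ≤ u z ∧ ‖lat h z‖ ≤ 2 * a * u z ∧ u z ≤ R := by
    intro z hz
    obtain ⟨E, hE, rfl⟩ := Finset.mem_image.mp hz
    obtain ⟨hz0, hz⟩ := hw E hE
    obtain ⟨h1, h2⟩ := bounds_of_lat_flow_frac_lt hKpos E h _ he0 (hgood.le_norm hdet hz0)
      (hRτ.trans (min_le_left _ _)) hz
    refine ⟨h1, h2, (pi_norm_le_iff_of_nonneg hR0.le).mpr fun i => ?_⟩
    have := (norm_le_pi_norm _ (Sum.inl i)).trans hz.le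
    rwa [lat_flow_inl] at this
  have hcount : ∀ P, M ≤ P → ∀ S' ⊆ S, (∀ z ∈ S', u z ≤ P) →
      (S'.card : ℝ) ≤ (2 * (2 * a * P + (a + b) * M)) ^ (a + b) := by
    intro P hP S' hS' hS'P
    obtain ⟨Z, hZ, hZM⟩ := hM h hdet fun z hz => hgood.le_norm hdet hz
    have hP0 : 0 ≤ P := hM0.le.trans hP
    have := card_lat_le h hdet hZ hM0.le hZM (P := 2 * a * P) (by positivity) S'
      (fun z hz => (hSprop z (hS' hz)).2.1.trans (by gcongr; exact hS'P z hz))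
    rw [hcard] at this
    push_cast at this
    exact this
  have hsmall : ∑ z ∈ S.filter (fun z => u z < M), (1 / u z) ^ b ≤ C1 * (1 / e1) ^ b := by
    refine (Finset.sum_le_card_nsmul _ _ ((1 / e1) ^ b) fun z hz => ?_).trans ?_
    · have := (hSprop z (Finset.mem_filter.mp hz).1).1
      gcongr
    · rw [nsmul_eq_mul]
      refine mul_le_mul_of_nonneg_right ?_ (by positivity)
      exact hcount M le_rfl _ (Finset.filter_subset _ _) fun z hz => (Finset.mem_filter.mp hz).2.le
  have hlarge : ∑ z ∈ S.filter (fun z => ¬ u z < M), (1 / u z) ^ b ≤ 2 ^ (b + 1) * C0 * R ^ a := by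
    obtain ⟨J, hJ⟩ := pow_unbounded_of_one_lt (R / M) (by norm_num : (1 : ℝ) < 2)
    refine sum_inv_pow_le u hM0 hC0pos.le ha1 J _ R hR0
      (by rw [div_lt_iff₀ hM0] at hJ; linarith) (fun z hz => ?_) fun S' hS' P hP hS'P => ?_
    · obtain ⟨hz1, hz2⟩ := Finset.mem_filter.mp hz
      exact ⟨not_lt.mp hz2, (hSprop z hz1).2.2⟩
    · refine (hcount P hP S' (hS'.trans (Finset.filter_subset _ _)) hS'P).trans ?_
      rw [hC0, ← mul_pow]
      have hP0 : 0 ≤ P := hM0.le.trans hP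
      refine pow_le_pow_left₀ (by positivity) ?_ _
      have : ((a : ℝ) + b) * M ≤ (a + b) * P := by gcongr
      linarith
  have hsplit := Finset.sum_filter_add_sum_filter_not S (fun z => u z < M) (fun z => (1 / u z) ^ b)
  have hfiber : ∀ z ∈ S, ((T.filter fun E => w E = z).card : ℝ) ≤
      (K : ℝ) ^ (a * b) * (32 * (R / N)) ^ b * (1 / u z) ^ b := by
    intro z hz
    obtain ⟨h1, -, h3⟩ := hSprop z hz
    have hupos : 0 < u z := he10.trans_le h1
    refine (card_lat_flow_frac_lt_le hKpos h z hupos h3 _ fun E hE => ?_).trans (le_of_eq ?_)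
    · obtain ⟨hE1, rfl⟩ := Finset.mem_filter.mp hE
      exact (hw E hE1).2
    · rw [pow_mul, ← mul_pow, ← mul_pow]
      congr 1
      rw [← ha]
      obtain ⟨a', ha'⟩ : ∃ a', a = a' + 1 := ⟨a - 1, by omega⟩
      rw [ha', Nat.add_sub_cancel, hN]
      change (K : ℝ) ^ a' * (2 * R / u z) = _
      field_simp
      ring
  have hTsum : (T.card : ℝ) ≤ ∑ z ∈ S, (K : ℝ) ^ (a * b) * (32 * (R / N)) ^ b * (1 / u z) ^ b := by
    rw [Finset.card_eq_sum_card_image w T, Nat.cast_sum]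
    exact Finset.sum_le_sum hfiber
  rw [← Finset.mul_sum, ← hsplit] at hTsum
  have hRN0 : 0 < R / N := by positivity
  have hA : (32 * (R / N)) ^ b * (C1 * (1 / e1) ^ b) ≤ 1 / 4 := by
    have h1 : 32 * (R / N) * (1 / e1) ≤ 1 / (4 * C1 + 1) := by
      have h2 : R / N ≤ e1 / (32 * (4 * C1 + 1)) := hRτ.trans (min_le_right _ _)
      calc 32 * (R / N) * (1 / e1) ≤ 32 * (e1 / (32 * (4 * C1 + 1))) * (1 / e1) := by gcongr
        _ = 1 / (4 * C1 + 1) := by field_simp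
    have h3 : 1 / (4 * C1 + 1) ≤ 1 := by
      rw [div_le_one (by positivity)]; linarith
    calc (32 * (R / N)) ^ b * (C1 * (1 / e1) ^ b) = C1 * (32 * (R / N) * (1 / e1)) ^ b := by
          rw [mul_pow _ (1 / e1)]; ring
      _ ≤ C1 * (32 * (R / N) * (1 / e1)) := by
          gcongr
          exact pow_le_of_le_one (by positivity) (h1.trans h3) (by omega)
      _ ≤ C1 * (1 / (4 * C1 + 1)) := by gcongr
      _ ≤ 1 / 4 := by
          rw [mul_one_div, div_le_div_iff₀ (by positivity) (by norm_num)]; linarith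
  have hB : (32 * (R / N)) ^ b * (2 ^ (b + 1) * C0 * R ^ a) = 1 / 4 := by
    calc (32 * (R / N)) ^ b * (2 ^ (b + 1) * C0 * R ^ a)
        = 32 ^ b * 2 ^ (b + 1) * C0 * (R ^ (a + b)) / N ^ b := by
          rw [mul_pow, div_pow, pow_add]; ring
      _ = 1 / 4 := by
          rw [hR, hε₀]
          field_simp
  have hsum : (32 * (R / N)) ^ b * (∑ z ∈ S.filter (fun z => u z < M), (1 / u z) ^ b +
      ∑ z ∈ S.filter (fun z => ¬ u z < M), (1 / u z) ^ b) ≤ 1 / 2 := by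
    calc _ ≤ (32 * (R / N)) ^ b * (C1 * (1 / e1) ^ b + 2 ^ (b + 1) * C0 * R ^ a) := by gcongr
      _ ≤ 1 / 4 + 1 / 4 := by rw [mul_add, hB]; gcongr
      _ = 1 / 2 := by norm_num
  rw [mul_assoc] at hTsum
  have := mul_le_mul_of_nonneg_left hsum (by positivity : (0 : ℝ) ≤ (K : ℝ) ^ (a * b))
  linarith

/-- For a lattice without short vectors, most one-step perturbations yield again a lattice without
short vectors, with a constant `ε₀` not depending on the original lattice. -/
theorem card_not_good_flow_le [Nonempty ι] [Nonempty κ] :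
    ∃ ε₀ : ℝ, 0 < ε₀ ∧ ∀ ε : ℝ, 0 < ε → ∃ K₀ : ℕ, ∀ K ≥ K₀, ∀ h : Matrix (ι ⊕ κ) (ι ⊕ κ) ℝ,
      h.det ≠ 0 → Good ε h → ∀ T : Finset (κ → ι → Fin K),
      (∀ E ∈ T, ¬ Good ε₀ (flow (16 * K) 1 (frac E) h)) →
      2 * T.card ≤ K ^ (Fintype.card ι * Fintype.card κ) := by
  obtain ⟨ε₀, hε₀, H⟩ := card_not_good_flow_le_of_det_eq_one (ι := ι) (κ := κ)
  refine ⟨ε₀, hε₀, fun ε hε => ?_⟩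
  obtain ⟨K₀, HK⟩ := H ε hε
  refine ⟨K₀, fun K hK h hdet hg T hT => ?_⟩
  obtain ⟨s, hs, -, hs1⟩ := exists_smul_det_eq_one h hdet
  have := HK K hK (s • h) hs1 ((good_smul hs h).mpr hg) T fun E hE => by
    rw [flow_smul, good_smul hs]
    exact hT E hE
  exact_mod_cast this

end

section

open Matrix

variable {ι κ : Type*} [Fintype ι] [DecidableEq ι] [Fintype κ] [DecidableEq κ]

theorem flow_flow {N : ℝ} (hN : N ≠ 0) (s t : ℕ) (η η' : Matrix κ ι ℝ)
    (h : Matrix (ι ⊕ κ) (ι ⊕ κ) ℝ) :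
    flow N t η' (flow N s η h) = flow N (s + t) (η + (N ^ s)⁻¹ • η') h := by
  have hs : N ^ s ≠ 0 := pow_ne_zero _ hN
  rw [flow, flow, flow, ← Matrix.mul_assoc, Matrix.fromBlocks_multiply]
  congr 1
  congr 1
  · simp
  · simp
  · simp only [Matrix.mul_one, Matrix.smul_mul, Matrix.one_mul, smul_smul, smul_add]
    rw [pow_add, mul_assoc, mul_comm (N ^ t) (N ^ s)⁻¹, mul_inv_cancel_left₀ hs, add_comm,
      mul_comm (N ^ t)]
  · simp [smul_smul, pow_add]

theorem abs_sum_mul_le {B : ℝ} (c x : ι → ℝ) (hc : ∀ i, |c i| ≤ B) {y : ℝ}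
    (hx : ∀ i, |x i| ≤ y) : |∑ i, c i * x i| ≤ Fintype.card ι * (B * y) := by
  refine (Finset.abs_sum_le_sum_abs _ _).trans
    ((Finset.sum_le_card_nsmul _ _ (B * y) fun i _ => ?_).trans ?_)
  · rw [abs_mul]
    have := hc i
    have := hx i
    have := abs_nonneg (c i)
    gcongr
    linarith
  · rw [nsmul_eq_mul, Finset.card_univ]

theorem norm_lat_flow_zero_le (N : ℝ) {B : ℝ} (hB : 0 ≤ B) {η : Matrix κ ι ℝ}
    (hη : ∀ k i, |η k i| ≤ B) (h : Matrix (ι ⊕ κ) (ι ⊕ κ) ℝ) (z : ι ⊕ κ → ℤ) :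
    ‖lat (flow N 0 η h) z‖ ≤ (1 + Fintype.card ι * B) * ‖lat h z‖ := by
  have h0 := norm_nonneg (lat h z)
  have hi : ∀ i, |lat h z i| ≤ ‖lat h z‖ := fun i => norm_le_pi_norm (lat h z) i
  have h1 : 0 ≤ Fintype.card ι * (B * ‖lat h z‖) := by positivity
  refine (pi_norm_le_iff_of_nonneg (by positivity)).mpr ?_
  rintro (i | k)
  · rw [lat_flow_inl]
    have := hi (Sum.inl i)
    rw [Real.norm_eq_abs]
    linarith
  · rw [lat_flow_inr, pow_zero, one_mul, Real.norm_eq_abs]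
    have h2 := abs_sum_mul_le (η k) (fun i => lat h z (Sum.inl i)) (hη k) fun i => hi _
    have h3 := hi (Sum.inr k)
    have h4 := abs_add_le (lat h z (Sum.inr k)) (∑ i, η k i * lat h z (Sum.inl i))
    linarith

theorem norm_le_norm_lat_flow_zero {N : ℝ} (hN : N ≠ 0) {B : ℝ} (hB : 0 ≤ B) {η : Matrix κ ι ℝ}
    (hη : ∀ k i, |η k i| ≤ B) (h : Matrix (ι ⊕ κ) (ι ⊕ κ) ℝ) (z : ι ⊕ κ → ℤ) :
    ‖lat h z‖ ≤ (1 + Fintype.card ι * B) * ‖lat (flow N 0 η h) z‖ := by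
  have h1 : flow N 0 (-η) (flow N 0 η h) = h := by
    rw [flow_flow hN]
    simp [flow]
  conv_lhs => rw [← h1]
  exact norm_lat_flow_zero_le N hB (fun k i => by simpa using hη k i) _ _

theorem Good.flow_zero {N : ℝ} (hN : N ≠ 0) {B : ℝ} (hB : 0 ≤ B) {η : Matrix κ ι ℝ}
    (hη : ∀ k i, |η k i| ≤ B) {h : Matrix (ι ⊕ κ) (ι ⊕ κ) ℝ} {ε : ℝ} (hg : Good ε h) :
    Good (ε / (1 + Fintype.card ι * B) ^ Fintype.card (ι ⊕ κ)) (flow N 0 η h) := by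
  intro z hz
  rw [det_flow, pow_zero, one_pow, one_mul, div_mul_eq_mul_div, div_le_iff₀ (by positivity)]
  refine (hg z hz).trans ?_
  rw [← mul_pow, mul_comm]
  exact pow_le_pow_left₀ (norm_nonneg _) (norm_le_norm_lat_flow_zero hN hB hη h z) _

theorem det_flow_ne_zero {N : ℝ} (hN : N ≠ 0) (t : ℕ) (η : Matrix κ ι ℝ)
    {h : Matrix (ι ⊕ κ) (ι ⊕ κ) ℝ} (hdet : h.det ≠ 0) : (flow N t η h).det ≠ 0 := by
  rw [det_flow]
  positivity

theorem exists_flow_good [Nonempty ι] [Nonempty κ] {ε : ℝ} (hε : 0 < ε) :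
    ∃ c : ℝ, 0 < c ∧ ∃ K₀ : ℕ, ∀ K ≥ K₀, ∀ h : Matrix (ι ⊕ κ) (ι ⊕ κ) ℝ,
      h.det ≠ 0 → Good ε h → ∀ T : ℕ, ∃ η : Matrix κ ι ℝ, (∀ k i, |η k i| ≤ 1) ∧
        ∀ t ≤ T, Good c (flow (16 * K) t η h) := by
  classical
  obtain ⟨ε₀, hε₀, H⟩ := card_not_good_flow_le (ι := ι) (κ := κ)
  obtain ⟨K₀, HK⟩ := H (min ε ε₀) (lt_min hε hε₀)
  refine ⟨min ε ε₀ / (1 + Fintype.card ι * 1) ^ Fintype.card (ι ⊕ κ), by positivity,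
    max K₀ 1, fun K hK => ?_⟩
  have hKpos : 0 < K := lt_of_lt_of_le one_pos ((le_max_right _ _).trans hK)
  have hKpos' : (0 : ℝ) < K := by positivity
  have hN : (16 * K : ℝ) ≠ 0 := by positivity
  suffices key : ∀ T : ℕ, ∀ h : Matrix (ι ⊕ κ) (ι ⊕ κ) ℝ, h.det ≠ 0 → Good (min ε ε₀) h →
      ∃ η : Matrix κ ι ℝ, (∀ k i, 0 ≤ η k i ∧ η k i ≤ 1) ∧
        ∀ t ≤ T, Good (min ε ε₀ / (1 + Fintype.card ι * 1) ^ Fintype.card (ι ⊕ κ))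
          (flow (16 * K) t η h) by
    intro h hdet hg T
    obtain ⟨η, h1, h2⟩ := key T h hdet (hg.mono (min_le_left _ _))
    exact ⟨η, fun k i => abs_le.mpr ⟨by linarith [(h1 k i).1], (h1 k i).2⟩, h2⟩
  intro T
  induction T with
  | zero =>
    intro h hdet hg
    refine ⟨0, fun _ _ => ⟨le_rfl, zero_le_one⟩, fun t ht => ?_⟩
    obtain rfl : t = 0 := by omega
    exact hg.flow_zero hN zero_le_one fun _ _ => by simp
  | succ T ih =>
    intro h hdet hg
    obtain ⟨E, hE⟩ : ∃ E : κ → ι → Fin K, Good ε₀ (flow (16 * K) 1 (frac E) h) := by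
      by_contra! hcon
      have h1 := HK K ((le_max_left _ _).trans hK) h hdet hg Finset.univ fun E _ => hcon E
      rw [Finset.card_univ, Fintype.card_fun, Fintype.card_fun, Fintype.card_fin, ← pow_mul] at h1
      have : 0 < K ^ (Fintype.card ι * Fintype.card κ) := by positivity
      omega
    obtain ⟨η₁, hη₁, hη₁'⟩ := ih _ (det_flow_ne_zero hN 1 (frac E) hdet)
      (hE.mono (min_le_right _ _))
    have hη : ∀ k i, 0 ≤ (frac E + (16 * K : ℝ)⁻¹ • η₁) k i ∧
        (frac E + (16 * K : ℝ)⁻¹ • η₁) k i ≤ 1 := by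
      intro k i
      obtain ⟨h1, h2⟩ := hη₁ k i
      have h3 : ((E k i : ℕ) : ℝ) + 1 ≤ K := by exact_mod_cast (E k i).2
      simp only [Matrix.add_apply, frac, Matrix.of_apply, Matrix.smul_apply, smul_eq_mul]
      refine ⟨by positivity, ?_⟩
      rw [inv_mul_eq_div, div_add_div _ _ hKpos'.ne' hN, div_le_one (by positivity)]
      nlinarith
    refine ⟨_, hη, fun t ht => ?_⟩
    rcases t with _ | t
    · exact hg.flow_zero hN zero_le_one fun k i => abs_le.mpr
        ⟨by linarith [(hη k i).1], (hη k i).2⟩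
    · have := hη₁' t (by omega)
      rwa [flow_flow hN, pow_one, add_comm 1 t] at this

end

section

open Matrix

section Elim

variable {ρ Δ R : Type*} [Fintype ρ] [DecidableEq ρ] [Fintype Δ] [DecidableEq Δ] [CommRing R]

/-- A matrix whose columns lie in the hyperplane orthogonal to `ω`. -/
def elimMatrix (ψ : Option ρ ≃ Δ) (ω : Δ → R) : Matrix Δ ρ R :=
  Matrix.of fun j i =>
    if j = ψ none then -ω (ψ (some i)) else if j = ψ (some i) then ω (ψ none) else 0

variable (ψ : Option ρ ≃ Δ) (ω : Δ → R)

theorem elimMatrix_mulVec_some (c : ρ → R) (i : ρ) :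
    (elimMatrix ψ ω *ᵥ c) (ψ (some i)) = ω (ψ none) * c i := by
  simp [elimMatrix, Matrix.mulVec, dotProduct]

theorem elimMatrix_mulVec_none (c : ρ → R) :
    (elimMatrix ψ ω *ᵥ c) (ψ none) = -∑ i, ω (ψ (some i)) * c i := by
  simp [elimMatrix, Matrix.mulVec, dotProduct]

theorem dotProduct_equiv_option (x y : Δ → R) :
    x ⬝ᵥ y = x (ψ none) * y (ψ none) + ∑ i, x (ψ (some i)) * y (ψ (some i)) := by
  rw [dotProduct, ← ψ.sum_comp, Fintype.sum_option]

theorem dotProduct_elimMatrix_mulVec (c : ρ → R) : ω ⬝ᵥ (elimMatrix ψ ω *ᵥ c) = 0 := by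
  rw [dotProduct_equiv_option ψ, elimMatrix_mulVec_none]
  simp only [elimMatrix_mulVec_some]
  rw [mul_neg, neg_add_eq_zero, Finset.mul_sum]
  exact Finset.sum_congr rfl fun i _ => by ring

theorem elimMatrix_mulVec_of_dotProduct_eq_zero {y : Δ → R} (hy : ω ⬝ᵥ y = 0) :
    elimMatrix ψ ω *ᵥ (fun i => y (ψ (some i))) = ω (ψ none) • y := by
  funext j
  obtain ⟨o, rfl⟩ := ψ.surjective j
  rcases o with _ | i
  · rw [elimMatrix_mulVec_none]
    rw [dotProduct_equiv_option ψ] at hy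
    rw [Pi.smul_apply, smul_eq_mul, eq_neg_of_add_eq_zero_left hy]
  · rw [elimMatrix_mulVec_some, Pi.smul_apply, smul_eq_mul]

theorem eq_zero_of_elimMatrix_mulVec_eq_zero [IsDomain R] (hω : ω (ψ none) ≠ 0) {c : ρ → R}
    (hc : elimMatrix ψ ω *ᵥ c = 0) : c = 0 := by
  funext i
  have := congrFun hc (ψ (some i))
  rw [elimMatrix_mulVec_some] at this
  simpa [hω] using this

end Elim

theorem intCast_mulVec {α β : Type*} [Fintype β] (A : Matrix α β ℤ) (x : β → ℤ) :
    (fun i => ((A *ᵥ x) i : ℝ)) = A.map (Int.cast : ℤ → ℝ) *ᵥ fun i => (x i : ℝ) := by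
  funext i
  simp [Matrix.mulVec, dotProduct]

theorem intCast_dotProduct {β : Type*} [Fintype β] (x y : β → ℤ) :
    ((x ⬝ᵥ y : ℤ) : ℝ) = (fun i => (x i : ℝ)) ⬝ᵥ fun i => (y i : ℝ) := by
  simp [dotProduct]

theorem elimMatrix_map {ρ Δ : Type*} [DecidableEq Δ] (ψ : Option ρ ≃ Δ) (ω : Δ → ℤ) :
    (elimMatrix ψ ω).map (Int.cast : ℤ → ℝ) = elimMatrix ψ fun i => (ω i : ℝ) := by
  ext j i
  simp only [elimMatrix, Matrix.map_apply, Matrix.of_apply]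
  split_ifs <;> simp

section Hyperplane

variable {ρ Δ : Type*} [Fintype ρ] [DecidableEq ρ] [Fintype Δ] [DecidableEq Δ]

theorem norm_le_norm_of_dotProduct_eq_zero (φ : Option ρ ≃ Δ) {w v : Δ → ℝ}
    (hw1 : w (φ none) = 1) (hw : ∀ i, i ≠ φ none → |w i| ≤ 1 / Fintype.card Δ)
    (hwv : w ⬝ᵥ v = 0) : ‖v‖ ≤ ‖fun r => v (φ (some r))‖ := by
  set y := ‖fun r => v (φ (some r))‖ with hy
  have hy0 : 0 ≤ y := norm_nonneg _
  have hvr : ∀ r, |v (φ (some r))| ≤ y := fun r => norm_le_pi_norm (fun r => v (φ (some r))) r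
  refine (pi_norm_le_iff_of_nonneg hy0).mpr fun j => ?_
  obtain ⟨o, rfl⟩ := φ.surjective j
  rcases o with _ | r
  · rw [dotProduct_equiv_option φ, hw1, one_mul] at hwv
    rw [Real.norm_eq_abs, eq_neg_of_add_eq_zero_left hwv, abs_neg]
    refine (abs_sum_mul_le _ _ (fun r => hw _ (by simp)) hvr).trans ?_
    have hc : Fintype.card Δ = Fintype.card ρ + 1 := by
      rw [← Fintype.card_congr φ, Fintype.card_option]
    rw [hc, ← mul_assoc]
    refine mul_le_of_le_one_left hy0 ?_
    push_cast
    rw [mul_one_div, div_le_one (by positivity)]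
    linarith
  · exact hvr r

theorem abs_adjugate_le {A : Matrix Δ Δ ℝ} {M : ℝ} (hM : 1 ≤ M) (hA : ∀ i j, |A i j| ≤ M)
    (i j : Δ) : |A.adjugate i j| ≤ (Fintype.card Δ).factorial * M ^ Fintype.card Δ := by
  rw [Matrix.adjugate_apply]
  have := Matrix.det_le (abv := AbsoluteValue.abs) (A := A.updateRow j (Pi.single i 1)) (x := M)
    (fun k l => by
      simp only [AbsoluteValue.abs_apply, Matrix.updateRow_apply]
      split_ifs
      · rw [Pi.single_apply]
        split_ifs <;> simp <;> linarith
      · exact hA k l)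
  simpa [nsmul_eq_mul] using this

theorem one_div_le_abs_det {g : Matrix ρ ρ ℝ} {e : ℝ} (he : 0 < e) (hdet : g.det ≠ 0)
    (hg : ∀ z ≠ 0, e ≤ ‖lat g z‖) : (e / 2) ^ Fintype.card ρ ≤ |g.det| := by
  by_contra! hlt
  obtain ⟨z, hz0, hz⟩ := exists_lat_le g hdet (fun _ => e / 2) (fun _ => by positivity)
    (by rw [Finset.prod_const, Finset.card_univ]; exact hlt)
  have : ‖lat g z‖ ≤ e / 2 := (pi_norm_le_iff_of_nonneg (by positivity)).mpr hz
  linarith [hg z hz0]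

/-- A lattice without short vectors has a sublattice of bounded index in a hyperplane that is
close to the coordinate hyperplane of the coordinate `φ none`. -/
theorem exists_hyperplane (φ : Option ρ ≃ Δ) {e : ℝ} (he : 0 < e) :
    ∃ B : ℝ, 0 < B ∧ ∀ h : Matrix Δ Δ ℝ, |h.det| = 1 → (∀ z ≠ 0, e ≤ ‖lat h z‖) →
      ∃ (w : Δ → ℝ) (G : Matrix Δ ρ ℝ),
        w (φ none) = 1 ∧ (∀ i, i ≠ φ none → |w i| ≤ 1 / Fintype.card Δ) ∧
        (∀ c ≠ 0, ∃ z ≠ 0, lat h z = lat G c) ∧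
        (∀ z ≠ 0, w ⬝ᵥ lat h z = 0 → ∃ c ≠ 0, ∃ l : ℝ, |l| ≤ B ∧ lat G c = l • lat h z) ∧
        (∀ c, w ⬝ᵥ lat G c = 0) ∧
        (∀ z, w ⬝ᵥ lat h z ≠ 0 → 1 / B ≤ |w ⬝ᵥ lat h z|) ∧
        1 / B ≤ |(G.submatrix (fun r => φ (some r)) id).det| ∧
        |(G.submatrix (fun r => φ (some r)) id).det| ≤ B ∧
        ∀ c ≠ 0, e ≤ ‖lat (G.submatrix (fun r => φ (some r)) id) c‖ := by
  obtain ⟨M, hM0, hM⟩ := exists_bounded_matrix (ρ := Δ) he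
  have hΔ : Nonempty Δ := ⟨φ none⟩
  set d := Fintype.card Δ with hd
  have hd1 : (1 : ℝ) ≤ d := by exact_mod_cast Fintype.card_pos (α := Δ)
  set M₁ := max M 1 with hM₁
  have hM₁1 : 1 ≤ M₁ := le_max_right _ _
  set A := (d.factorial : ℝ) * M₁ ^ d with hA
  have hA0 : 0 < A := by positivity
  set M' := d * A with hM'
  have hM'0 : 0 < M' := by positivity
  set R := (d + 1) * M' with hR
  have hR0 : 0 < R := by positivity
  set W := R * M₁ + 1 with hW
  have hW0 : 0 < W := by positivity
  set E := ((Fintype.card ρ).factorial : ℝ) * (d * (M₁ * W)) ^ Fintype.card ρ with hE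
  set F := (e / 2) ^ Fintype.card ρ with hF
  have hF0 : 0 < F := by positivity
  set B := max (max (W * A) (A * (R + M'))) (max E (1 / F)) with hB
  have hBpos : 0 < B := lt_of_lt_of_le (by positivity : 0 < W * A)
    ((le_max_left _ _).trans (le_max_left _ _))
  refine ⟨B, hBpos, fun h hdet hmin => ?_⟩
  obtain ⟨Z, hZ, hZM⟩ := hM h hdet hmin
  set Zr := Z.map (Int.cast : ℤ → ℝ) with hZr
  set V := h * Zr with hV
  have hVM : ∀ i j, |V i j| ≤ M₁ := by
    intro i j
    have h1 := (norm_le_pi_norm (lat h fun i => Z i j) i).trans (hZM j)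
    exact h1.trans (le_max_left _ _)
  have hZdet : Zr.det = (Z.det : ℝ) := (Int.cast_det Z).symm
  have hVdet : |V.det| = |(Z.det : ℝ)| := by
    rw [hV, Matrix.det_mul, abs_mul, hdet, one_mul, hZdet]
  have hk1 : 1 ≤ |(Z.det : ℝ)| := by
    rw [← Int.cast_abs]; exact_mod_cast Int.one_le_abs hZ
  have hVdet0 : V.det ≠ 0 := by
    rw [← abs_pos, hVdet]; linarith
  have hkA : |(Z.det : ℝ)| ≤ A := by
    rw [← hVdet]
    have := Matrix.det_le (abv := AbsoluteValue.abs) (A := V) (x := M₁) hVM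
    simpa [nsmul_eq_mul] using this
  have hVinv : ∀ i j, |V⁻¹ i j| ≤ A := by
    intro i j
    rw [Matrix.inv_def, Matrix.smul_apply, smul_eq_mul, Ring.inverse_eq_inv', abs_mul, abs_inv,
      hVdet]
    refine (mul_le_of_le_one_left (abs_nonneg _) (inv_le_one_of_one_le₀ hk1)).trans ?_
    exact abs_adjugate_le hM₁1 hVM i j
  set n₀ := φ none with hn₀
  set ω : Δ → ℤ := fun j => round (R * V n₀ j) with hω
  set ωr : Δ → ℝ := fun j => (ω j : ℝ) with hωr
  have hωerr : ∀ j, |ωr j - R * V n₀ j| ≤ 1 := by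
    intro j
    rw [abs_sub_comm]
    exact (abs_sub_round _).trans (by norm_num)
  have hωW : ∀ j, |ωr j| ≤ W := by
    intro j
    have h1 := abs_sub_abs_le_abs_sub (ωr j) (R * V n₀ j)
    have h2 : |R * V n₀ j| ≤ R * M₁ := by
      rw [abs_mul, abs_of_pos hR0]
      exact mul_le_mul_of_nonneg_left (hVM _ _) hR0.le
    linarith [hωerr j]
  set w₀ := ωr ᵥ* V⁻¹ with hw₀
  have hw₀V : w₀ ᵥ* V = ωr := by
    rw [hw₀, Matrix.vecMul_vecMul, Matrix.nonsing_inv_mul _ (isUnit_iff_ne_zero.mpr hVdet0),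
      Matrix.vecMul_one]
  have hw₀err : ∀ i, |w₀ i - R * (Pi.single n₀ (1 : ℝ) : Δ → ℝ) i| ≤ M' := by
    intro i
    have h1 : w₀ i - R * (Pi.single n₀ (1 : ℝ) : Δ → ℝ) i =
        ∑ j, (ωr j - R * V n₀ j) * V⁻¹ j i := by
      have h2 : ∑ j, V n₀ j * V⁻¹ j i = (Pi.single n₀ (1 : ℝ) : Δ → ℝ) i := by
        rw [← Matrix.mul_apply, Matrix.mul_nonsing_inv _ (isUnit_iff_ne_zero.mpr hVdet0),
          Matrix.one_apply, Pi.single_apply]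
        simp only [eq_comm]
      rw [← h2, hw₀]
      simp only [Matrix.vecMul, dotProduct]
      rw [Finset.mul_sum, ← Finset.sum_sub_distrib]
      exact Finset.sum_congr rfl fun j _ => by ring
    rw [h1]
    refine (abs_sum_mul_le _ _ hωerr fun j => hVinv j i).trans (le_of_eq ?_)
    rw [one_mul]
  have hw₀n : |w₀ n₀ - R| ≤ M' := by simpa using hw₀err n₀
  rw [abs_le] at hw₀n
  have hw₀lo : d * M' ≤ w₀ n₀ := by rw [hR] at hw₀n; linarith [hw₀n.1]
  have hw₀pos : 0 < w₀ n₀ := lt_of_lt_of_le (by positivity) hw₀lo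
  have hw₀hi : w₀ n₀ ≤ R + M' := by linarith [hw₀n.2]
  obtain ⟨j₀, hj₀⟩ : ∃ j, ω j ≠ 0 := by
    by_contra! hcon
    have : ωr = 0 := by funext j; simp [hωr, hcon j]
    rw [hw₀, this, Matrix.zero_vecMul] at hw₀pos
    simp at hw₀pos
  set ψ : Option ρ ≃ Δ := φ.trans (Equiv.swap n₀ j₀) with hψ
  have hψn : ψ none = j₀ := by simp [hψ, hn₀]
  have hωψ : ω (ψ none) ≠ 0 := by rwa [hψn]
  have hωψr : ωr (ψ none) ≠ 0 := by simpa [hωr] using hωψ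
  set U := elimMatrix ψ ωr with hU
  set w := (w₀ n₀)⁻¹ • w₀ with hw
  set G := V * U with hG
  have hwV : ∀ x, w ⬝ᵥ (V *ᵥ x) = (w₀ n₀)⁻¹ * (ωr ⬝ᵥ x) := by
    intro x
    rw [hw, smul_dotProduct, Matrix.dotProduct_mulVec, hw₀V, smul_eq_mul]
  have hwG : ∀ x, w ⬝ᵥ (G *ᵥ x) = 0 := by
    intro x
    rw [hG, ← Matrix.mulVec_mulVec, hwV, dotProduct_elimMatrix_mulVec, mul_zero]
  have hVinj : ∀ x, V *ᵥ x = 0 → x = 0 := fun x hx =>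
    Matrix.eq_zero_of_mulVec_eq_zero hVdet0 hx
  have hGinj : ∀ x, G *ᵥ x = 0 → x = 0 := by
    intro x hx
    rw [hG, ← Matrix.mulVec_mulVec] at hx
    exact eq_zero_of_elimMatrix_mulVec_eq_zero ψ ωr hωψr (hVinj _ hx)
  have hcast : ∀ {σ : Type _} [Fintype σ] (c : σ → ℤ), (fun i => (c i : ℝ)) = 0 → c = 0 := by
    intro σ _ c hc
    funext i
    simpa using congrFun hc i
  have hw1 : w n₀ = 1 := by
    rw [hw, Pi.smul_apply, smul_eq_mul, inv_mul_cancel₀ hw₀pos.ne']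
  have hwi : ∀ i, i ≠ n₀ → |w i| ≤ 1 / d := by
    intro i hi
    have h1 := hw₀err i
    rw [Pi.single_eq_of_ne hi, mul_zero, sub_zero] at h1
    rw [hw, Pi.smul_apply, smul_eq_mul, abs_mul, abs_inv, abs_of_pos hw₀pos, inv_mul_eq_div]
    rw [div_le_div_iff₀ hw₀pos (by positivity), one_mul]
    calc |w₀ i| * d ≤ M' * d := by gcongr
      _ ≤ w₀ n₀ := by linarith
  have hsub : ∀ c, ∃ z, lat h z = lat G c := by
    intro c
    refine ⟨Z *ᵥ (elimMatrix ψ ω *ᵥ c), ?_⟩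
    rw [lat, intCast_mulVec, intCast_mulVec, elimMatrix_map, lat, hG, ← Matrix.mulVec_mulVec, hV,
      ← Matrix.mulVec_mulVec]
  have hsub' : ∀ c ≠ 0, ∃ z ≠ 0, lat h z = lat G c := by
    intro c hc
    obtain ⟨z, hz⟩ := hsub c
    refine ⟨z, ?_, hz⟩
    rintro rfl
    apply hc
    apply hcast
    apply hGinj
    change lat G c = 0
    rw [← hz]
    simp [lat, ← Pi.zero_def]
  have hadj : ∀ z : Δ → ℤ, V *ᵥ (fun i => ((Z.adjugate *ᵥ z) i : ℝ)) = (Z.det : ℝ) • lat h z := by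
    intro z
    have h1 : Z *ᵥ (Z.adjugate *ᵥ z) = Z.det • z := by
      rw [Matrix.mulVec_mulVec, Matrix.mul_adjugate, Matrix.smul_mulVec, Matrix.one_mulVec]
    have h2 := intCast_mulVec Z (Z.adjugate *ᵥ z)
    rw [hV, ← Matrix.mulVec_mulVec, ← h2, h1, lat, ← Matrix.mulVec_smul]
    congr 1
    funext i
    simp
  have hkey : ∀ z : Δ → ℤ, w₀ n₀ * ((Z.det : ℝ) * (w ⬝ᵥ lat h z)) =
      ((ω ⬝ᵥ (Z.adjugate *ᵥ z) : ℤ) : ℝ) := by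
    intro z
    rw [intCast_dotProduct, ← smul_eq_mul (Z.det : ℝ), ← dotProduct_smul, ← hadj, hwV,
      mul_inv_cancel_left₀ hw₀pos.ne']
  refine ⟨w, G, hw1, hwi, hsub', ?_, fun c => hwG _, ?_, ?_⟩
  · intro z hz hwz
    have h0 : ω ⬝ᵥ (Z.adjugate *ᵥ z) = 0 := by
      have := hkey z
      rw [hwz, mul_zero, mul_zero] at this
      exact_mod_cast this.symm
    have h0r : ωr ⬝ᵥ (fun i => ((Z.adjugate *ᵥ z) i : ℝ)) = 0 := by
      rw [← intCast_dotProduct, h0, Int.cast_zero]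
    have hl : lat G (fun i => (Z.adjugate *ᵥ z) (ψ (some i))) =
        (ωr (ψ none) * Z.det) • lat h z := by
      have := elimMatrix_mulVec_of_dotProduct_eq_zero ψ ωr h0r
      rw [lat, hG, ← Matrix.mulVec_mulVec, this, Matrix.mulVec_smul, hadj, smul_smul]
    refine ⟨_, ?_, _, ?_, hl⟩
    · intro hc
      rw [hc] at hl
      have h1 : lat G 0 = 0 := by simp [lat, ← Pi.zero_def]
      rw [h1] at hl
      have h2 : ωr (ψ none) * Z.det ≠ 0 :=
        mul_ne_zero hωψr (by exact_mod_cast hZ)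
      have h3 := (smul_eq_zero.mp hl.symm).resolve_left h2
      have h4 := hmin z hz
      rw [h3, norm_zero] at h4
      linarith
    · rw [abs_mul]
      calc |ωr (ψ none)| * |(Z.det : ℝ)| ≤ W * A := by gcongr; exact hωW _
        _ ≤ B := (le_max_left _ _).trans (le_max_left _ _)
  · intro z hz
    have h1 : ω ⬝ᵥ (Z.adjugate *ᵥ z) ≠ 0 := by
      intro h0
      have := hkey z
      rw [h0, Int.cast_zero] at this
      have hk0 : (Z.det : ℝ) ≠ 0 := by exact_mod_cast hZ
      simp [hw₀pos.ne', hk0, hz] at this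
    have h2 : 1 ≤ |w₀ n₀ * ((Z.det : ℝ) * (w ⬝ᵥ lat h z))| := by
      rw [hkey, ← Int.cast_abs]; exact_mod_cast Int.one_le_abs h1
    rw [abs_mul, abs_mul, abs_of_pos hw₀pos] at h2
    rw [div_le_iff₀ hBpos]
    calc 1 ≤ w₀ n₀ * (|(Z.det : ℝ)| * |w ⬝ᵥ lat h z|) := h2
      _ ≤ (R + M') * (A * |w ⬝ᵥ lat h z|) := by gcongr
      _ = |w ⬝ᵥ lat h z| * (A * (R + M')) := by ring
      _ ≤ |w ⬝ᵥ lat h z| * B := by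
        gcongr
        exact (le_max_right _ _).trans (le_max_left _ _)
  · set g := G.submatrix (fun r => φ (some r)) id with hg
    have hgv : ∀ x, g *ᵥ x = fun r => (G *ᵥ x) (φ (some r)) := fun x => rfl
    have hnorm : ∀ x, ‖G *ᵥ x‖ ≤ ‖g *ᵥ x‖ := by
      intro x
      rw [hgv]
      exact norm_le_norm_of_dotProduct_eq_zero φ hw1 hwi (hwG x)
    have hgmin : ∀ c ≠ 0, e ≤ ‖lat g c‖ := by
      intro c hc
      obtain ⟨z, hz, hzc⟩ := hsub' c hc
      refine (hmin z hz).trans ?_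
      rw [hzc]
      exact hnorm _
    have hgdet : g.det ≠ 0 := by
      intro h0
      obtain ⟨x, hx0, hx⟩ := Matrix.exists_mulVec_eq_zero_iff.mpr h0
      apply hx0
      apply hGinj
      have := hnorm x
      rw [hx, norm_zero] at this
      exact norm_le_zero_iff.mp this
    refine ⟨?_, ?_, hgmin⟩
    · have h1 := one_div_le_abs_det he hgdet hgmin
      refine le_trans ?_ h1
      rw [div_le_iff₀ hBpos, ← div_le_iff₀' hF0]
      exact (le_max_right _ _).trans (le_max_right _ _)
    · refine le_trans ?_ ((le_max_left _ _).trans (le_max_right _ _))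
      have hUW : ∀ j i, |U j i| ≤ W := by
        intro j i
        simp only [hU, elimMatrix, Matrix.of_apply]
        split_ifs
        · rw [abs_neg]; exact hωW _
        · exact hωW _
        · simpa using hW0.le
      have hgE : ∀ i j, |g i j| ≤ d * (M₁ * W) := by
        intro i j
        change |(V * U) (φ (some i)) j| ≤ _
        rw [Matrix.mul_apply]
        exact abs_sum_mul_le _ _ (fun k => hVM _ k) fun k => hUW k j
      have := Matrix.det_le (abv := AbsoluteValue.abs) (A := g) (x := d * (M₁ * W)) hgE
      simpa [nsmul_eq_mul] using this

end Hyperplane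

end

section

open Matrix

section Excursion

theorem abs_sum_mul_le_of_card_mul_le {ι : Type*} [Fintype ι] {B : ℝ} (c x : ι → ℝ) {y : ℝ}
    (hy : 0 ≤ y) (hB : Fintype.card ι * B ≤ 1) (hc : ∀ i, |c i| ≤ B) (hx : ∀ i, |x i| ≤ y) :
    |∑ i, c i * x i| ≤ y := by
  classical
  refine (abs_sum_mul_le c x hc hx).trans ?_
  rw [← mul_assoc]
  exact mul_le_of_le_one_left hy hB

/-- The matrix of the map `(p, q) ↦ (p, N ^ t (q + η p))`. -/
def shear {ι κ : Type*} [DecidableEq ι] [DecidableEq κ] (N : ℝ) (t : ℕ) (η : Matrix κ ι ℝ) :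
    Matrix (ι ⊕ κ) (ι ⊕ κ) ℝ :=
  fromBlocks 1 0 (N ^ t • η) (N ^ t • 1)

section Shear

variable {ι κ : Type*} [Fintype ι] [DecidableEq ι] [Fintype κ] [DecidableEq κ]

theorem lat_flow_eq_shear (N : ℝ) (t : ℕ) (η : Matrix κ ι ℝ) (h : Matrix (ι ⊕ κ) (ι ⊕ κ) ℝ)
    (z : ι ⊕ κ → ℤ) : lat (flow N t η h) z = shear N t η *ᵥ lat h z :=
  lat_flow N t η h z

theorem shear_inl (N : ℝ) (t : ℕ) (η : Matrix κ ι ℝ) (v : ι ⊕ κ → ℝ) (i : ι) :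
    (shear N t η *ᵥ v) (Sum.inl i) = v (Sum.inl i) := by
  rw [shear, Matrix.fromBlocks_mulVec]
  simp

theorem shear_inr (N : ℝ) (t : ℕ) (η : Matrix κ ι ℝ) (v : ι ⊕ κ → ℝ) (k : κ) :
    (shear N t η *ᵥ v) (Sum.inr k) = N ^ t * (v (Sum.inr k) + ∑ i, η k i * v (Sum.inl i)) := by
  rw [shear, Matrix.fromBlocks_mulVec]
  simp only [Sum.elim_inr, Pi.add_apply, Matrix.smul_mulVec, Matrix.one_mulVec, Pi.smul_apply,
    Function.comp_apply, smul_eq_mul, Matrix.mulVec, dotProduct]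
  ring

end Shear

variable {ι κ : Type*}

/-- Moves the distinguished coordinate from the first block to the second one. -/
def moveNone (ι κ : Type*) : Option ι ⊕ κ ≃ ι ⊕ Option κ where
  toFun := Sum.elim (fun o => o.elim (Sum.inr none) Sum.inl) fun k => Sum.inr (some k)
  invFun := Sum.elim (fun i => Sum.inl (some i)) fun o => o.elim (Sum.inl none) Sum.inr
  left_inv := by rintro ((_ | i) | k) <;> rfl
  right_inv := by rintro (i | _ | k) <;> rfl

/-- The distinguished coordinate of the second block, followed by all other ones. -/
def lastNone (ι κ : Type*) : Option (ι ⊕ κ) ≃ ι ⊕ Option κ where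
  toFun o := o.elim (Sum.inr none) (Sum.elim Sum.inl fun k => Sum.inr (some k))
  invFun := Sum.elim (fun i => some (Sum.inl i)) fun o => o.elim none fun k => some (Sum.inr k)
  left_inv := by rintro (_ | i | k) <;> rfl
  right_inv := by rintro (i | _ | k) <;> rfl

/-- The linear form that is contracted in the second half of an excursion. -/
def excForm (η₂ : Matrix (Option κ) ι ℝ) : Option ι → ℝ := fun o => o.elim 1 (η₂ none)

/-- The perturbation that realizes an excursion along a rational hyperplane. -/
def excMatrix [Fintype κ] (a : Option ι → ℝ) (b : κ → ℝ) (η₁ : Matrix κ (Option ι) ℝ)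
    (η₂ : Matrix (Option κ) ι ℝ) (θ : ℝ) : Matrix (Option κ) (Option ι) ℝ :=
  Matrix.of fun o i => o.elim
    (a i + θ * excForm η₂ i -
      ∑ k, b k * (η₁ k i + θ * i.elim 0 (η₂ (some k))))
    fun k => η₁ k i + θ * i.elim 0 (η₂ (some k))

section

variable [Fintype κ] (a : Option ι → ℝ) (b : κ → ℝ) (η₁ : Matrix κ (Option ι) ℝ)
    (η₂ : Matrix (Option κ) ι ℝ) (θ : ℝ)

theorem excMatrix_some (k : κ) (i : Option ι) : excMatrix a b η₁ η₂ θ (some k) i =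
    η₁ k i + θ * i.elim 0 (η₂ (some k)) := rfl

theorem excMatrix_none (i : Option ι) : excMatrix a b η₁ η₂ θ none i =
    a i + θ * excForm η₂ i - ∑ k, b k * excMatrix a b η₁ η₂ θ (some k) i := rfl

variable [Fintype ι]

theorem excMatrix_some_sum (k : κ) (x : Option ι → ℝ) :
    ∑ i, excMatrix a b η₁ η₂ θ (some k) i * x i =
      ∑ i, η₁ k i * x i + θ * ∑ i, η₂ (some k) i * x (some i) := by
  simp only [excMatrix_some, add_mul, Finset.sum_add_distrib, Finset.mul_sum]
  congr 1
  rw [Fintype.sum_option]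
  simp [mul_assoc]

theorem excMatrix_none_sum (v : Option ι ⊕ Option κ → ℝ) :
    v (Sum.inr none) + ∑ i, excMatrix a b η₁ η₂ θ none i * v (Sum.inl i) =
      (v (Sum.inr none) + ∑ i, a i * v (Sum.inl i) + ∑ k, b k * v (Sum.inr (some k))) +
      θ * ∑ i, excForm η₂ i * v (Sum.inl i) -
      ∑ k, b k * (v (Sum.inr (some k)) +
        ∑ i, excMatrix a b η₁ η₂ θ (some k) i * v (Sum.inl i)) := by
  simp only [excMatrix_none, sub_mul, add_mul, mul_add, Finset.sum_add_distrib,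
    Finset.sum_sub_distrib, Finset.mul_sum, Finset.sum_mul, mul_assoc]
  rw [Finset.sum_comm]
  ring

theorem sum_excForm (x : Option ι → ℝ) :
    ∑ i, excForm η₂ i * x i = x none + ∑ i, η₂ none i * x (some i) := by
  rw [Fintype.sum_option]
  simp [excForm]

theorem abs_excForm_le (hη₂ : ∀ k i, |η₂ k i| ≤ 1) (i : Option ι) : |excForm η₂ i| ≤ 1 := by
  rcases i with _ | i
  · simp [excForm]
  · exact hη₂ none i

variable {a b η₁ η₂ θ}

theorem abs_excMatrix_le {β : ℝ} (hβ : Fintype.card κ * β ≤ 1) (ha : ∀ i, |a i| ≤ 1)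
    (hb : ∀ k, |b k| ≤ β) (hη₁ : ∀ k i, |η₁ k i| ≤ 1) (hη₂ : ∀ k i, |η₂ k i| ≤ 1)
    (hθ₀ : 0 ≤ θ) (hθ : θ ≤ 1) (o : Option κ) (i : Option ι) :
    |excMatrix a b η₁ η₂ θ o i| ≤ 4 := by
  have key : ∀ x, |x| ≤ 1 → |θ * x| ≤ 1 := fun x hx => by
    rw [abs_mul, abs_of_nonneg hθ₀]
    exact mul_le_one₀ hθ (abs_nonneg _) hx
  have hs : ∀ k, |excMatrix a b η₁ η₂ θ (some k) i| ≤ 2 := by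
    intro k
    rw [excMatrix_some]
    refine (abs_add_le _ _).trans ?_
    have h2 : |i.elim 0 (η₂ (some k))| ≤ 1 := by
      rcases i with _ | i
      · simp
      · exact hη₂ _ _
    linarith [hη₁ k i, key _ h2]
  rcases o with _ | k
  · rw [excMatrix_none]
    have h1 := abs_sum_mul_le_of_card_mul_le b (fun k => excMatrix a b η₁ η₂ θ (some k) i)
      zero_le_two hβ hb hs
    have h2 := key _ (abs_excForm_le η₂ hη₂ i)
    have h3 := abs_sub (a i + θ * excForm η₂ i)
      (∑ k, b k * excMatrix a b η₁ η₂ θ (some k) i)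
    have h4 := abs_add_le (a i) (θ * excForm η₂ i)
    linarith [ha i]
  · linarith [hs k]

end

section Compare

variable [Fintype ι] [DecidableEq ι] [Fintype κ] [DecidableEq κ]
  {a : Option ι → ℝ} {b : κ → ℝ} {η₁ : Matrix κ (Option ι) ℝ} {η₂ : Matrix (Option κ) ι ℝ}
  {N θ β : ℝ}

/-- The projection that forgets the distinguished coordinate of the second block. -/
def dropNone (v : Option ι ⊕ Option κ → ℝ) : Option ι ⊕ κ → ℝ :=
  fun r => v (lastNone (Option ι) κ (some r))

variable (v : Option ι ⊕ Option κ → ℝ)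

theorem shear_excMatrix_some (t : ℕ) (k : κ) :
    (shear N t (excMatrix a b η₁ η₂ θ) *ᵥ v) (Sum.inr (some k)) =
      (shear N t η₁ *ᵥ dropNone v) (Sum.inr k) +
        N ^ t * θ * ∑ i, η₂ (some k) i * v (Sum.inl (some i)) := by
  rw [shear_inr, shear_inr, excMatrix_some_sum]
  simp only [dropNone, lastNone]
  simp
  ring

theorem shear_excMatrix_none (t : ℕ) :
    (shear N t (excMatrix a b η₁ η₂ θ) *ᵥ v) (Sum.inr none) =
      N ^ t * (v (Sum.inr none) + ∑ i, a i * v (Sum.inl i) + ∑ k, b k * v (Sum.inr (some k))) +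
      N ^ t * θ * ∑ i, excForm η₂ i * v (Sum.inl i) -
      ∑ k, b k * (shear N t (excMatrix a b η₁ η₂ θ) *ᵥ v) (Sum.inr (some k)) := by
  have h : ∀ k, b k * (shear N t (excMatrix a b η₁ η₂ θ) *ᵥ v) (Sum.inr (some k)) =
      N ^ t * (b k * (v (Sum.inr (some k)) +
        ∑ i, excMatrix a b η₁ η₂ θ (some k) i * v (Sum.inl i))) := fun k => by
    rw [shear_inr]; ring
  simp only [h]
  rw [shear_inr, excMatrix_none_sum, ← Finset.mul_sum]
  ring

theorem norm_shear_excMatrix_le_left (hβ : Fintype.card κ * β ≤ 1) (hb : ∀ k, |b k| ≤ β)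
    (hη₂ : ∀ k i, |η₂ k i| ≤ 1) {t : ℕ} (hN : 0 < N) (hθ₀ : 0 ≤ θ) (hθ : N ^ t * θ ≤ 1)
    (hv : v (Sum.inr none) + ∑ i, a i * v (Sum.inl i) + ∑ k, b k * v (Sum.inr (some k)) = 0) :
    ‖shear N t (excMatrix a b η₁ η₂ θ) *ᵥ v‖ ≤
        2 * Fintype.card (Option ι) * ‖shear N t η₁ *ᵥ dropNone v‖ ∧
      ‖shear N t η₁ *ᵥ dropNone v‖ ≤
        2 * Fintype.card (Option ι) * ‖shear N t (excMatrix a b η₁ η₂ θ) *ᵥ v‖ := by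
  set Q := shear N t (excMatrix a b η₁ η₂ θ) *ᵥ v with hQ
  set P := shear N t η₁ *ᵥ dropNone v with hP
  have hNθ : 0 ≤ N ^ t * θ := by positivity
  have hQi : ∀ i, |v (Sum.inl i)| ≤ ‖Q‖ := fun i => by
    have := norm_le_pi_norm Q (Sum.inl i)
    rwa [hQ, shear_inl] at this
  have hPi : ∀ i, |v (Sum.inl i)| ≤ ‖P‖ := fun i => by
    have := norm_le_pi_norm P (Sum.inl i)
    rwa [hP, shear_inl] at this
  have hcard : (Fintype.card (Option ι) : ℝ) = Fintype.card ι + 1 := by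
    rw [Fintype.card_option]; push_cast; rfl
  have hι : (0 : ℝ) ≤ Fintype.card ι := by positivity
  have hdiff : ∀ y, (∀ i, |v (Sum.inl i)| ≤ y) → ∀ k,
      |N ^ t * θ * ∑ i, η₂ (some k) i * v (Sum.inl (some i))| ≤ Fintype.card ι * y := by
    intro y hy k
    rw [abs_mul, abs_of_nonneg hNθ]
    refine (mul_le_of_le_one_left (abs_nonneg _) hθ).trans ?_
    simpa using abs_sum_mul_le (η₂ (some k)) (fun i => v (Sum.inl (some i)))
      (fun i => hη₂ _ i) fun i => hy _
  have hQ0 := norm_nonneg Q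
  have hP0 := norm_nonneg P
  have hιQ := mul_nonneg hι hQ0
  have hιP := mul_nonneg hι hP0
  have hQk : ∀ k, |Q (Sum.inr (some k))| ≤ (Fintype.card ι + 1) * ‖P‖ := fun k => by
    rw [hQ, shear_excMatrix_some]
    refine (abs_add_le _ _).trans ?_
    have h1 := norm_le_pi_norm P (Sum.inr k)
    rw [Real.norm_eq_abs] at h1
    linarith [hdiff _ hPi k]
  constructor
  · refine (pi_norm_le_iff_of_nonneg (by positivity)).mpr ?_
    rw [hcard]
    rintro (i | _ | k)
    · rw [hQ, shear_inl, Real.norm_eq_abs]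
      linarith [hPi i]
    · rw [hQ, shear_excMatrix_none, hv, mul_zero, zero_add, Real.norm_eq_abs]
      refine (abs_sub _ _).trans ?_
      have h1 := abs_sum_mul_le_of_card_mul_le b (fun k => Q (Sum.inr (some k)))
        (by positivity) hβ hb hQk
      have h2 : |N ^ t * θ * ∑ i, excForm η₂ i * v (Sum.inl i)| ≤
          (Fintype.card ι + 1) * ‖P‖ := by
        rw [abs_mul, abs_of_nonneg hNθ]
        refine (mul_le_of_le_one_left (abs_nonneg _) hθ).trans ?_
        have := abs_sum_mul_le (excForm η₂) (fun i => v (Sum.inl i))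
          (abs_excForm_le η₂ hη₂) hPi
        rwa [one_mul, hcard] at this
      linarith
    · rw [Real.norm_eq_abs]
      linarith [hQk k]
  · refine (pi_norm_le_iff_of_nonneg (by positivity)).mpr ?_
    rw [hcard]
    rintro (i | k)
    · rw [hP, shear_inl, Real.norm_eq_abs]
      have := hQi i
      change |v (Sum.inl i)| ≤ _
      linarith
    · have h1 : P (Sum.inr k) = Q (Sum.inr (some k)) -
          N ^ t * θ * ∑ i, η₂ (some k) i * v (Sum.inl (some i)) := by
        rw [hQ, shear_excMatrix_some]; ring
      rw [h1, Real.norm_eq_abs]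
      refine (abs_sub _ _).trans ?_
      have h2 := norm_le_pi_norm Q (Sum.inr (some k))
      rw [Real.norm_eq_abs] at h2
      linarith [hdiff _ hQi k]

theorem norm_shear_excMatrix_le_right (hβ : Fintype.card κ * β ≤ 1) (hb : ∀ k, |b k| ≤ β)
    (hη₂ : ∀ k i, |η₂ k i| ≤ 1) {t₁ s : ℕ} (hN : 1 ≤ N) (hθ : N ^ t₁ * θ = 1)
    (hv : v (Sum.inr none) + ∑ i, a i * v (Sum.inl i) + ∑ k, b k * v (Sum.inr (some k)) = 0) :
    ‖shear N (t₁ + s) (excMatrix a b η₁ η₂ θ) *ᵥ v‖ ≤ 2 * Fintype.card (Option ι) *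
        ‖shear N s η₂ *ᵥ ((shear N t₁ η₁ *ᵥ dropNone v) ∘ (moveNone ι κ).symm)‖ ∧
      ‖shear N s η₂ *ᵥ ((shear N t₁ η₁ *ᵥ dropNone v) ∘ (moveNone ι κ).symm)‖ ≤
        2 * Fintype.card (Option ι) * ‖shear N (t₁ + s) (excMatrix a b η₁ η₂ θ) *ᵥ v‖ := by
  set Q := shear N (t₁ + s) (excMatrix a b η₁ η₂ θ) *ᵥ v with hQ
  set P := shear N s η₂ *ᵥ ((shear N t₁ η₁ *ᵥ dropNone v) ∘ (moveNone ι κ).symm) with hP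
  have hNθ : N ^ (t₁ + s) * θ = N ^ s := by
    rw [pow_add, mul_right_comm, hθ, one_mul]
  have hNs : 1 ≤ N ^ s := one_le_pow₀ hN
  have hPl : ∀ i, P (Sum.inl i) = v (Sum.inl (some i)) := fun i => by
    rw [hP, shear_inl]
    change (shear N t₁ η₁ *ᵥ dropNone v) (Sum.inl (some i)) = _
    rw [shear_inl]
    rfl
  have hPn : P (Sum.inr none) = N ^ s * ∑ i, excForm η₂ i * v (Sum.inl i) := by
    rw [hP, shear_inr, sum_excForm]
    change N ^ s * ((shear N t₁ η₁ *ᵥ dropNone v) (Sum.inl none) +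
      ∑ i, η₂ none i * (shear N t₁ η₁ *ᵥ dropNone v) (Sum.inl (some i))) = _
    simp only [shear_inl]
    rfl
  have hPs : ∀ k, P (Sum.inr (some k)) = Q (Sum.inr (some k)) := fun k => by
    rw [hP, hQ, shear_inr, shear_excMatrix_some, hNθ]
    change N ^ s * ((shear N t₁ η₁ *ᵥ dropNone v) (Sum.inr k) +
      ∑ i, η₂ (some k) i * (shear N t₁ η₁ *ᵥ dropNone v) (Sum.inl (some i))) = _
    simp only [shear_inl, shear_inr, pow_add]
    change _ = _ + N ^ s * ∑ i, η₂ (some k) i * dropNone v (Sum.inl (some i))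
    ring
  have hQn : Q (Sum.inr none) = P (Sum.inr none) - ∑ k, b k * Q (Sum.inr (some k)) := by
    rw [hQ, shear_excMatrix_none, hv, hNθ, hPn]
    ring
  have hQ0 := norm_nonneg Q
  have hP0 := norm_nonneg P
  have hcard : (Fintype.card (Option ι) : ℝ) = Fintype.card ι + 1 := by
    rw [Fintype.card_option]; push_cast; rfl
  have hι : (0 : ℝ) ≤ Fintype.card ι := by positivity
  have hιQ := mul_nonneg hι hQ0
  have hιP := mul_nonneg hι hP0
  have hPle : ∀ r, |P r| ≤ ‖P‖ := fun r => norm_le_pi_norm P r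
  have hQle : ∀ r, |Q r| ≤ ‖Q‖ := fun r => norm_le_pi_norm Q r
  constructor
  · refine (pi_norm_le_iff_of_nonneg (by positivity)).mpr ?_
    rw [hcard]
    rintro ((_ | i) | _ | k)
    · rw [hQ, shear_inl, Real.norm_eq_abs]
      have h1 : v (Sum.inl none) = ∑ i, excForm η₂ i * v (Sum.inl i) -
          ∑ i, η₂ none i * v (Sum.inl (some i)) := by
        rw [sum_excForm]; ring
      have h2 : |∑ i, excForm η₂ i * v (Sum.inl i)| ≤ ‖P‖ := by
        refine le_trans ?_ (hPle (Sum.inr none))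
        rw [hPn, abs_mul, abs_of_pos (show 0 < N ^ s by linarith)]
        exact le_mul_of_one_le_left (abs_nonneg _) hNs
      have h3 := abs_sum_mul_le (η₂ none) (fun i => v (Sum.inl (some i))) (fun i => hη₂ _ i)
        (fun i => by rw [← hPl]; exact hPle _)
      rw [h1]
      refine (abs_sub _ _).trans ?_
      linarith
    · rw [hQ, shear_inl, Real.norm_eq_abs, ← hPl]
      linarith [hPle (Sum.inl i)]
    · rw [hQn, Real.norm_eq_abs]
      have h1 := abs_sum_mul_le_of_card_mul_le b (fun k => Q (Sum.inr (some k))) hP0 hβ hb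
        (fun k => by rw [← hPs]; exact hPle _)
      refine (abs_sub _ _).trans ?_
      linarith [hPle (Sum.inr none)]
    · rw [← hPs, Real.norm_eq_abs]
      linarith [hPle (Sum.inr (some k))]
  · refine (pi_norm_le_iff_of_nonneg (by positivity)).mpr ?_
    rw [hcard]
    rintro (i | _ | k)
    · rw [hPl, Real.norm_eq_abs]
      have := hQle (Sum.inl (some i))
      rw [hQ, shear_inl] at this
      linarith
    · have h1 := abs_sum_mul_le_of_card_mul_le b (fun k => Q (Sum.inr (some k))) hQ0 hβ hb
        (fun k => hQle _)
      have h2 : P (Sum.inr none) = Q (Sum.inr none) + ∑ k, b k * Q (Sum.inr (some k)) := by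
        rw [hQn]; ring
      rw [h2, Real.norm_eq_abs]
      refine (abs_add_le _ _).trans ?_
      linarith [hQle (Sum.inr none)]
    · rw [hPs, Real.norm_eq_abs]
      linarith [hQle (Sum.inr (some k))]

theorem le_norm_shear_excMatrix (hβ : Fintype.card κ * β ≤ 1) (hb : ∀ k, |b k| ≤ β)
    (hη₂ : ∀ k i, |η₂ k i| ≤ 1) {t s : ℕ} (hN : 1 ≤ N) (hθ₀ : 0 ≤ θ)
    (hθ : N ^ t * θ ≤ N ^ (t - s)) (hst : s ≤ t) :
    N ^ s * |v (Sum.inr none) + ∑ i, a i * v (Sum.inl i) + ∑ k, b k * v (Sum.inr (some k))| ≤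
      (2 + Fintype.card (Option ι)) * ‖shear N t (excMatrix a b η₁ η₂ θ) *ᵥ v‖ := by
  set Q := shear N t (excMatrix a b η₁ η₂ θ) *ᵥ v with hQ
  set W := v (Sum.inr none) + ∑ i, a i * v (Sum.inl i) + ∑ k, b k * v (Sum.inr (some k)) with hW
  have hQ0 := norm_nonneg Q
  have hQle : ∀ r, |Q r| ≤ ‖Q‖ := fun r => norm_le_pi_norm Q r
  have hN0 : 0 < N := by linarith
  have h1 := abs_sum_mul_le_of_card_mul_le b (fun k => Q (Sum.inr (some k))) hQ0 hβ hb
    (fun k => hQle _)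
  have h2 := abs_sum_mul_le (excForm η₂) (fun i => v (Sum.inl i)) (abs_excForm_le η₂ hη₂)
    (y := ‖Q‖) (fun i => by
      have := hQle (Sum.inl i)
      rwa [hQ, shear_inl] at this)
  rw [one_mul] at h2
  have h3 : N ^ t * W = Q (Sum.inr none) + ∑ k, b k * Q (Sum.inr (some k)) -
      N ^ t * θ * ∑ i, excForm η₂ i * v (Sum.inl i) := by
    rw [hQ, shear_excMatrix_none]; ring
  have h4 : N ^ t * |W| ≤ 2 * ‖Q‖ + N ^ (t - s) * (Fintype.card (Option ι) * ‖Q‖) := by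
    have h5 : N ^ t * |W| = |N ^ t * W| := by
      rw [abs_mul, abs_of_pos (show 0 < N ^ t by positivity)]
    rw [h5, h3]
    refine (abs_sub _ _).trans (add_le_add ((abs_add_le _ _).trans ?_) ?_)
    · linarith [hQle (Sum.inr none)]
    · rw [abs_mul, abs_of_nonneg (show 0 ≤ N ^ t * θ by positivity)]
      gcongr
  have h6 : N ^ t = N ^ (t - s) * N ^ s := by rw [← pow_add, Nat.sub_add_cancel hst]
  have h7 : 1 ≤ N ^ (t - s) := one_le_pow₀ hN
  refine le_of_mul_le_mul_left ?_ (by linarith : 0 < N ^ (t - s))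
  calc N ^ (t - s) * (N ^ s * |W|) = N ^ t * |W| := by rw [h6]; ring
    _ ≤ 2 * ‖Q‖ + N ^ (t - s) * (Fintype.card (Option ι) * ‖Q‖) := h4
    _ ≤ N ^ (t - s) * (2 * ‖Q‖) + N ^ (t - s) * (Fintype.card (Option ι) * ‖Q‖) := 
      add_le_add (le_mul_of_one_le_left (by linarith) h7) le_rfl
    _ = _ := by ring

end Compare

end Excursion

end

section

open Matrix

section Reindex

variable {ρ σ : Type*} [Fintype ρ] [DecidableEq ρ] [Fintype σ] [DecidableEq σ]

theorem lat_submatrix_equiv (e : σ ≃ ρ) (A : Matrix ρ ρ ℝ) (z : σ → ℤ) :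
    lat (A.submatrix e e) z = lat A (z ∘ e.symm) ∘ e := by
  have : (fun i => (z i : ℝ)) = (fun i => ((z ∘ e.symm) i : ℝ)) ∘ e := by
    funext i; simp
  rw [lat, this, Matrix.submatrix_mulVec_equiv]
  simp [lat, Function.comp_assoc]

theorem comp_symm_ne_zero (e : σ ≃ ρ) {z : σ → ℤ} (hz : z ≠ 0) : z ∘ e.symm ≠ 0 := by
  intro h
  apply hz
  funext i
  simpa using congrFun h (e i)

theorem norm_comp_equiv (e : σ ≃ ρ) (v : ρ → ℝ) : ‖v ∘ e‖ = ‖v‖ := by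
  refine le_antisymm ((pi_norm_le_iff_of_nonneg (norm_nonneg _)).mpr fun i =>
    norm_le_pi_norm v (e i)) ((pi_norm_le_iff_of_nonneg (norm_nonneg _)).mpr fun i => ?_)
  simpa using norm_le_pi_norm (v ∘ e) (e.symm i)

theorem Good.submatrix_equiv (e : σ ≃ ρ) {ε : ℝ} {A : Matrix ρ ρ ℝ} (hA : Good ε A) :
    Good ε (A.submatrix e e) := by
  intro z hz
  rw [lat_submatrix_equiv, norm_comp_equiv, Matrix.det_submatrix_equiv_self,
    Fintype.card_congr e]
  exact hA _ (comp_symm_ne_zero e hz)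

theorem exists_norm_lat_pow_le [Nonempty ρ] (A : Matrix ρ ρ ℝ) (hA : A.det ≠ 0) :
    ∃ z ≠ 0, ‖lat A z‖ ^ Fintype.card ρ ≤ 2 * |A.det| := by
  have hpos : 0 < |A.det| := abs_pos.mpr hA
  obtain ⟨y, hy, hyp⟩ := exists_root (Fintype.card ρ) Fintype.card_ne_zero
    (x := 2 * |A.det|) (by positivity)
  obtain ⟨z, hz, hle⟩ := exists_lat_le A hA (fun _ => y) (fun _ => hy) (by
    rw [Finset.prod_const, Finset.card_univ, hyp]; linarith)
  refine ⟨z, hz, ?_⟩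
  rw [← hyp]
  have h1 : ‖lat A z‖ ≤ y := (pi_norm_le_iff_of_nonneg hy.le).mpr hle
  gcongr

end Reindex

/-- The logarithmic covolume of the rational hyperplane that is contracted in an excursion of
depth `j`. -/
def excExp (n j t : ℕ) : ℕ := min t (n * j) * (n - 1) + (t - n * j) * n

theorem excExp_le (m n j t : ℕ) (hn : 1 ≤ n) (ht : t ≤ (m + n) * j) :
    excExp n j t ≤ (m + n - 1) * min t (n * j) := by
  obtain ⟨k, rfl⟩ := Nat.exists_eq_add_of_le' hn
  rw [excExp]
  simp only [Nat.add_sub_cancel, ← Nat.add_assoc]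
  rcases le_total t ((k + 1) * j) with h | h
  · rw [min_eq_left h, Nat.sub_eq_zero_of_le h, zero_mul, add_zero]
    nlinarith
  · rw [min_eq_right h]
    obtain ⟨s, rfl⟩ := Nat.exists_eq_add_of_le h
    rw [Nat.add_sub_cancel_left]
    have : s ≤ m * j := by nlinarith
    nlinarith

section Excursion

variable {ι κ : Type*} [Fintype ι] [DecidableEq ι] [Fintype κ] [DecidableEq κ]
  [Nonempty ι] [Nonempty κ]

theorem exists_excursion_of_det_eq_one {ε : ℝ} (hε : 0 < ε) :
    ∃ c C : ℝ, 0 < c ∧ 0 < C ∧ ∃ K₀ : ℕ, ∀ K ≥ K₀,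
      ∀ h : Matrix (Option ι ⊕ Option κ) (Option ι ⊕ Option κ) ℝ, |h.det| = 1 → Good ε h →
      ∀ j : ℕ, ∃ η : Matrix (Option κ) (Option ι) ℝ, (∀ k i, |η k i| ≤ 4) ∧
        ∀ t ≤ (Fintype.card (Option ι) + Fintype.card (Option κ)) * j,
          (∀ z ≠ 0, c * (16 * K : ℝ) ^ (Fintype.card (Option ι ⊕ Option κ) *
              excExp (Fintype.card (Option κ)) j t) ≤
            ‖lat (flow (16 * K) t η h) z‖ ^ (Fintype.card (Option ι ⊕ Option κ) *
              (Fintype.card (Option ι ⊕ Option κ) - 1))) ∧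
          ∃ z ≠ 0, ‖lat (flow (16 * K) t η h) z‖ ^ (Fintype.card (Option ι ⊕ Option κ) *
              (Fintype.card (Option ι ⊕ Option κ) - 1)) ≤
            C * (16 * K : ℝ) ^ (Fintype.card (Option ι ⊕ Option κ) *
              excExp (Fintype.card (Option κ)) j t) := by
  set m := Fintype.card (Option ι) with hm
  set n := Fintype.card (Option κ) with hn
  set d := Fintype.card (Option ι ⊕ Option κ) with hd
  have hdmn : d = m + n := Fintype.card_sum
  have hnκ : n - 1 = Fintype.card κ := by rw [hn, Fintype.card_option]; rfl
  have hn1 : 1 ≤ n := Fintype.card_pos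
  have hm1 : 1 ≤ m := Fintype.card_pos
  have hρ₁ : Fintype.card (Option ι ⊕ κ) = d - 1 := by
    rw [Fintype.card_sum, hdmn, ← hm, ← hnκ]; omega
  have hρ₂ : Fintype.card (ι ⊕ Option κ) = d - 1 := by
    rw [Fintype.card_sum, hdmn, ← hn, hm, Fintype.card_option]; omega
  set e := min ε 1 with he
  have he0 : 0 < e := lt_min hε one_pos
  obtain ⟨B, hB, HB⟩ := exists_hyperplane (lastNone (Option ι) κ) he0
  obtain ⟨c₁, hc₁, K₁, HK₁⟩ := exists_flow_good (ι := Option ι) (κ := κ)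
    (ε := e ^ (d - 1) / B) (by positivity)
  obtain ⟨c₂, hc₂, K₂, HK₂⟩ := exists_flow_good (ι := ι) (κ := Option κ) hc₁
  set R : ℝ := 2 * m with hR
  have hR0 : 0 < R := by positivity
  set c₃ := min c₁ c₂ with hc₃
  have hc₃0 : 0 < c₃ := lt_min hc₁ hc₂
  set D := d * (d - 1) with hD
  set cA := (c₃ / B) ^ d / (R * B) ^ D with hcA
  set cB := (1 / (B * (2 + m))) ^ D with hcB
  refine ⟨min cA cB, R ^ D * (2 * B) ^ d, by positivity, by positivity, max (max K₁ K₂) 1,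
    fun K hK h hdet hg j => ?_⟩
  have hK1 : 1 ≤ K := (le_max_right _ _).trans hK
  have hK1' : (1 : ℝ) ≤ K := by exact_mod_cast hK1
  have H₁ := HK₁ K ((le_max_left _ _).trans ((le_max_left _ _).trans hK))
  have H₂ := HK₂ K ((le_max_right _ _).trans ((le_max_left _ _).trans hK))
  have hN1 : (1 : ℝ) ≤ 16 * K := by linarith
  generalize (16 * K : ℝ) = N at *
  have hN0 : 0 < N := by linarith
  obtain ⟨w, G, hw1, hw, hGh, hhG, hwG, hwh, hdet₁, hdet₂, hgmin⟩ :=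
    HB h hdet fun z hz => hg.le_norm hdet hz
  set g := G.submatrix (fun r => lastNone (Option ι) κ (some r)) id with hgdef
  have hgdet : g.det ≠ 0 := by
    rw [← abs_pos]
    exact lt_of_lt_of_le (by positivity) hdet₁
  have hgg : Good (e ^ (d - 1) / B) g := by
    intro z hz
    rw [hρ₁]
    calc e ^ (d - 1) / B * |g.det| ≤ e ^ (d - 1) / B * B := by gcongr
      _ = e ^ (d - 1) := by field_simp
      _ ≤ _ := pow_le_pow_left₀ he0.le (hgmin z hz) _
  set t₁ := n * j with ht₁
  obtain ⟨η₁, hη₁, hgood₁⟩ := H₁ g hgdet hgg t₁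
  set g₂ := (flow N t₁ η₁ g).submatrix (moveNone ι κ).symm (moveNone ι κ).symm with hg₂
  have hg₂det : g₂.det = (N ^ t₁) ^ (n - 1) * g.det := by
    rw [hg₂, Matrix.det_submatrix_equiv_self, det_flow, hnκ]
  have hg₂det0 : g₂.det ≠ 0 := by rw [hg₂det]; positivity
  obtain ⟨η₂, hη₂, hgood₂⟩ := H₂ g₂ hg₂det0 ((hgood₁ t₁ le_rfl).submatrix_equiv _) (m * j)
  set θ := (N ^ t₁)⁻¹ with hθ
  have hθ0 : 0 ≤ θ := by positivity
  set a : Option ι → ℝ := fun i => w (Sum.inl i) with ha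
  set b : κ → ℝ := fun k => w (Sum.inr (some k)) with hb
  have hcardΔ : (1 : ℝ) ≤ d := by
    have : 1 ≤ d := by omega
    exact_mod_cast this
  have hble : ∀ k, |b k| ≤ 1 / d := fun k => hw _ (by simp [lastNone])
  have hale : ∀ i, |a i| ≤ 1 := fun i => (hw _ (by simp [lastNone])).trans (by
    rw [div_le_one (by linarith)]; exact hcardΔ)
  have hβ : (Fintype.card κ : ℝ) * (1 / d) ≤ 1 := by
    rw [mul_one_div, div_le_one (by linarith)]
    have : Fintype.card κ ≤ d := by omega
    exact_mod_cast this
  have hwv : ∀ v, w ⬝ᵥ v =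
      v (Sum.inr none) + ∑ i, a i * v (Sum.inl i) + ∑ k, b k * v (Sum.inr (some k)) := by
    intro v
    have hw1' : w (Sum.inr none) = 1 := hw1
    rw [dotProduct, Fintype.sum_sum_type, Fintype.sum_option (f := fun k => w (Sum.inr k) * _),
      hw1']
    ring
  set η := excMatrix a b η₁ η₂ θ with hη
  refine ⟨η, abs_excMatrix_le hβ hale hble hη₁ hη₂ hθ0
    (inv_le_one_of_one_le₀ (one_le_pow₀ hN1)), fun t ht => ?_⟩
  set X := excExp n j t with hX
  have key : ∃ P : (Option ι ⊕ Option κ → ℝ) → ℝ, (∀ v, 0 ≤ P v) ∧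
      (∀ v, w ⬝ᵥ v = 0 → ‖shear N t η *ᵥ v‖ ≤ R * P v ∧ P v ≤ R * ‖shear N t η *ᵥ v‖) ∧
      (∀ x ≠ 0, c₃ / B * N ^ X ≤ P (lat G x) ^ (d - 1)) ∧
      ∃ x ≠ 0, P (lat G x) ^ (d - 1) ≤ 2 * B * N ^ X := by
    rcases le_or_gt t t₁ with htt | htt
    · refine ⟨fun v => ‖shear N t η₁ *ᵥ dropNone v‖, fun v => norm_nonneg _, fun v hv => ?_, ?_,
        ?_⟩
      · refine norm_shear_excMatrix_le_left v hβ hble hη₂ hN0 hθ0 ?_ ((hwv v).symm.trans hv)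
        rw [hθ, ← div_eq_mul_inv, div_le_one (by positivity)]
        exact pow_le_pow_right₀ hN1 htt
      all_goals
        have hXt : (N ^ t) ^ Fintype.card κ = N ^ X := by
          rw [← pow_mul, hX, excExp, min_eq_left htt, Nat.sub_eq_zero_of_le htt, zero_mul,
            add_zero, hnκ]
        have hdetf : |(flow N t η₁ g).det| = N ^ X * |g.det| := by
          rw [det_flow, hXt, abs_mul, abs_of_pos (by positivity)]
        have hlat : ∀ x, shear N t η₁ *ᵥ dropNone (lat G x) = lat (flow N t η₁ g) x := fun x =>
          (lat_flow_eq_shear N t η₁ g x).symm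
        simp only [hlat]
      · intro x hx
        have := hgood₁ t htt x hx
        rw [hρ₁, hdetf] at this
        refine le_trans ?_ this
        calc c₃ / B * N ^ X = c₃ * (N ^ X * (1 / B)) := by ring
          _ ≤ c₁ * (N ^ X * |g.det|) := by
            gcongr
            exact min_le_left _ _
      · obtain ⟨x, hx, hle⟩ := exists_norm_lat_pow_le (flow N t η₁ g)
          (det_flow_ne_zero hN0.ne' t η₁ hgdet)
        rw [hρ₁, hdetf] at hle
        refine ⟨x, hx, le_trans hle ?_⟩
        calc 2 * (N ^ X * |g.det|) ≤ 2 * (N ^ X * B) := by gcongr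
          _ = _ := by ring
    · obtain ⟨s, rfl⟩ := Nat.exists_eq_add_of_le htt.le
      have hs : s ≤ m * j := by nlinarith
      refine ⟨fun v => ‖shear N s η₂ *ᵥ ((shear N t₁ η₁ *ᵥ dropNone v) ∘ (moveNone ι κ).symm)‖,
        fun v => norm_nonneg _, fun v hv => ?_, ?_, ?_⟩
      · exact norm_shear_excMatrix_le_right v hβ hble hη₂ hN1
          (mul_inv_cancel₀ (by positivity)) ((hwv v).symm.trans hv)
      all_goals
        have hXt : (N ^ s) ^ n * (N ^ t₁) ^ (n - 1) = N ^ X := by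
          rw [← pow_mul, ← pow_mul, ← pow_add, hX, excExp, min_eq_right htt.le,
            Nat.add_sub_cancel_left]
          congr 1
          ring
        have hdetf : |(flow N s η₂ g₂).det| = N ^ X * |g.det| := by
          rw [det_flow, hg₂det, ← mul_assoc, hXt, abs_mul, abs_of_pos (by positivity)]
        have hlat : ∀ x, shear N s η₂ *ᵥ
            ((shear N t₁ η₁ *ᵥ dropNone (lat G x)) ∘ (moveNone ι κ).symm) =
            lat (flow N s η₂ g₂) (x ∘ (moveNone ι κ).symm) := by
          intro x
          rw [lat_flow_eq_shear, hg₂, lat_submatrix_equiv, lat_flow_eq_shear]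
          have : (x ∘ (moveNone ι κ).symm) ∘ (moveNone ι κ).symm.symm = x := by
            funext i; simp
          rw [this]
          rfl
        simp only [hlat]
      · intro x hx
        have := hgood₂ s hs _ (comp_symm_ne_zero (moveNone ι κ) hx)
        rw [hρ₂, hdetf] at this
        refine le_trans ?_ this
        calc c₃ / B * N ^ X = c₃ * (N ^ X * (1 / B)) := by ring
          _ ≤ c₂ * (N ^ X * |g.det|) := by
            gcongr
            exact min_le_right _ _
      · obtain ⟨x, hx, hle⟩ := exists_norm_lat_pow_le (flow N s η₂ g₂)
          (det_flow_ne_zero hN0.ne' s η₂ hg₂det0)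
        rw [hρ₂, hdetf] at hle
        refine ⟨x ∘ moveNone ι κ, comp_symm_ne_zero (moveNone ι κ).symm hx, ?_⟩
        rw [Function.comp_assoc, Equiv.self_comp_symm, Function.comp_id]
        refine hle.trans ?_
        calc 2 * (N ^ X * |g.det|) ≤ 2 * (N ^ X * B) := by gcongr
          _ = _ := by ring
  obtain ⟨P, hP0, hPQ, hPlow, x₀, hx₀, hPup⟩ := key
  have hNdX : N ^ (d * X) = (N ^ X) ^ d := by rw [← pow_mul, mul_comm]
  have hDpow : ∀ y : ℝ, y ^ D = (y ^ (d - 1)) ^ d := fun y => by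
    rw [hD, ← pow_mul, mul_comm]
  constructor
  · intro z hz
    rw [lat_flow_eq_shear]
    set Q := shear N t η *ᵥ lat h z with hQ
    have hQ0 := norm_nonneg Q
    by_cases hwz : w ⬝ᵥ lat h z = 0
    · obtain ⟨x, hx, l, hl, hxz⟩ := hhG z hz hwz
      have h1 : P (lat G x) ≤ R * B * ‖Q‖ := by
        refine (hPQ _ (hwG x)).2.trans ?_
        rw [hxz, Matrix.mulVec_smul, ← hQ, norm_smul, Real.norm_eq_abs]
        calc R * (|l| * ‖Q‖) ≤ R * (B * ‖Q‖) := by gcongr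
          _ = _ := by ring
      have h2 : (c₃ / B) ^ d * N ^ (d * X) ≤ (R * B * ‖Q‖) ^ D := by
        calc (c₃ / B) ^ d * N ^ (d * X) = (c₃ / B * N ^ X) ^ d := by rw [mul_pow, hNdX]
          _ ≤ (P (lat G x) ^ (d - 1)) ^ d := pow_le_pow_left₀ (by positivity) (hPlow x hx) _
          _ = P (lat G x) ^ D := (hDpow _).symm
          _ ≤ _ := pow_le_pow_left₀ (hP0 _) h1 _
      rw [mul_pow] at h2
      calc min cA cB * N ^ (d * X) ≤ cA * N ^ (d * X) := by gcongr; exact min_le_left _ _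
        _ ≤ _ := by
          rw [hcA, div_mul_eq_mul_div, div_le_iff₀ (by positivity)]
          linarith
    · have h1 := hwh z hwz
      have h2 := le_norm_shear_excMatrix (η₁ := η₁) (a := a) (b := b) (t := t) (s := min t t₁)
        (N := N) (θ := θ) (lat h z) hβ hble hη₂ hN1 hθ0 (by
          rcases le_total t t₁ with htt | htt
          · rw [min_eq_left htt, Nat.sub_self, pow_zero, hθ, ← div_eq_mul_inv,
              div_le_one (by positivity)]
            exact pow_le_pow_right₀ hN1 htt
          · rw [min_eq_right htt, hθ, ← div_eq_mul_inv, div_le_iff₀ (by positivity), ← pow_add,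
              Nat.sub_add_cancel htt]) (min_le_left _ _)
      rw [← hwv, ← hη, ← hQ, ← hm] at h2
      have h3 : 1 / (B * (2 + m)) * N ^ (min t t₁) ≤ ‖Q‖ := by
        have h4 : N ^ (min t t₁) * (1 / B) ≤ (2 + m) * ‖Q‖ :=
          le_trans (by gcongr) h2
        rw [mul_one_div, div_le_iff₀ hB] at h4
        rw [div_mul_eq_mul_div, one_mul, div_le_iff₀ (by positivity)]
        linarith
      have h5 : d * X ≤ min t t₁ * D := by
        have := excExp_le m n j t hn1 ht
        rw [← hdmn] at this
        calc d * X ≤ d * ((d - 1) * min t t₁) := Nat.mul_le_mul_left _ this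
          _ = _ := by rw [hD]; ring
      calc min cA cB * N ^ (d * X) ≤ cB * N ^ (min t t₁ * D) := by
            gcongr
            · exact min_le_right _ _
        _ = (1 / (B * (2 + m)) * N ^ (min t t₁)) ^ D := by rw [mul_pow, hcB, ← pow_mul]
        _ ≤ _ := pow_le_pow_left₀ (by positivity) h3 _
  · obtain ⟨z, hz, hzx⟩ := hGh x₀ hx₀
    refine ⟨z, hz, ?_⟩
    rw [lat_flow_eq_shear, hzx]
    calc ‖shear N t η *ᵥ lat G x₀‖ ^ D ≤ (R * P (lat G x₀)) ^ D :=
          pow_le_pow_left₀ (norm_nonneg _) (hPQ _ (hwG x₀)).1 _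
      _ = R ^ D * (P (lat G x₀) ^ (d - 1)) ^ d := by rw [mul_pow, ← hDpow]
      _ ≤ R ^ D * (2 * B * N ^ X) ^ d := by
        have := hP0 (lat G x₀)
        gcongr
      _ = _ := by rw [mul_pow _ (N ^ X), hNdX]; ring

/-- Along a suitable trajectory the shortest vector makes an excursion of depth `j`. -/
theorem exists_excursion {ε : ℝ} (hε : 0 < ε) :
    ∃ c C : ℝ, 0 < c ∧ 0 < C ∧ ∃ K₀ : ℕ, ∀ K ≥ K₀,
      ∀ h : Matrix (Option ι ⊕ Option κ) (Option ι ⊕ Option κ) ℝ, h.det ≠ 0 → Good ε h →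
      ∀ j : ℕ, ∃ η : Matrix (Option κ) (Option ι) ℝ, (∀ k i, |η k i| ≤ 4) ∧
        ∀ t ≤ (Fintype.card (Option ι) + Fintype.card (Option κ)) * j,
          (∀ z ≠ 0, c * (16 * K : ℝ) ^ (Fintype.card (Option ι ⊕ Option κ) *
              excExp (Fintype.card (Option κ)) j t) *
                |h.det| ^ (Fintype.card (Option ι ⊕ Option κ) - 1) ≤
            ‖lat (flow (16 * K) t η h) z‖ ^ (Fintype.card (Option ι ⊕ Option κ) *
              (Fintype.card (Option ι ⊕ Option κ) - 1))) ∧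
          ∃ z ≠ 0, ‖lat (flow (16 * K) t η h) z‖ ^ (Fintype.card (Option ι ⊕ Option κ) *
              (Fintype.card (Option ι ⊕ Option κ) - 1)) ≤
            C * (16 * K : ℝ) ^ (Fintype.card (Option ι ⊕ Option κ) *
              excExp (Fintype.card (Option κ)) j t) *
                |h.det| ^ (Fintype.card (Option ι ⊕ Option κ) - 1) := by
  obtain ⟨c, C, hc, hC, K₀, H⟩ := exists_excursion_of_det_eq_one (ι := ι) (κ := κ) hε
  refine ⟨c, C, hc, hC, K₀, fun K hK h hdet hg j => ?_⟩
  obtain ⟨s, hs, hsdet, hsdet'⟩ := exists_smul_det_eq_one h hdet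
  obtain ⟨η, hη, hH⟩ := H K hK (s • h) hsdet' ((good_smul hs h).mpr hg) j
  refine ⟨η, hη, fun t ht => ?_⟩
  obtain ⟨h1, z₀, hz₀, h2⟩ := hH t ht
  set d := Fintype.card (Option ι ⊕ Option κ) with hd
  have hsD : s ^ (d * (d - 1)) * |h.det| ^ (d - 1) = 1 := by
    rw [pow_mul, ← mul_pow, hsdet, one_pow]
  have hdpos : 0 < |h.det| ^ (d - 1) := by positivity
  have hnorm : ∀ z, ‖lat (flow (16 * K) t η h) z‖ ^ (d * (d - 1)) =
      ‖lat (flow (16 * K) t η (s • h)) z‖ ^ (d * (d - 1)) * |h.det| ^ (d - 1) := fun z => by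
    rw [flow_smul, lat_smul, norm_smul, Real.norm_eq_abs, abs_of_pos hs, mul_pow, mul_right_comm,
      hsD, one_mul]
  refine ⟨fun z hz => ?_, z₀, hz₀, ?_⟩
  · rw [hnorm]
    exact mul_le_mul_of_nonneg_right (h1 z hz) hdpos.le
  · rw [hnorm]
    exact mul_le_mul_of_nonneg_right h2 hdpos.le

end Excursion

end

section

open Matrix

section Transport

variable {ι κ ι' κ' : Type*} [Fintype ι] [DecidableEq ι] [Fintype κ] [DecidableEq κ]
  [Fintype ι'] [DecidableEq ι'] [Fintype κ'] [DecidableEq κ']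

theorem flow_submatrix_equiv (e : ι ≃ ι') (f : κ ≃ κ') (N : ℝ) (t : ℕ) (η : Matrix κ' ι' ℝ)
    (h : Matrix (ι' ⊕ κ') (ι' ⊕ κ') ℝ) :
    flow N t (η.submatrix f e) (h.submatrix (e.sumCongr f) (e.sumCongr f)) =
      (flow N t η h).submatrix (e.sumCongr f) (e.sumCongr f) := by
  have h1 : fromBlocks 1 0 (N ^ t • η.submatrix f e) (N ^ t • (1 : Matrix κ κ ℝ)) =
      (fromBlocks 1 0 (N ^ t • η) (N ^ t • (1 : Matrix κ' κ' ℝ))).submatrix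
        (e.sumCongr f) (e.sumCongr f) := by
    ext (i | k) (j | l) <;> simp [Matrix.one_apply]
  rw [flow, flow, h1, Matrix.submatrix_mul_equiv]

end Transport

theorem exists_excursion_fin {m n : ℕ} (hm : 2 ≤ m) (hn : 2 ≤ n) {ε : ℝ} (hε : 0 < ε) :
    ∃ c C : ℝ, 0 < c ∧ 0 < C ∧ ∃ K₀ : ℕ, ∀ K ≥ K₀,
      ∀ h : Matrix (Fin m ⊕ Fin n) (Fin m ⊕ Fin n) ℝ, h.det ≠ 0 → Good ε h →
      ∀ j : ℕ, ∃ η : Matrix (Fin n) (Fin m) ℝ, (∀ k i, |η k i| ≤ 4) ∧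
        ∀ t ≤ (m + n) * j,
          (∀ z ≠ 0, c * (16 * K : ℝ) ^ ((m + n) * excExp n j t) * |h.det| ^ (m + n - 1) ≤
            ‖lat (flow (16 * K) t η h) z‖ ^ ((m + n) * (m + n - 1))) ∧
          ∃ z ≠ 0, ‖lat (flow (16 * K) t η h) z‖ ^ ((m + n) * (m + n - 1)) ≤
            C * (16 * K : ℝ) ^ ((m + n) * excExp n j t) * |h.det| ^ (m + n - 1) := by
  obtain ⟨m, rfl⟩ := Nat.exists_eq_add_of_le' hm
  obtain ⟨n, rfl⟩ := Nat.exists_eq_add_of_le' hn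
  obtain ⟨c, C, hc, hC, K₀, H⟩ := exists_excursion (ι := Fin (m + 1)) (κ := Fin (n + 1)) hε
  refine ⟨c, C, hc, hC, K₀, fun K hK h hdet hg j => ?_⟩
  set e : Option (Fin (m + 1)) ≃ Fin (m + 2) := (finSuccEquiv _).symm with he
  set f : Option (Fin (n + 1)) ≃ Fin (n + 2) := (finSuccEquiv _).symm with hf
  set u := e.sumCongr f with hu
  obtain ⟨η, hη, hH⟩ := H K hK (h.submatrix u u)
    (by rwa [Matrix.det_submatrix_equiv_self]) (hg.submatrix_equiv u) j
  have hcard : Fintype.card (Option (Fin (m + 1)) ⊕ Option (Fin (n + 1))) = m + 2 + (n + 2) := by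
    simp
  have hcard' : Fintype.card (Option (Fin (n + 1))) = n + 2 := by simp
  have hcard'' : Fintype.card (Option (Fin (m + 1))) = m + 2 := by simp
  rw [hcard, hcard', hcard''] at hH
  refine ⟨η.submatrix f.symm e.symm, fun k i => hη _ _, fun t ht => ?_⟩
  have key : flow (16 * K) t η (h.submatrix u u) =
      (flow (16 * K) t (η.submatrix f.symm e.symm) h).submatrix u u := by
    rw [hu, ← flow_submatrix_equiv]
    simp
  obtain ⟨h1, z₀, hz₀, h2⟩ := hH t ht
  rw [Matrix.det_submatrix_equiv_self] at h1 h2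
  rw [key] at h2
  simp only [key] at h1
  simp only [lat_submatrix_equiv, norm_comp_equiv] at h1 h2
  refine ⟨fun z hz => ?_, _, comp_symm_ne_zero u hz₀, h2⟩
  have := h1 (z ∘ u) (comp_symm_ne_zero u.symm hz)
  rwa [Function.comp_assoc, Equiv.self_comp_symm, Function.comp_id] at this

theorem excExp_end (m n j : ℕ) (hn : 1 ≤ n) :
    excExp n j ((m + n) * j) = n * j * (m + n - 1) := by
  obtain ⟨k, rfl⟩ := Nat.exists_eq_add_of_le' hn
  have h1 : (k + 1) * j ≤ (m + (k + 1)) * j := Nat.mul_le_mul_right _ (by omega)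
  have h2 : (m + (k + 1)) * j - (k + 1) * j = m * j := by
    rw [Nat.add_mul, Nat.add_sub_cancel]
  rw [excExp, min_eq_right h1, h2]
  simp only [Nat.add_sub_cancel, ← Nat.add_assoc]
  ring

/-- Every good lattice has many separated good descendants, all of which are reached by an
excursion of depth `j`. -/
theorem exists_children {m n : ℕ} (hm : 2 ≤ m) (hn : 2 ≤ n) :
    ∃ ε c C : ℝ, 0 < ε ∧ ε ≤ 1 ∧ 0 < c ∧ 0 < C ∧ ∃ l₀ : ℕ, ∀ l ≥ l₀,
      ∀ h : Matrix (Fin m ⊕ Fin n) (Fin m ⊕ Fin n) ℝ, h.det ≠ 0 → Good ε h → ∀ j : ℕ,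
      ∃ Δ : Fin (2 ^ (l * (m * n))) → Matrix (Fin n) (Fin m) ℝ,
        (∀ a k i, |Δ a k i| ≤ 1 + 4 / 2 ^ (l + 5)) ∧
        (∀ a b, a ≠ b → ∃ k i, 8 / 2 ^ (l + 5) ≤ |Δ a k i - Δ b k i|) ∧
        (∀ a, Good ε (flow (2 ^ (l + 5)) (1 + (m + n) * j) (Δ a) h)) ∧
        ∀ a, ∀ t ≤ (m + n) * j,
          (∀ z ≠ 0, c * (2 ^ (l + 5)) ^ ((m + n) * excExp n j t + n * (m + n - 1)) *
            |h.det| ^ (m + n - 1) ≤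
            ‖lat (flow (2 ^ (l + 5)) (1 + t) (Δ a) h) z‖ ^ ((m + n) * (m + n - 1))) ∧
          ∃ z ≠ 0, ‖lat (flow (2 ^ (l + 5)) (1 + t) (Δ a) h) z‖ ^ ((m + n) * (m + n - 1)) ≤
            C * (2 ^ (l + 5)) ^ ((m + n) * excExp n j t + n * (m + n - 1)) *
              |h.det| ^ (m + n - 1) := by
  classical
  have : Nonempty (Fin m) := ⟨⟨0, by omega⟩⟩
  have : Nonempty (Fin n) := ⟨⟨0, by omega⟩⟩
  obtain ⟨ε₀, hε₀, Hfree⟩ := card_not_good_flow_le (ι := Fin m) (κ := Fin n)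
  obtain ⟨c, C, hc, hC, K₁, Hexc⟩ := exists_excursion_fin hm hn hε₀
  set ε := min (min c ε₀) 1 with hεdef
  have hε : 0 < ε := lt_min (lt_min hc hε₀) one_pos
  have hε1 : ε ≤ 1 := min_le_right _ _
  obtain ⟨K₂, HK₂⟩ := Hfree ε hε
  refine ⟨ε, c, C, hε, hε1, hc, hC, max K₁ K₂, fun l hl h hdet hg j => ?_⟩
  set K : ℕ := 2 ^ (l + 1) with hK
  have hlK : l ≤ K :=
    (Nat.lt_two_pow_self.trans_le (Nat.pow_le_pow_right (by norm_num) (by simp))).le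
  have hK0 : 0 < K := by positivity
  have hKr : (0 : ℝ) < K := by exact_mod_cast hK0
  have hNK : (16 * K : ℝ) = 2 ^ (l + 5) := by
    rw [hK]; push_cast; ring
  have H₁ := Hexc K ((le_max_left _ _).trans (hl.trans hlK))
  have H₂ := HK₂ K ((le_max_right _ _).trans (hl.trans hlK)) h hdet hg
  have hfrac : ∀ E E' : Fin n → Fin m → Fin K, E ≠ E' →
      ∃ k i, 16 / 2 ^ (l + 5) ≤ |frac E k i - frac E' k i| := by
    intro E E' hE
    obtain ⟨k, hk⟩ := Function.ne_iff.mp hE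
    obtain ⟨i, hi⟩ := Function.ne_iff.mp hk
    refine ⟨k, i, ?_⟩
    have h1 : ((E k i : ℕ) : ℤ) - (E' k i : ℕ) ≠ 0 := by
      rw [sub_ne_zero]
      exact_mod_cast fun h => hi (Fin.ext h)
    have h2 : (1 : ℝ) ≤ |((E k i : ℕ) : ℝ) - (E' k i : ℕ)| := by
      exact_mod_cast Int.one_le_abs h1
    have h3 : frac E k i - frac E' k i = (((E k i : ℕ) : ℝ) - (E' k i : ℕ)) / K := by
      simp only [frac, Matrix.of_apply]; ring
    rw [h3, abs_div, abs_of_pos hKr, ← hNK, div_le_div_iff₀ (by positivity) hKr]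
    nlinarith
  have hfrac1 : ∀ (E : Fin n → Fin m → Fin K) k i, |frac E k i| ≤ 1 := by
    intro E k i
    simp only [frac, Matrix.of_apply]
    rw [abs_of_nonneg (by positivity), div_le_one hKr]
    exact_mod_cast (E k i).2.le
  set S : Finset (Fin n → Fin m → Fin K) :=
    Finset.univ.filter fun E => Good ε₀ (flow (16 * K) 1 (frac E) h) with hS
  have hScard : 2 ^ (l * (m * n)) ≤ S.card := by
    have h1 := H₂ (Finset.univ.filter fun E => ¬Good ε₀ (flow (16 * K) 1 (frac E) h))
      fun E hE => (Finset.mem_filter.mp hE).2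
    have h2 := Finset.card_filter_add_card_filter_not
      (s := (Finset.univ : Finset (Fin n → Fin m → Fin K)))
      (fun E : Fin n → Fin m → Fin K => Good ε₀ (flow (16 * K) 1 (frac E) h))
    have h3 : (Finset.univ : Finset (Fin n → Fin m → Fin K)).card = K ^ (m * n) := by
      simp [← pow_mul]
    have h4 : 2 * 2 ^ (l * (m * n)) ≤ K ^ (m * n) := by
      rw [hK, ← pow_mul, ← pow_succ']
      refine Nat.pow_le_pow_right (by norm_num) ?_
      have : 1 ≤ m * n := Nat.mul_pos (by omega) (by omega)
      rw [Nat.add_mul]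
      omega
    have h5 : S.card + (Finset.univ.filter
        fun E : Fin n → Fin m → Fin K => ¬Good ε₀ (flow (16 * K) 1 (frac E) h)).card =
        K ^ (m * n) := by
      rw [← h3, ← h2]
    rw [Fintype.card_fin, Fintype.card_fin] at h1
    omega
  have hemb : Nonempty (Fin (2 ^ (l * (m * n))) ↪ S) := by
    rw [Function.Embedding.nonempty_iff_card_le]
    simpa using hScard
  obtain ⟨φ⟩ := hemb
  have hgoodφ : ∀ a, Good ε₀ (flow (16 * K) 1 (frac (φ a).1) h) := fun a =>
    (Finset.mem_filter.mp (φ a).2).2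
  have hN0 : (16 * K : ℝ) ≠ 0 := by positivity
  choose η hη hηH using fun a => H₁ (flow (16 * K) 1 (frac (φ a).1) h)
    (det_flow_ne_zero hN0 1 _ hdet) (hgoodφ a) j
  have hdet1 : ∀ a, |(flow (16 * K) 1 (frac (φ a).1) h).det| ^ (m + n - 1) =
      (16 * K : ℝ) ^ (n * (m + n - 1)) * |h.det| ^ (m + n - 1) := fun a => by
    rw [det_flow, pow_one, Fintype.card_fin, abs_mul, abs_of_pos (by positivity), mul_pow, pow_mul]
  simp only [flow_flow hN0, hdet1, pow_one] at hηH
  rw [hNK] at hηH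
  have hΔη : ∀ a k i, |((2 ^ (l + 5) : ℝ)⁻¹ • η a) k i| ≤ 4 / 2 ^ (l + 5) := fun a k i => by
    rw [Matrix.smul_apply, smul_eq_mul, abs_mul, abs_of_pos (by positivity), inv_mul_eq_div]
    gcongr
    exact hη a k i
  refine ⟨fun a => frac (φ a).1 + (2 ^ (l + 5) : ℝ)⁻¹ • η a, fun a k i => ?_, fun a b hab => ?_,
    fun a z hz => ?_, fun a t ht => ?_⟩
  · change |frac (φ a).1 k i + ((2 ^ (l + 5) : ℝ)⁻¹ • η a) k i| ≤ _
    exact (abs_add_le _ _).trans (add_le_add (hfrac1 _ k i) (hΔη a k i))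
  · obtain ⟨k, i, hki⟩ := hfrac (φ a).1 (φ b).1 fun h => hab (φ.injective (Subtype.ext h))
    refine ⟨k, i, ?_⟩
    change _ ≤ |frac (φ a).1 k i + ((2 ^ (l + 5) : ℝ)⁻¹ • η a) k i -
      (frac (φ b).1 k i + ((2 ^ (l + 5) : ℝ)⁻¹ • η b) k i)|
    have h1 := hΔη a k i
    have h2 := hΔη b k i
    set x := ((2 ^ (l + 5) : ℝ)⁻¹ • η a) k i
    set y := ((2 ^ (l + 5) : ℝ)⁻¹ • η b) k i
    have h3 : frac (φ a).1 k i - frac (φ b).1 k i =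
        (frac (φ a).1 k i + x - (frac (φ b).1 k i + y)) - x + y := by ring
    rw [h3] at hki
    have h4 := abs_add_le ((frac (φ a).1 k i + x - (frac (φ b).1 k i + y)) - x) y
    have h5 := abs_sub (frac (φ a).1 k i + x - (frac (φ b).1 k i + y)) x
    have h6 : (16 : ℝ) / 2 ^ (l + 5) = 8 / 2 ^ (l + 5) + 4 / 2 ^ (l + 5) + 4 / 2 ^ (l + 5) := by
      ring
    linarith
  · have h1 := (hηH a _ le_rfl).1 z hz
    rw [excExp_end m n j (by omega)] at h1
    set F := flow (2 ^ (l + 5)) (1 + (m + n) * j) (frac (φ a).1 + (2 ^ (l + 5) : ℝ)⁻¹ • η a) h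
      with hF
    have hFdet : c * |F.det| ^ (m + n - 1) ≤ (‖lat F z‖ ^ (m + n)) ^ (m + n - 1) := by
      rw [← pow_mul]
      refine le_trans (le_of_eq ?_) h1
      have hpow : (((2 ^ (l + 5) : ℝ) ^ (1 + (m + n) * j)) ^ n) ^ (m + n - 1) =
          (2 ^ (l + 5)) ^ ((m + n) * (n * j * (m + n - 1))) *
            (2 ^ (l + 5)) ^ (n * (m + n - 1)) := by
        rw [← pow_mul _ _ n, ← pow_mul _ _ (m + n - 1), ← pow_add _ _ (n * (m + n - 1))]
        congr 1
        ring
      rw [hF, det_flow, Fintype.card_fin, abs_mul, abs_of_pos (by positivity), mul_pow, hpow]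
      ring
    have hdn : m + n - 1 ≠ 0 := by omega
    rw [Fintype.card_sum, Fintype.card_fin, Fintype.card_fin]
    refine le_of_pow_le_pow_left₀ hdn (by positivity) (le_trans ?_ hFdet)
    rw [mul_pow]
    gcongr
    exact (pow_le_of_le_one hε.le hε1 hdn).trans ((min_le_left _ _).trans (min_le_left _ _))
  · obtain ⟨h1, z₀, hz₀, h2⟩ := hηH a t ht
    refine ⟨fun z hz => le_trans (le_of_eq ?_) (h1 z hz), z₀, hz₀, h2.trans (le_of_eq ?_)⟩
    · rw [pow_add]; ring
    · rw [pow_add]; ring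

end

section

open Matrix Topology

/-- The time at which the `J`-th step starts when the `i`-th step contains an excursion of depth
`dep i`. -/
def startTime (m n : ℕ) (dep : ℕ → ℕ) : ℕ → ℕ
  | 0 => 0
  | J + 1 => startTime m n dep J + (1 + (m + n) * dep J)

theorem startTime_succ_ge (m n : ℕ) (dep : ℕ → ℕ) (J : ℕ) :
    startTime m n dep J + 1 ≤ startTime m n dep (J + 1) := by
  rw [startTime]; omega

theorem exists_limit {m n : ℕ} {N : ℝ} (hN : 6 ≤ N) {A : ℕ → Matrix (Fin n) (Fin m) ℝ} {T : ℕ → ℕ}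
    (hT : ∀ J, T J + 1 ≤ T (J + 1))
    (hA : ∀ J k i, |A (J + 1) k i - A J k i| ≤ (1 + 4 / N) / N ^ T J) :
    ∃ ξ : Matrix (Fin n) (Fin m) ℝ, ∀ J k i, |ξ k i - A J k i| ≤ 2 / N ^ T J := by
  have hN0 : 0 < N := by linarith
  have hTJ : ∀ J, J ≤ T J := by
    intro J
    induction J with
    | zero => exact Nat.zero_le _
    | succ J ih => have := hT J; omega
  have key : ∀ r J k i, |A (J + r) k i - A J k i| ≤ 2 / N ^ T J := by
    intro r
    induction r with
    | zero => intro J k i; simp; positivity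
    | succ r ih =>
      intro J k i
      have h1 := ih (J + 1) k i
      have h2 := hA J k i
      have h3 : (2 : ℝ) / N ^ T (J + 1) ≤ 2 / N ^ (T J + 1) := by
        gcongr
        · linarith
        · exact hT J
      have h4 : (2 : ℝ) / N ^ (T J + 1) = 2 / N / N ^ T J := by
        rw [pow_succ]; field_simp
      have h5 : (1 + 4 / N) / N ^ T J + 2 / N / N ^ T J ≤ 2 / N ^ T J := by
        rw [← add_div]
        gcongr
        have : 6 / N ≤ 1 := by rw [div_le_one hN0]; exact hN
        have h6 : 6 / N = 4 / N + 2 / N := by ring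
        linarith
      have h7 : A (J + (r + 1)) k i - A J k i =
          (A (J + 1 + r) k i - A (J + 1) k i) + (A (J + 1) k i - A J k i) := by
        rw [show J + (r + 1) = J + 1 + r by ring]; ring
      rw [h7]
      exact (abs_add_le _ _).trans (by linarith)
  have hlim : ∀ k i, ∃ x, Tendsto (fun J => A J k i) atTop (𝓝 x) := by
    intro k i
    refine cauchySeq_tendsto_of_complete (cauchySeq_of_le_tendsto_0' (fun J => 2 / N ^ J) ?_ ?_)
    · intro J J' hJ
      obtain ⟨r, rfl⟩ := Nat.exists_eq_add_of_le hJ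
      rw [dist_comm, Real.dist_eq]
      refine (key r J k i).trans ?_
      gcongr
      · linarith
      · exact hTJ J
    · have h1 := (tendsto_pow_atTop_atTop_of_one_lt (by linarith : 1 < N))
      exact h1.const_div_atTop 2
  choose ξ hξ using hlim
  refine ⟨ξ, fun J k i => ?_⟩
  refine le_of_tendsto (((hξ k i).sub_const _).abs) ?_
  filter_upwards [eventually_ge_atTop J] with J' hJ'
  obtain ⟨r, rfl⟩ := Nat.exists_eq_add_of_le hJ'
  exact key r J k i

/-- A Cantor-type family of matrices whose trajectories follow a prescribed profile. -/
theorem exists_tree {m n : ℕ} (hm : 2 ≤ m) (hn : 2 ≤ n) :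
    ∃ c C : ℝ, 0 < c ∧ 0 < C ∧ ∃ l₀ : ℕ, ∀ l ≥ l₀, ∀ dep : ℕ → ℕ,
      ∃ ξ : (ℕ → Fin (2 ^ (l * (m * n)))) → Matrix (Fin n) (Fin m) ℝ,
        (∀ a b J, (∀ i < J, a i = b i) → a J ≠ b J →
          ∃ k i, 1 / (2 ^ (l + 5)) ^ (startTime m n dep J + 1) ≤ |ξ a k i - ξ b k i|) ∧
        ∀ a J, ∀ t ≤ (m + n) * dep J,
          (∀ z ≠ 0, c * (2 ^ (l + 5)) ^ ((m + n) * excExp n (dep J) t +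
              (startTime m n dep J + 1) * n * (m + n - 1)) ≤
            ‖lat (flow (2 ^ (l + 5)) (startTime m n dep J + 1 + t) (ξ a) 1) z‖ ^
              ((m + n) * (m + n - 1))) ∧
          ∃ z ≠ 0, ‖lat (flow (2 ^ (l + 5)) (startTime m n dep J + 1 + t) (ξ a) 1) z‖ ^
              ((m + n) * (m + n - 1)) ≤
            C * (2 ^ (l + 5)) ^ ((m + n) * excExp n (dep J) t +
              (startTime m n dep J + 1) * n * (m + n - 1)) := by
  obtain ⟨ε, c, C, hε, hε1, hc, hC, l₀, H⟩ := exists_children hm hn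
  set D := (m + n) * (m + n - 1) with hD
  set R : ℝ := 1 + m * 2 with hR
  have hR0 : 0 < R := by positivity
  refine ⟨c / R ^ D, C * R ^ D, by positivity, by positivity, l₀, fun l hl dep => ?_⟩
  have Hl := H l hl
  have hN32 : (32 : ℝ) ≤ 2 ^ (l + 5) := by
    rw [pow_add]
    have : (1 : ℝ) ≤ 2 ^ l := one_le_pow₀ one_le_two
    linarith
  generalize (2 ^ (l + 5) : ℝ) = N at *
  have hN0 : 0 < N := by linarith
  have hN1 : 1 ≤ N := by linarith
  have Hl' : ∀ (h : Matrix (Fin m ⊕ Fin n) (Fin m ⊕ Fin n) ℝ) (j : ℕ),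
      ∃ Δ : Fin (2 ^ (l * (m * n))) → Matrix (Fin n) (Fin m) ℝ, ∀ _ : h.det ≠ 0 ∧ Good ε h,
        (∀ a k i, |Δ a k i| ≤ 1 + 4 / N) ∧
        (∀ a b, a ≠ b → ∃ k i, 8 / N ≤ |Δ a k i - Δ b k i|) ∧
        (∀ a, Good ε (flow N (1 + (m + n) * j) (Δ a) h)) ∧
        ∀ a, ∀ t ≤ (m + n) * j,
          (∀ z ≠ 0, c * N ^ ((m + n) * excExp n j t + n * (m + n - 1)) * |h.det| ^ (m + n - 1) ≤
            ‖lat (flow N (1 + t) (Δ a) h) z‖ ^ D) ∧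
          ∃ z ≠ 0, ‖lat (flow N (1 + t) (Δ a) h) z‖ ^ D ≤
            C * N ^ ((m + n) * excExp n j t + n * (m + n - 1)) * |h.det| ^ (m + n - 1) := by
    intro h j
    by_cases hh : h.det ≠ 0 ∧ Good ε h
    · obtain ⟨Δ, hΔ⟩ := Hl h hh.1 hh.2 j
      exact ⟨Δ, fun _ => hΔ⟩
    · exact ⟨0, fun h' => absurd h' hh⟩
  choose Δ hΔ using Hl'
  set T := startTime m n dep with hT
  let A : (ℕ → Fin (2 ^ (l * (m * n)))) → ℕ → Matrix (Fin n) (Fin m) ℝ := fun a J =>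
    Nat.rec 0 (fun J B => B + (N ^ T J)⁻¹ • Δ (flow N (T J) B 1) (dep J) (a J)) J
  have hA : ∀ a J, A a (J + 1) =
      A a J + (N ^ T J)⁻¹ • Δ (flow N (T J) (A a J) 1) (dep J) (a J) := fun a J => rfl
  have hAdet : ∀ a J, (flow N (T J) (A a J) 1).det = N ^ (T J * n) := by
    intro a J
    rw [det_flow, Matrix.det_one, mul_one, Fintype.card_fin, pow_mul]
  have hflowA : ∀ a J t, flow N (1 + t) (Δ (flow N (T J) (A a J) 1) (dep J) (a J))
      (flow N (T J) (A a J) 1) = flow N (T J + (1 + t)) (A a (J + 1)) 1 := by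
    intro a J t
    rw [flow_flow hN0.ne', hA]
  have hgood : ∀ a J, (flow N (T J) (A a J) 1).det ≠ 0 ∧ Good ε (flow N (T J) (A a J) 1) := by
    intro a J
    refine ⟨by rw [hAdet]; positivity, ?_⟩
    induction J with
    | zero =>
      intro z hz
      have h1 : flow N (T 0) (A a 0) (1 : Matrix (Fin m ⊕ Fin n) (Fin m ⊕ Fin n) ℝ) = 1 := by
        change flow N 0 (0 : Matrix (Fin n) (Fin m) ℝ) 1 = 1
        simp [flow]
      rw [h1, Matrix.det_one, abs_one, mul_one]
      refine hε1.trans (one_le_pow₀ ?_)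
      obtain ⟨i, hi⟩ := Function.ne_iff.mp hz
      have h2 := norm_le_pi_norm (lat (1 : Matrix (Fin m ⊕ Fin n) (Fin m ⊕ Fin n) ℝ) z) i
      refine le_trans ?_ h2
      rw [lat, Matrix.one_mulVec, Real.norm_eq_abs, ← Int.cast_abs]
      exact_mod_cast Int.one_le_abs hi
    | succ J ih =>
      have h1 := (hΔ _ (dep J) ⟨by rw [hAdet]; positivity, ih⟩).2.2.1 (a J)
      rwa [hflowA] at h1
  have hstep : ∀ a J k i, |A a (J + 1) k i - A a J k i| ≤ (1 + 4 / N) / N ^ T J := by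
    intro a J k i
    rw [hA, Matrix.add_apply, add_sub_cancel_left, Matrix.smul_apply, smul_eq_mul, abs_mul,
      abs_of_pos (by positivity), inv_mul_eq_div]
    gcongr
    exact (hΔ _ (dep J) (hgood a J)).1 _ k i
  choose ξ hξ using fun a => exists_limit (by linarith : 6 ≤ N) (startTime_succ_ge m n dep)
    (hstep a)
  refine ⟨ξ, fun a b J hab hJ => ?_, fun a J t ht => ?_⟩
  · have hAJ : ∀ J' ≤ J, A a J' = A b J' := by
      intro J' hJ'
      induction J' with
      | zero => rfl
      | succ J' ih => rw [hA, hA, ih (by omega), hab J' (by omega)]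
    obtain ⟨k, i, hki⟩ := (hΔ _ (dep J) (hgood a J)).2.1 _ _ hJ
    refine ⟨k, i, ?_⟩
    have h1 : A a (J + 1) k i - A b (J + 1) k i =
        (Δ (flow N (T J) (A a J) 1) (dep J) (a J) k i -
          Δ (flow N (T J) (A a J) 1) (dep J) (b J) k i) / N ^ T J := by
      rw [hA, hA, ← hAJ J le_rfl, Matrix.add_apply, Matrix.add_apply, Matrix.smul_apply,
        Matrix.smul_apply, smul_eq_mul, smul_eq_mul]
      ring
    have h2 : 8 / N ^ (T J + 1) ≤ |A a (J + 1) k i - A b (J + 1) k i| := by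
      rw [h1, abs_div, abs_of_pos (show 0 < N ^ T J by positivity), le_div_iff₀ (by positivity)]
      refine le_trans (le_of_eq ?_) hki
      rw [pow_succ]; field_simp
    have h3 : (2 : ℝ) / N ^ T (J + 1) ≤ 2 / N ^ (T J + 1) := by
      gcongr
      exact startTime_succ_ge m n dep J
    have h4 := hξ a (J + 1) k i
    have h5 := hξ b (J + 1) k i
    have h6 : A a (J + 1) k i - A b (J + 1) k i = (ξ a k i - ξ b k i) -
        (ξ a k i - A a (J + 1) k i) + (ξ b k i - A b (J + 1) k i) := by ring
    rw [h6] at h2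
    have h7 := abs_add_le (ξ a k i - ξ b k i - (ξ a k i - A a (J + 1) k i))
      (ξ b k i - A b (J + 1) k i)
    have h8 := abs_sub (ξ a k i - ξ b k i) (ξ a k i - A a (J + 1) k i)
    have h9 : (0 : ℝ) < 1 / N ^ (T J + 1) := by positivity
    have h10 : (8 : ℝ) / N ^ (T J + 1) = 8 * (1 / N ^ (T J + 1)) := by ring
    have h11 : (2 : ℝ) / N ^ (T J + 1) = 2 * (1 / N ^ (T J + 1)) := by ring
    change 1 / N ^ (T J + 1) ≤ _
    change _ ≤ 2 / N ^ T (J + 1) at h4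
    change _ ≤ 2 / N ^ T (J + 1) at h5
    linarith
  · obtain ⟨hlow, z₀, hz₀, hup⟩ := (hΔ _ (dep J) (hgood a J)).2.2.2 (a J) t ht
    rw [hflowA] at hup
    simp only [hflowA] at hlow
    set k := T J + 1 + t with hk
    have hk' : T J + (1 + t) = k := by rw [hk]; ring
    have hkT : k ≤ T (J + 1) := by
      change k ≤ T J + (1 + (m + n) * dep J)
      omega
    rw [hk'] at hup hlow
    set B := A a (J + 1) with hB
    have hexp : N ^ ((m + n) * excExp n (dep J) t + n * (m + n - 1)) *
        |(flow N (T J) (A a J) 1).det| ^ (m + n - 1) =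
        N ^ ((m + n) * excExp n (dep J) t + (T J + 1) * n * (m + n - 1)) := by
      rw [hAdet, abs_of_pos (by positivity), ← pow_mul, ← pow_add]
      congr 1
      ring
    rw [mul_assoc, hexp] at hup
    simp only [mul_assoc c, hexp] at hlow
    set η : Matrix (Fin n) (Fin m) ℝ := N ^ k • (ξ a - B) with hη
    have hηle : ∀ r i, |η r i| ≤ 2 := by
      intro r i
      rw [hη, Matrix.smul_apply, Matrix.sub_apply, smul_eq_mul, abs_mul,
        abs_of_pos (by positivity)]
      calc N ^ k * |ξ a r i - B r i| ≤ N ^ k * (2 / N ^ T (J + 1)) := by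
            gcongr
            exact hξ a (J + 1) r i
        _ ≤ N ^ T (J + 1) * (2 / N ^ T (J + 1)) := by gcongr
        _ = 2 := by field_simp
    have hflow : flow N 0 η (flow N k B 1) = flow N k (ξ a) 1 := by
      rw [flow_flow hN0.ne', add_zero, hη, smul_smul, inv_mul_cancel₀ (by positivity), one_smul,
        add_sub_cancel]
    have hR' : (1 + Fintype.card (Fin m) * 2 : ℝ) = R := by rw [Fintype.card_fin]
    constructor
    · intro z hz
      have h1 := norm_le_norm_lat_flow_zero hN0.ne' zero_le_two hηle (flow N k B 1) z
      rw [hflow, hR'] at h1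
      rw [div_mul_eq_mul_div, div_le_iff₀ (by positivity), ← mul_pow, mul_comm _ R]
      exact (hlow z hz).trans (pow_le_pow_left₀ (norm_nonneg _) h1 _)
    · refine ⟨z₀, hz₀, ?_⟩
      have h1 := norm_lat_flow_zero_le N zero_le_two hηle (flow N k B 1) z₀
      rw [hflow, hR'] at h1
      refine (pow_le_pow_left₀ (norm_nonneg _) h1 _).trans ?_
      rw [mul_pow, mul_right_comm, mul_comm]
      gcongr

end

section

open Matrix Topology

section Criterion

variable {m n : ℕ}

/-- The sup norm of an integer vector. -/
noncomputable def height (u : Fin m → ℤ) : ℝ := ‖(fun j => (u j : ℝ))‖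

/-- The approximation error of the integer pair `(u, v)`. -/
noncomputable def err (ξ : Matrix (Fin n) (Fin m) ℝ) (u : Fin m → ℤ) (v : Fin n → ℤ) : ℝ :=
  ‖(ξ.mulVec (fun j => (u j : ℝ)) - (fun k => (v k : ℝ)))‖

/-- The sup norm of the image of `(u, v)` under the flow at time `k + 1`. -/
noncomputable def size (ξ : Matrix (Fin n) (Fin m) ℝ) (N : ℝ) (k : ℕ) (u : Fin m → ℤ)
    (v : Fin n → ℤ) : ℝ :=
  max (height u) (N ^ (k + 1) * err ξ u v)

/-- The first minimum of the lattice attached to `ξ` at time `k + 1` is comparable to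
`N ^ (E k / D)`, and the growth rate of `E` stays inside `[1, D - 1]`. -/
structure FollowsProfile (ξ : Matrix (Fin n) (Fin m) ℝ) (N : ℝ) (D : ℕ) (E : ℕ → ℕ) : Prop where
  one_lt : 1 < N
  lower : ∃ c : ℝ, 0 < c ∧ ∀ k u v, (u, v) ≠ 0 → c * N ^ E k ≤ size ξ N k u v ^ D
  upper : ∃ C : ℝ, 0 < C ∧ ∀ k, ∃ u v, (u, v) ≠ 0 ∧ size ξ N k u v ^ D ≤ C * N ^ E k
  step_lower : ∀ k, E k + 1 ≤ E (k + 1)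
  step_upper : ∀ k, E (k + 1) + 1 ≤ E k + D

theorem height_nonneg (u : Fin m → ℤ) : 0 ≤ height u := norm_nonneg _

theorem err_nonneg (ξ : Matrix (Fin n) (Fin m) ℝ) (u : Fin m → ℤ) (v : Fin n → ℤ) :
    0 ≤ err ξ u v := norm_nonneg _

theorem one_le_height {u : Fin m → ℤ} (hu : u ≠ 0) : 1 ≤ height u := by
  obtain ⟨j, hj⟩ := Function.ne_iff.mp hu
  have h1 : |(u j : ℝ)| ≤ height u := norm_le_pi_norm (fun j => (u j : ℝ)) j
  have h2 : (1 : ℝ) ≤ |(u j : ℝ)| := by exact_mod_cast Int.one_le_abs hj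
  exact h2.trans h1

theorem err_zero (ξ : Matrix (Fin n) (Fin m) ℝ) (v : Fin n → ℤ) : err ξ 0 v = height v := by
  have h1 : (fun j => (((0 : Fin m → ℤ) j : ℤ) : ℝ)) = 0 := by
    funext j
    simp
  rw [err, height, h1, Matrix.mulVec_zero, zero_sub, norm_neg]

theorem height_le_size (ξ : Matrix (Fin n) (Fin m) ℝ) (N : ℝ) (k : ℕ) (u : Fin m → ℤ)
    (v : Fin n → ℤ) : height u ≤ size ξ N k u v := le_max_left _ _

theorem err_le_size (ξ : Matrix (Fin n) (Fin m) ℝ) (N : ℝ) (k : ℕ) (u : Fin m → ℤ)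
    (v : Fin n → ℤ) : N ^ (k + 1) * err ξ u v ≤ size ξ N k u v := le_max_right _ _

theorem size_nonneg (ξ : Matrix (Fin n) (Fin m) ℝ) (N : ℝ) (k : ℕ) (u : Fin m → ℤ)
    (v : Fin n → ℤ) : 0 ≤ size ξ N k u v := (height_nonneg u).trans (height_le_size ..)

/-- Only finitely many integer pairs have bounded height and bounded error. -/
theorem finite_setOf_height_le (ξ : Matrix (Fin n) (Fin m) ℝ) (a b : ℝ) :
    {q : (Fin m → ℤ) × (Fin n → ℤ) | height q.1 ≤ a ∧ err ξ q.1 q.2 ≤ b}.Finite := by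
  have hbox : ∀ (r : ℕ) (a : ℝ), {u : Fin r → ℤ | height u ≤ a}.Finite := by
    intro r a
    refine (Set.finite_Icc (fun _ : Fin r => -⌈a⌉) (fun _ => ⌈a⌉)).subset fun u hu => ?_
    have h1 : ∀ j, |u j| ≤ ⌈a⌉ := by
      intro j
      have h2 : |(u j : ℝ)| ≤ a := (norm_le_pi_norm (fun j => (u j : ℝ)) j).trans hu
      have h3 : |(u j : ℝ)| ≤ (⌈a⌉ : ℝ) := h2.trans (Int.le_ceil a)
      exact_mod_cast h3
    exact ⟨fun j => (abs_le.mp (h1 j)).1, fun j => (abs_le.mp (h1 j)).2⟩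
  have h1 := (hbox m a).biUnion (t := fun u => {u} ×ˢ
    {v : Fin n → ℤ | height v ≤ ‖ξ.mulVec (fun j => (u j : ℝ))‖ + b})
    fun u _ => (Set.finite_singleton u).prod (hbox n _)
  refine h1.subset ?_
  rintro ⟨u, v⟩ ⟨hu, hv⟩
  simp only [Set.mem_iUnion]
  refine ⟨u, hu, rfl, ?_⟩
  have h2 := norm_sub_norm_le (fun k => (v k : ℝ)) (ξ.mulVec (fun j => (u j : ℝ)))
  rw [norm_sub_rev] at h2
  change height v - _ ≤ err ξ u v at h2
  change height v ≤ _
  change err ξ u v ≤ b at hv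
  linarith

/-- Among the pairs with error below `b` there is one of least height and, subject to this, of
least error. -/
theorem exists_minimal_pair (ξ : Matrix (Fin n) (Fin m) ℝ) {b : ℝ} {u₀ : Fin m → ℤ}
    {v₀ : Fin n → ℤ} (hu₀ : u₀ ≠ 0) (hb : err ξ u₀ v₀ < b) :
    ∃ q : (Fin m → ℤ) × (Fin n → ℤ), q.1 ≠ 0 ∧ err ξ q.1 q.2 < b ∧ height q.1 ≤ height u₀ ∧
      (∀ u v, u ≠ 0 → height u < height q.1 → b ≤ err ξ u v) ∧
      ∀ u v, u ≠ 0 → height u ≤ height q.1 → err ξ q.1 q.2 ≤ err ξ u v := by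
  have hfin : ∀ a, {q : (Fin m → ℤ) × (Fin n → ℤ) | q.1 ≠ 0 ∧ height q.1 ≤ a ∧
      err ξ q.1 q.2 < b}.Finite := fun a =>
    (finite_setOf_height_le ξ a b).subset fun q hq => ⟨hq.2.1, hq.2.2.le⟩
  obtain ⟨p, ⟨hp0, hpu, hpb⟩, hp⟩ := (hfin (height u₀)).exists_minimalFor
    (fun q => height q.1) _ ⟨(u₀, v₀), hu₀, le_rfl, hb⟩
  obtain ⟨q, ⟨hq0, hqp, hqb⟩, hq⟩ := (hfin (height p.1)).exists_minimalFor
    (fun q => err ξ q.1 q.2) _ ⟨p, hp0, le_rfl, hpb⟩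
  refine ⟨q, hq0, hqb, hqp.trans hpu, fun u v hu hlt => ?_, fun u v hu hle => ?_⟩
  · by_contra! h
    have h1 : height u < height p.1 := hlt.trans_le hqp
    have h2 := hp (j := (u, v)) ⟨hu, h1.le.trans hpu, h⟩ h1.le
    exact absurd h1 (not_lt.mpr h2)
  · by_contra! h
    have h2 := hq (j := (u, v)) ⟨hu, hle.trans hqp, h.trans hqb⟩ h.le
    exact absurd h (not_lt.mpr h2)

/-- A totally irrational matrix with arbitrarily good approximations has a sequence of best
approximation vectors. -/
theorem exists_isBestApproxSeq (hm : 0 < m) {ξ : Matrix (Fin n) (Fin m) ℝ}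
    (hξ : TotallyIrrational ξ) (happ : ∀ b > 0, ∃ u v, u ≠ 0 ∧ err ξ u v < b) :
    ∃ x y, IsBestApproxSeq ξ x y := by
  have hpos : ∀ u v, u ≠ 0 → 0 < err ξ u v := fun u v hu =>
    hξ u v fun h => hu (congrArg Prod.fst h)
  have hex : ∀ b : ℝ, ∃ q : (Fin m → ℤ) × (Fin n → ℤ), 0 < b → q.1 ≠ 0 ∧ err ξ q.1 q.2 < b ∧
      (∀ u v, u ≠ 0 → height u < height q.1 → b ≤ err ξ u v) ∧
      ∀ u v, u ≠ 0 → height u ≤ height q.1 → err ξ q.1 q.2 ≤ err ξ u v := by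
    intro b
    by_cases hb : 0 < b
    · obtain ⟨u, v, hu, hv⟩ := happ b hb
      obtain ⟨q, h0, h1, -, h2, h3⟩ := exists_minimal_pair ξ hu hv
      exact ⟨q, fun _ => ⟨h0, h1, h2, h3⟩⟩
    · exact ⟨0, fun h => absurd h hb⟩
  choose f hf using hex
  set u₀ : Fin m → ℤ := fun _ => 1 with hu₀
  have hu₀0 : u₀ ≠ 0 := fun h => by simpa [hu₀] using congrFun h ⟨0, hm⟩
  have hu₀1 : height u₀ ≤ 1 := by
    refine (pi_norm_le_iff_of_nonneg zero_le_one).mpr fun j => ?_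
    simp [hu₀]
  obtain ⟨q₀, hq0, -, hq1, -, hq2⟩ :=
    exists_minimal_pair ξ hu₀0 (lt_add_one (err ξ u₀ (0 : Fin n → ℤ)))
  let p : ℕ → (Fin m → ℤ) × (Fin n → ℤ) := fun i =>
    Nat.rec q₀ (fun _ q => f (err ξ q.1 q.2)) i
  have hp : ∀ i, (p i).1 ≠ 0 ∧
      ∀ u v, u ≠ 0 → height u ≤ height (p i).1 → err ξ (p i).1 (p i).2 ≤ err ξ u v := by
    intro i
    induction i with
    | zero => exact ⟨hq0, hq2⟩
    | succ i ih =>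
      have h1 := hf (err ξ (p i).1 (p i).2) (hpos _ _ ih.1)
      exact ⟨h1.1, h1.2.2.2⟩
  have hs := fun i => hf (err ξ (p i).1 (p i).2) (hpos _ _ (hp i).1)
  refine ⟨fun i => (p i).1, fun i => (p i).2, fun i => (hp i).1, ?_, ?_, ?_, ?_⟩
  · exact le_antisymm (hq1.trans hu₀1) (one_le_height hq0)
  · refine strictMono_nat_of_lt_succ fun i => ?_
    by_contra! h
    exact absurd (hs i).2.1 (not_lt.mpr ((hp i).2 _ _ (hp (i + 1)).1 h))
  · exact strictAnti_nat_of_succ_lt fun i => (hs i).2.1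
  · exact fun i u v hu hlt => (hs i).2.2.1 u v hu hlt

end Criterion

end

section

open Matrix Topology

theorem exists_lt_pow_succ {N : ℝ} (hN : 1 < N) (r : ℝ) :
    ∃ k : ℕ, r < N ^ (k + 1) ∧ (k = 0 ∨ N ^ k ≤ r) := by
  classical
  have hex : ∃ k : ℕ, r < N ^ (k + 1) := by
    obtain ⟨k, hk⟩ := pow_unbounded_of_one_lt r hN
    exact ⟨k, hk.trans_le (pow_le_pow_right₀ hN.le k.le_succ)⟩
  refine ⟨Nat.find hex, Nat.find_spec hex, ?_⟩
  rcases h : Nat.find hex with _ | k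
  · exact Or.inl rfl
  · exact Or.inr (not_lt.mp (Nat.find_min hex (h ▸ k.lt_succ_self)))

theorem FollowsProfile.le_add {m n : ℕ} {ξ : Matrix (Fin n) (Fin m) ℝ} {N : ℝ} {D : ℕ}
    {E : ℕ → ℕ} (h : FollowsProfile ξ N D E) (k s : ℕ) : E k + s ≤ E (k + s) := by
  induction s with
  | zero => exact le_rfl
  | succ s ih =>
    have := h.step_lower (k + s)
    rw [← add_assoc k s 1]
    omega

theorem FollowsProfile.add_le {m n : ℕ} {ξ : Matrix (Fin n) (Fin m) ℝ} {N : ℝ} {D : ℕ}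
    {E : ℕ → ℕ} (h : FollowsProfile ξ N D E) (k s : ℕ) : E (k + s) + s ≤ E k + s * D := by
  induction s with
  | zero => simp
  | succ s ih =>
    have := h.step_upper (k + s)
    rw [← add_assoc k s 1, add_mul]
    omega

theorem FollowsProfile.deg_ne_zero {m n : ℕ} {ξ : Matrix (Fin n) (Fin m) ℝ} {N : ℝ} {D : ℕ}
    {E : ℕ → ℕ} (h : FollowsProfile ξ N D E) : D ≠ 0 := by
  have h1 := h.step_lower 0
  have h2 := h.step_upper 0
  omega

theorem FollowsProfile.totallyIrrational {m n : ℕ} {ξ : Matrix (Fin n) (Fin m) ℝ} {N : ℝ} {D : ℕ}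
    {E : ℕ → ℕ} (h : FollowsProfile ξ N D E) : TotallyIrrational ξ := by
  intro u v huv
  change 0 < err ξ u v
  refine (err_nonneg ξ u v).lt_of_ne fun h0 => ?_
  obtain ⟨c, hc, hlow⟩ := h.lower
  obtain ⟨k, hk⟩ := pow_unbounded_of_one_lt (height u ^ D / c) h.one_lt
  have h1 := hlow k u v huv
  rw [size, ← h0, mul_zero, max_eq_left (height_nonneg u)] at h1
  have h2 : N ^ k ≤ N ^ E k :=
    pow_le_pow_right₀ h.one_lt.le (by have := h.le_add 0 k; rw [zero_add] at this; omega)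
  rw [div_lt_iff₀ hc] at hk
  nlinarith

/-- The error of the shortest vector at a late time is small. -/
theorem pow_err_le {m n : ℕ} {ξ : Matrix (Fin n) (Fin m) ℝ} {N : ℝ} (hN : 0 < N) {D k : ℕ}
    {u : Fin m → ℤ} {v : Fin n → ℤ} {b : ℝ} (hb : size ξ N k u v ^ D ≤ b) :
    (N ^ (k + 1)) ^ D * err ξ u v ^ D ≤ b := by
  rw [← mul_pow]
  exact (pow_le_pow_left₀ (mul_nonneg (by positivity) (err_nonneg ..)) (err_le_size ..) D).trans hb

theorem le_mul_of_pow_le {a b K : ℝ} {D : ℕ} (hD : D ≠ 0) (hb : 0 ≤ b) (hK : 1 ≤ K)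
    (h : a ^ D ≤ K * b ^ D) : a ≤ K * b := by
  refine le_of_pow_le_pow_left₀ hD (by positivity) (h.trans ?_)
  rw [mul_pow]
  gcongr
  exact le_self_pow₀ hK hD

/-- From any time there is a later time, at bounded distance, at which the error of the shortest
vector has decreased by a given factor. -/
theorem FollowsProfile.exists_short {m n : ℕ} {ξ : Matrix (Fin n) (Fin m) ℝ} {N : ℝ} {D : ℕ}
    {E : ℕ → ℕ} (h : FollowsProfile ξ N D E) {c : ℝ} (hc : 0 < c) :
    ∃ K : ℝ, 1 ≤ K ∧ ∀ k, ∃ u v, u ≠ 0 ∧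
      (N ^ (k + 1)) ^ D * err ξ u v ^ D < c * N ^ E k ∧
      height u ^ D ≤ K * (c * N ^ E k) ∧ err ξ u v ^ D * N ^ k < 1 := by
  obtain ⟨C, hC, hup⟩ := h.upper
  have hN1 := h.one_lt
  have hN0 : 0 < N := by linarith
  obtain ⟨s, hs⟩ := pow_unbounded_of_one_lt (max (C / c) (C * N ^ E 0)) hN1
  have hs1 : C < N ^ s * c := (div_lt_iff₀ hc).mp ((le_max_left _ _).trans_lt hs)
  have hs2 : C * N ^ E 0 < N ^ s := (le_max_right _ _).trans_lt hs
  refine ⟨max 1 (C / c * N ^ (s * D)), le_max_left _ _, fun k => ?_⟩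
  obtain ⟨u, v, huv, hq⟩ := hup (k + s)
  have h1 := pow_err_le hN0 hq
  have h4 : N ^ E (k + s) * N ^ s ≤ N ^ E k * N ^ (s * D) := by
    rw [← pow_add, ← pow_add]
    exact pow_le_pow_right₀ hN1.le (h.add_le k s)
  have h5 : (N ^ (k + s + 1)) ^ D = (N ^ (k + 1)) ^ D * N ^ (s * D) := by
    rw [← pow_mul, ← pow_mul, ← pow_add]
    congr 1
    ring
  have h6 : err ξ u v ^ D * N ^ k < 1 := by
    have h7 : N ^ E (k + s) * N ^ (k + s) ≤ N ^ E 0 * (N ^ (k + s + 1)) ^ D := by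
      rw [← pow_add, ← pow_mul, ← pow_add]
      refine pow_le_pow_right₀ hN1.le ?_
      have := h.add_le 0 (k + s)
      rw [zero_add] at this
      rw [add_mul (k + s) 1 D]
      omega
    have h8 : (N ^ (k + s + 1)) ^ D * (err ξ u v ^ D * N ^ (k + s)) ≤
        (N ^ (k + s + 1)) ^ D * (C * N ^ E 0) := by
      calc (N ^ (k + s + 1)) ^ D * (err ξ u v ^ D * N ^ (k + s))
          = ((N ^ (k + s + 1)) ^ D * err ξ u v ^ D) * N ^ (k + s) := by ring
        _ ≤ (C * N ^ E (k + s)) * N ^ (k + s) := by gcongr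
        _ = C * (N ^ E (k + s) * N ^ (k + s)) := by ring
        _ ≤ C * (N ^ E 0 * (N ^ (k + s + 1)) ^ D) := by gcongr
        _ = _ := by ring
    have h9 := le_of_mul_le_mul_left h8 (by positivity)
    rw [pow_add, ← mul_assoc] at h9
    have h10 : err ξ u v ^ D * N ^ k * N ^ s < 1 * N ^ s := by linarith
    exact lt_of_mul_lt_mul_right h10 (by positivity)
  refine ⟨u, v, ?_, ?_, ?_, h6⟩
  · rintro rfl
    have hv : v ≠ 0 := fun hv => huv (by rw [hv]; rfl)
    rw [err_zero] at h6
    have h7 : 1 ≤ height v ^ D := one_le_pow₀ (one_le_height hv)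
    have h8 : 1 ≤ N ^ k := one_le_pow₀ hN1.le
    nlinarith
  · rw [h5] at h1
    have h7 : ((N ^ (k + 1)) ^ D * err ξ u v ^ D) * (N ^ (s * D) * N ^ s) ≤
        (C * N ^ E k) * N ^ (s * D) := by
      calc ((N ^ (k + 1)) ^ D * err ξ u v ^ D) * (N ^ (s * D) * N ^ s)
          = ((N ^ (k + 1)) ^ D * N ^ (s * D) * err ξ u v ^ D) * N ^ s := by ring
        _ ≤ (C * N ^ E (k + s)) * N ^ s := by gcongr
        _ = C * (N ^ E (k + s) * N ^ s) := by ring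
        _ ≤ C * (N ^ E k * N ^ (s * D)) := by gcongr
        _ = _ := by ring
    have h8 : ((N ^ (k + 1)) ^ D * err ξ u v ^ D * N ^ s) * N ^ (s * D) <
        (c * N ^ E k * N ^ s) * N ^ (s * D) := by
      refine lt_of_le_of_lt (le_of_eq (by ring)) (h7.trans_lt ?_)
      have : C * N ^ E k < c * N ^ E k * N ^ s := by
        have : 0 < N ^ E k := by positivity
        nlinarith
      gcongr
    exact lt_of_mul_lt_mul_right (lt_of_mul_lt_mul_right h8 (by positivity)) (by positivity)
  · have h7 : N ^ E (k + s) ≤ N ^ E k * N ^ (s * D) :=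
      le_trans (le_mul_of_one_le_right (by positivity) (one_le_pow₀ hN1.le)) h4
    calc height u ^ D ≤ size ξ N (k + s) u v ^ D :=
          pow_le_pow_left₀ (height_nonneg u) (height_le_size ..) D
      _ ≤ C * N ^ E (k + s) := hq
      _ ≤ C * (N ^ E k * N ^ (s * D)) := by gcongr
      _ = (C / c * N ^ (s * D)) * (c * N ^ E k) := by field_simp
      _ ≤ _ := by gcongr; exact le_max_right _ _

theorem FollowsProfile.exists_isBestApproxSeq {m n : ℕ} (hm : 0 < m)
    {ξ : Matrix (Fin n) (Fin m) ℝ} {N : ℝ} {D : ℕ} {E : ℕ → ℕ} (h : FollowsProfile ξ N D E) :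
    ∃ x y, IsBestApproxSeq ξ x y := by
  refine LatticeFlow.exists_isBestApproxSeq hm h.totallyIrrational fun b hb => ?_
  have hN1 := h.one_lt
  obtain ⟨K, -, hK⟩ := h.exists_short one_pos
  obtain ⟨k, hk⟩ := pow_unbounded_of_one_lt (1 / b ^ D) hN1
  obtain ⟨u, v, hu, -, -, hq⟩ := hK k
  refine ⟨u, v, hu, lt_of_pow_lt_pow_left₀ D hb.le ?_⟩
  rw [div_lt_iff₀ (by positivity)] at hk
  have h1 : err ξ u v ^ D * N ^ k < b ^ D * N ^ k := by linarith
  exact lt_of_mul_lt_mul_right h1 (pow_nonneg (by linarith) _)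

theorem FollowsProfile.propB {m n : ℕ} {ξ : Matrix (Fin n) (Fin m) ℝ} {N : ℝ} {D : ℕ} {E : ℕ → ℕ}
    (h : FollowsProfile ξ N D E) {x : ℕ → Fin m → ℤ} {y : ℕ → Fin n → ℤ}
    (hxy : IsBestApproxSeq ξ x y) : PropB x := by
  obtain ⟨c, hc, hlow⟩ := h.lower
  obtain ⟨K, hK1, hK⟩ := h.exists_short hc
  have hN1 := h.one_lt
  have hN0 : 0 < N := by linarith
  have hX : ∀ i, 1 ≤ height (x i) := fun i => one_le_height (hxy.nonzero i)
  have hL : ∀ i, 0 < err ξ (x i) (y i) := fun i =>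
    h.totallyIrrational _ _ fun h0 => hxy.nonzero i (congrArg Prod.fst h0)
  set B := N * max 1 (err ξ (x 0) (y 0)) with hB
  have hB1 : N ≤ B := le_mul_of_one_le_right hN0.le (le_max_left _ _)
  refine ⟨K * B, fun i => ?_⟩
  change height (x (i + 1)) / height (x i) ≤ _
  rw [div_le_iff₀ (by linarith [hX i])]
  obtain ⟨k, hk, hk'⟩ := exists_lt_pow_succ hN1 (height (x i) / err ξ (x i) (y i))
  rw [div_lt_iff₀ (hL i)] at hk
  have hsz : size ξ N k (x i) (y i) = N ^ (k + 1) * err ξ (x i) (y i) := max_eq_right hk.le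
  have hszle : N ^ (k + 1) * err ξ (x i) (y i) ≤ B * height (x i) := by
    rcases hk' with rfl | hk'
    · have h1 : err ξ (x i) (y i) ≤ err ξ (x 0) (y 0) := hxy.lStrictAnti.antitone (Nat.zero_le i)
      rw [zero_add, pow_one, hB, mul_assoc]
      have h2 : err ξ (x i) (y i) ≤ max 1 (err ξ (x 0) (y 0)) * height (x i) :=
        (h1.trans (le_max_right _ _)).trans (le_mul_of_one_le_right (by positivity) (hX i))
      gcongr
    · rw [le_div_iff₀ (hL i)] at hk'
      rw [pow_succ]
      calc N ^ k * N * err ξ (x i) (y i) = N * (N ^ k * err ξ (x i) (y i)) := by ring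
        _ ≤ B * height (x i) := by
          refine mul_le_mul hB1 hk' ?_ (by linarith)
          exact mul_nonneg (by positivity) (hL i).le
  have hlowi := hlow k (x i) (y i) fun h0 => hxy.nonzero i (congrArg Prod.fst h0)
  rw [hsz] at hlowi
  obtain ⟨u, v, hu, hq1, hq2, -⟩ := hK k
  have h1 : err ξ u v < err ξ (x i) (y i) := by
    refine lt_of_pow_lt_pow_left₀ D (hL i).le ?_
    rw [mul_pow] at hlowi
    exact lt_of_mul_lt_mul_left (hq1.trans_le hlowi) (by positivity)
  have h2 : height (x (i + 1)) ≤ height u := by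
    by_contra! hlt
    exact absurd h1 (not_lt.mpr (hxy.best i u v hu hlt))
  refine h2.trans ?_
  rw [mul_assoc]
  refine le_mul_of_pow_le h.deg_ne_zero (mul_nonneg (by linarith) (height_nonneg _)) hK1
    (hq2.trans ?_)
  have h3 := pow_le_pow_left₀ (mul_nonneg (by positivity) (hL i).le) hszle D
  have h4 : c * N ^ E k ≤ (B * height (x i)) ^ D := hlowi.trans h3
  gcongr

theorem FollowsProfile.propC {m n : ℕ} {ξ : Matrix (Fin n) (Fin m) ℝ} {N : ℝ} {D : ℕ} {E : ℕ → ℕ}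
    (h : FollowsProfile ξ N D E) {x : ℕ → Fin m → ℤ} {y : ℕ → Fin n → ℤ}
    (hxy : IsBestApproxSeq ξ x y) : PropC ξ x y := by
  obtain ⟨c, hc, hlow⟩ := h.lower
  obtain ⟨C, hC, hup⟩ := h.upper
  have hN1 := h.one_lt
  have hN0 : 0 < N := by linarith
  have hX : ∀ i, 1 ≤ height (x i) := fun i => one_le_height (hxy.nonzero i)
  have hL : ∀ i, 0 < err ξ (x i) (y i) := fun i =>
    h.totallyIrrational _ _ fun h0 => hxy.nonzero i (congrArg Prod.fst h0)
  set Λ := max 1 (err ξ (x 0) (y 0)) with hΛ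
  have hΛ1 : 1 ≤ Λ := le_max_left _ _
  have hLΛ : ∀ i, err ξ (x i) (y i) ≤ Λ := fun i =>
    (hxy.lStrictAnti.antitone (Nat.zero_le i)).trans (le_max_right _ _)
  obtain ⟨s, hs⟩ := pow_unbounded_of_one_lt (C * Λ ^ D / c) hN1
  rw [div_lt_iff₀ hc] at hs
  refine ⟨N * Λ * N ^ s, fun i => ?_⟩
  change err ξ (x i) (y i) / err ξ (x (i + 1)) (y (i + 1)) ≤ _
  rw [div_le_iff₀ (hL _)]
  obtain ⟨k, hk, hk'⟩ := exists_lt_pow_succ hN1 (height (x (i + 1)) / err ξ (x i) (y i))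
  rw [div_lt_iff₀ (hL i)] at hk
  have hkle : N ^ (k + 1) * err ξ (x i) (y i) ≤ N * Λ * height (x (i + 1)) := by
    rcases hk' with rfl | hk'
    · rw [zero_add, pow_one, mul_assoc]
      have h2 : err ξ (x i) (y i) ≤ Λ * height (x (i + 1)) :=
        (hLΛ i).trans (le_mul_of_one_le_right (by linarith) (hX _))
      gcongr
    · rw [le_div_iff₀ (hL i)] at hk'
      rw [pow_succ]
      calc N ^ k * N * err ξ (x i) (y i) = N * (N ^ k * err ξ (x i) (y i)) := by ring
        _ ≤ N * height (x (i + 1)) := by gcongr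
        _ ≤ N * Λ * height (x (i + 1)) := by
          have := height_nonneg (x (i + 1))
          have : N ≤ N * Λ := le_mul_of_one_le_right hN0.le hΛ1
          gcongr
  obtain ⟨u, v, huv, hq⟩ := hup k
  have hXle : height (x (i + 1)) ≤ Λ * size ξ N k u v := by
    have hsz0 := size_nonneg ξ N k u v
    by_cases hu : u = 0
    · subst hu
      have hv : v ≠ 0 := fun hv => huv (by rw [hv]; rfl)
      have h1 := err_le_size ξ N k 0 v
      rw [err_zero] at h1
      have h2 : N ^ (k + 1) ≤ size ξ N k 0 v :=
        (le_mul_of_one_le_right (by positivity) (one_le_height hv)).trans h1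
      calc height (x (i + 1)) ≤ N ^ (k + 1) * err ξ (x i) (y i) := hk.le
        _ ≤ size ξ N k 0 v * Λ := mul_le_mul h2 (hLΛ i) (hL i).le hsz0
        _ = _ := mul_comm _ _
    · refine le_trans ?_ (le_mul_of_one_le_left hsz0 hΛ1)
      by_cases hlt : height u < height (x (i + 1))
      · have h1 : err ξ (x i) (y i) ≤ err ξ u v := hxy.best i u v hu hlt
        exact hk.le.trans ((mul_le_mul_of_nonneg_left h1 (by positivity)).trans
          (err_le_size ξ N k u v))
      · exact (not_lt.mp hlt).trans (height_le_size ..)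
  have hlowi := hlow (k + s) (x (i + 1)) (y (i + 1))
    fun h0 => hxy.nonzero (i + 1) (congrArg Prod.fst h0)
  have hlt : height (x (i + 1)) < size ξ N (k + s) (x (i + 1)) (y (i + 1)) := by
    refine lt_of_pow_lt_pow_left₀ D (size_nonneg ..) ?_
    have h1 := pow_le_pow_left₀ (height_nonneg _) hXle D
    rw [mul_pow] at h1
    have h2 : N ^ E k * N ^ s ≤ N ^ E (k + s) := by
      rw [← pow_add]
      exact pow_le_pow_right₀ hN1.le (h.le_add k s)
    have h3 : 0 < N ^ E k := by positivity
    calc height (x (i + 1)) ^ D ≤ Λ ^ D * (C * N ^ E k) := h1.trans (by gcongr)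
      _ = C * Λ ^ D * N ^ E k := by ring
      _ < N ^ s * c * N ^ E k := by gcongr
      _ = c * (N ^ E k * N ^ s) := by ring
      _ ≤ c * N ^ E (k + s) := by gcongr
      _ ≤ _ := hlowi
  have hge : height (x (i + 1)) ≤ N ^ (k + s + 1) * err ξ (x (i + 1)) (y (i + 1)) := by
    rcases lt_max_iff.mp hlt with h1 | h1
    · exact absurd h1 (lt_irrefl _)
    · exact h1.le
  have h5 : N ^ (k + 1) * err ξ (x i) (y i) ≤
      N ^ (k + 1) * (N * Λ * N ^ s * err ξ (x (i + 1)) (y (i + 1))) := by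
    calc N ^ (k + 1) * err ξ (x i) (y i) ≤ N * Λ * height (x (i + 1)) := hkle
      _ ≤ N * Λ * (N ^ (k + s + 1) * err ξ (x (i + 1)) (y (i + 1))) := by gcongr
      _ = _ := by ring
  exact le_of_mul_le_mul_left h5 (by positivity)

/-- If the first minimum drops arbitrarily far below its generic size then the matrix is not
badly approximable. -/
theorem FollowsProfile.not_propA {m n : ℕ} {ξ : Matrix (Fin n) (Fin m) ℝ}
    {N : ℝ} {E : ℕ → ℕ} (h : FollowsProfile ξ N ((m + n) * (m + n - 1)) E)
    (hE : ∀ K, ∃ k, E k + K ≤ (k + 1) * (n * (m + n - 1))) : ¬ PropA ξ := by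
  rintro ⟨c, hc, hA⟩
  obtain ⟨C, hC, hup⟩ := h.upper
  have hN1 := h.one_lt
  have hN0 : 0 < N := by linarith
  obtain ⟨K, hK⟩ := pow_unbounded_of_one_lt (max C (C / c ^ (m + n - 1))) hN1
  have hK1 : C < N ^ K := (le_max_left _ _).trans_lt hK
  have hK2 : C < N ^ K * c ^ (m + n - 1) :=
    (div_lt_iff₀ (by positivity)).mp ((le_max_right _ _).trans_lt hK)
  obtain ⟨k, hk⟩ := hE K
  obtain ⟨u, v, huv, hq⟩ := hup k
  have hEk : N ^ E k * N ^ K ≤ (N ^ (k + 1)) ^ (n * (m + n - 1)) := by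
    rw [← pow_add, ← pow_mul]
    exact pow_le_pow_right₀ hN1.le hk
  have hpos : 0 < N ^ E k := by positivity
  have hsz0 := size_nonneg ξ N k u v
  by_cases hu : u = 0
  · subst hu
    have hv : v ≠ 0 := fun hv => huv (by rw [hv]; rfl)
    have h1 := err_le_size ξ N k 0 v
    rw [err_zero] at h1
    have h2 : N ^ (k + 1) ≤ size ξ N k 0 v :=
      (le_mul_of_one_le_right (by positivity) (one_le_height hv)).trans h1
    have h3 : (N ^ (k + 1)) ^ (n * (m + n - 1)) ≤ (N ^ (k + 1)) ^ ((m + n) * (m + n - 1)) :=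
      pow_le_pow_right₀ (one_le_pow₀ hN1.le) (Nat.mul_le_mul_right _ (Nat.le_add_left _ _))
    have h4 := pow_le_pow_left₀ (by positivity) h2 ((m + n) * (m + n - 1))
    nlinarith
  · have h1 : c ≤ height u ^ m * err ξ u v ^ n := hA u v hu
    have h2 : c * (N ^ (k + 1)) ^ n ≤ size ξ N k u v ^ (m + n) := by
      calc c * (N ^ (k + 1)) ^ n ≤ height u ^ m * err ξ u v ^ n * (N ^ (k + 1)) ^ n := by gcongr
        _ = height u ^ m * (N ^ (k + 1) * err ξ u v) ^ n := by rw [mul_pow]; ring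
        _ ≤ size ξ N k u v ^ m * size ξ N k u v ^ n := by
          have := height_nonneg u
          have := err_nonneg ξ u v
          gcongr
          · exact height_le_size ..
          · exact err_le_size ..
        _ = _ := (pow_add _ _ _).symm
    have h3 := pow_le_pow_left₀ (by positivity) h2 (m + n - 1)
    rw [mul_pow, ← pow_mul (N ^ (k + 1)), ← pow_mul (size ξ N k u v)] at h3
    have h4 : c ^ (m + n - 1) * (N ^ E k * N ^ K) ≤ C * N ^ E k :=
      (mul_le_mul_of_nonneg_left hEk (by positivity)).trans (h3.trans hq)
    nlinarith

end

section

open Matrix Topology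

theorem norm_lat_flow_one {m n : ℕ} (ξ : Matrix (Fin n) (Fin m) ℝ) {N : ℝ} (hN : 0 ≤ N) (k : ℕ)
    (z : Fin m ⊕ Fin n → ℤ) :
    ‖lat (flow N (k + 1) ξ 1) z‖ =
      size ξ N k (fun i => z (Sum.inl i)) (fun j => -z (Sum.inr j)) := by
  have h1 : lat (1 : Matrix (Fin m ⊕ Fin n) (Fin m ⊕ Fin n) ℝ) z = fun i => (z i : ℝ) := by
    rw [lat, Matrix.one_mulVec]
  have h2 : N ^ (k + 1) * err ξ (fun i => z (Sum.inl i)) (fun j => -z (Sum.inr j)) =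
      ‖fun j => lat (flow N (k + 1) ξ 1) z (Sum.inr j)‖ := by
    have h3 : (fun j => lat (flow N (k + 1) ξ 1) z (Sum.inr j)) = N ^ (k + 1) •
        (ξ.mulVec (fun i => (z (Sum.inl i) : ℝ)) - fun j => ((-z (Sum.inr j) : ℤ) : ℝ)) := by
      funext j
      rw [lat_flow_inr, h1]
      simp [Matrix.mulVec, dotProduct]
      exact Or.inl (add_comm _ _)
    rw [h3, norm_smul, Real.norm_of_nonneg (by positivity)]
    rfl
  have h4 : height (fun i => z (Sum.inl i)) =
      ‖fun i => lat (flow N (k + 1) ξ 1) z (Sum.inl i)‖ := by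
    simp_rw [lat_flow_inl, h1]
    rfl
  rw [size, h2, h4]
  refine le_antisymm ?_ (max_le ?_ ?_)
  · refine (pi_norm_le_iff_of_nonneg (le_max_of_le_left (norm_nonneg _))).mpr ?_
    rintro (i | j)
    · exact le_max_of_le_left
        (norm_le_pi_norm (fun i => lat (flow N (k + 1) ξ 1) z (Sum.inl i)) i)
    · exact le_max_of_le_right
        (norm_le_pi_norm (fun j => lat (flow N (k + 1) ξ 1) z (Sum.inr j)) j)
  · exact (pi_norm_le_iff_of_nonneg (norm_nonneg _)).mpr fun i => norm_le_pi_norm _ (Sum.inl i)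
  · exact (pi_norm_le_iff_of_nonneg (norm_nonneg _)).mpr fun j => norm_le_pi_norm _ (Sum.inr j)

/-- The step and the time elapsed since the start of that step, as functions of the time. -/
def position (m n : ℕ) (dep : ℕ → ℕ) : ℕ → ℕ × ℕ
  | 0 => (0, 0)
  | k + 1 => if (position m n dep k).2 < (m + n) * dep (position m n dep k).1 then
      ((position m n dep k).1, (position m n dep k).2 + 1) else ((position m n dep k).1 + 1, 0)

theorem position_spec (m n : ℕ) (dep : ℕ → ℕ) (k : ℕ) :
    (position m n dep k).2 ≤ (m + n) * dep (position m n dep k).1 ∧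
      startTime m n dep (position m n dep k).1 + (position m n dep k).2 = k := by
  induction k with
  | zero => exact ⟨Nat.zero_le _, rfl⟩
  | succ k ih =>
    rw [position]
    split_ifs with h
    · exact ⟨h, by rw [← add_assoc, ih.2]⟩
    · refine ⟨Nat.zero_le _, ?_⟩
      simp only [startTime]
      omega

theorem position_startTime_add (m n : ℕ) (dep : ℕ → ℕ) (J t : ℕ) (ht : t ≤ (m + n) * dep J) :
    position m n dep (startTime m n dep J + t) = (J, t) := by
  have hstep : ∀ J, position m n dep (startTime m n dep J) = (J, 0) →
      ∀ t ≤ (m + n) * dep J, position m n dep (startTime m n dep J + t) = (J, t) := by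
    intro J hJ t
    induction t with
    | zero => exact fun _ => hJ
    | succ t ih =>
      intro ht
      rw [← add_assoc, position, ih (by omega), if_pos (by exact ht)]
  have hstart : ∀ J, position m n dep (startTime m n dep J) = (J, 0) := by
    intro J
    induction J with
    | zero => rfl
    | succ J ih =>
      have h1 := hstep J ih _ le_rfl
      rw [startTime, show startTime m n dep J + (1 + (m + n) * dep J) =
        startTime m n dep J + (m + n) * dep J + 1 by ring, position, h1, if_neg (lt_irrefl _)]
  exact hstep J (hstart J) t ht

/-- The exponent governing the first minimum at a given time. -/
def profile (m n : ℕ) (dep : ℕ → ℕ) (k : ℕ) : ℕ :=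
  (m + n) * excExp n (dep (position m n dep k).1) (position m n dep k).2 +
    (startTime m n dep (position m n dep k).1 + 1) * n * (m + n - 1)

theorem profile_step {m n : ℕ} (hm : 2 ≤ m) (hn : 2 ≤ n) (dep : ℕ → ℕ) (k : ℕ) :
    profile m n dep k + 1 ≤ profile m n dep (k + 1) ∧
      profile m n dep (k + 1) + 1 ≤ profile m n dep k + (m + n) * (m + n - 1) := by
  obtain ⟨h1, -⟩ := position_spec m n dep k
  rw [profile, profile, position]
  generalize (position m n dep k).1 = J at *
  generalize (position m n dep k).2 = t at *
  obtain ⟨m', rfl⟩ := Nat.exists_eq_add_of_le' hm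
  obtain ⟨n', rfl⟩ := Nat.exists_eq_add_of_le' hn
  rw [show m' + 2 + (n' + 2) - 1 = m' + n' + 3 by omega]
  split_ifs with h
  · have h2 : excExp (n' + 2) (dep J) t + 1 ≤ excExp (n' + 2) (dep J) (t + 1) ∧
        excExp (n' + 2) (dep J) (t + 1) ≤ excExp (n' + 2) (dep J) t + (n' + 2) := by
      simp only [excExp]
      rw [show n' + 2 - 1 = n' + 1 by omega]
      rcases lt_or_ge t ((n' + 2) * dep J) with h3 | h3
      · rw [min_eq_left h3.le, min_eq_left h3, Nat.sub_eq_zero_of_le h3.le,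
          Nat.sub_eq_zero_of_le h3]
        constructor <;> nlinarith
      · rw [min_eq_right h3, min_eq_right (h3.trans t.le_succ), Nat.sub_add_comm h3]
        constructor <;> nlinarith
    simp only
    constructor <;> nlinarith
  · have h2 : t = (m' + 2 + (n' + 2)) * dep J := by omega
    subst h2
    have h3 := excExp_end (m' + 2) (n' + 2) (dep J) (by omega)
    rw [show m' + 2 + (n' + 2) - 1 = m' + n' + 3 by omega] at h3
    simp only
    rw [h3, startTime]
    simp only [excExp]
    simp only [Nat.zero_min, zero_mul, Nat.zero_sub, add_zero, mul_zero]
    constructor <;> nlinarith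

theorem profile_deep {m n : ℕ} (hm : 1 ≤ m) (hn : 1 ≤ n) (dep : ℕ → ℕ) (J : ℕ) :
    profile m n dep (startTime m n dep J + n * dep J) + dep J ≤
      (startTime m n dep J + n * dep J + 1) * (n * (m + n - 1)) := by
  rw [profile, position_startTime_add _ _ _ _ _
    (Nat.mul_le_mul_right _ (Nat.le_add_left n m)), excExp, min_self, Nat.sub_self]
  obtain ⟨m', rfl⟩ := Nat.exists_eq_add_of_le' hm
  obtain ⟨n', rfl⟩ := Nat.exists_eq_add_of_le' hn
  rw [show m' + 1 + (n' + 1) - 1 = m' + n' + 1 by omega, show n' + 1 - 1 = n' by omega]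
  simp only
  nlinarith [Nat.zero_le (m' * dep J), Nat.zero_le (n' * dep J), Nat.zero_le (n' * m' * dep J)]

/-- Cantor-type families of matrices following the profile given by a sequence of excursion
depths. -/
theorem exists_followsProfile {m n : ℕ} (hm : 2 ≤ m) (hn : 2 ≤ n) :
    ∃ l₀ : ℕ, ∀ l ≥ l₀, ∀ dep : ℕ → ℕ,
      ∃ ξ : (ℕ → Fin (2 ^ (l * (m * n)))) → Matrix (Fin n) (Fin m) ℝ,
        (∀ a b J, (∀ i < J, a i = b i) → a J ≠ b J →
          ∃ k i, 1 / (2 ^ (l + 5)) ^ (startTime m n dep J + 1) ≤ |ξ a k i - ξ b k i|) ∧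
        ∀ a, FollowsProfile (ξ a) (2 ^ (l + 5)) ((m + n) * (m + n - 1)) (profile m n dep) := by
  obtain ⟨c, C, hc, hC, l₀, H⟩ := exists_tree hm hn
  refine ⟨l₀, fun l hl dep => ?_⟩
  obtain ⟨ξ, hsep, hξ⟩ := H l hl dep
  refine ⟨ξ, hsep, fun a => ⟨one_lt_pow₀ one_lt_two (by omega), ⟨c, hc, fun k u v huv => ?_⟩,
    ⟨C, hC, fun k => ?_⟩, fun k => (profile_step hm hn dep k).1,
    fun k => (profile_step hm hn dep k).2⟩⟩
  · obtain ⟨h1, h2⟩ := position_spec m n dep k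
    have h3 := (hξ a _ _ h1).1 (Sum.elim u (-v)) ?_
    · rw [add_right_comm, h2, norm_lat_flow_one _ (by positivity)] at h3
      simp only [Sum.elim_inl, Sum.elim_inr, Pi.neg_apply, neg_neg] at h3
      exact h3
    · intro h0
      refine huv (Prod.ext (funext fun i => congrFun h0 (Sum.inl i)) (funext fun j => ?_))
      exact neg_eq_zero.mp (congrFun h0 (Sum.inr j))
  · obtain ⟨h1, h2⟩ := position_spec m n dep k
    obtain ⟨z, hz, h3⟩ := (hξ a _ _ h1).2
    rw [add_right_comm, h2, norm_lat_flow_one _ (by positivity)] at h3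
    refine ⟨_, _, fun h0 => hz ?_, h3⟩
    obtain ⟨h4, h5⟩ := Prod.mk.inj h0
    funext i
    rcases i with i | j
    · exact congrFun h4 i
    · exact neg_eq_zero.mp (congrFun h5 j)

end

section

open Matrix Topology

/-- A family indexed by digit sequences, and separated in terms of the first differing digit, has
large Hausdorff dimension. -/
theorem le_dimH_range {X : Type*} [MetricSpace X] {b : ℕ} (hb : 1 < b) {ξ : (ℕ → Fin b) → X}
    {r K : NNReal} (hr : 0 < r)
    (hξ : ∀ a a' J, (∀ i < J, a i = a' i) → a J ≠ a' J →
      ((b : ℝ) ^ J)⁻¹ ≤ K * dist (ξ a) (ξ a') ^ (r : ℝ)) :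
    (r : ENNReal) ≤ dimH (Set.range ξ) := by
  classical
  have hb0 : (0 : ℝ) < b := by exact_mod_cast (by omega : 0 < b)
  have hfirst : ∀ a a' : ℕ → Fin b, a ≠ a' → ∃ J, (∀ i < J, a i = a' i) ∧ a J ≠ a' J := by
    intro a a' h
    have hex := Function.ne_iff.mp h
    exact ⟨Nat.find hex, fun i hi => not_not.mp (Nat.find_min hex hi), Nat.find_spec hex⟩
  have hinj : Function.Injective ξ := by
    intro a a' h
    by_contra hne
    obtain ⟨J, hJ, hJ'⟩ := hfirst a a' hne
    have h1 := hξ a a' J hJ hJ'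
    rw [h, dist_self, Real.zero_rpow (by exact_mod_cast hr.ne'), mul_zero] at h1
    have : 0 < ((b : ℝ) ^ J)⁻¹ := by positivity
    linarith
  have : Nonempty (ℕ → Fin b) := ⟨fun _ => ⟨0, by omega⟩⟩
  have hinv : ∀ a, Function.invFun ξ (ξ a) = a := Function.leftInverse_invFun hinj
  have hH : HolderOnWith K r (fun x => Real.ofDigits (Function.invFun ξ x)) (Set.range ξ) := by
    rintro _ ⟨a, rfl⟩ _ ⟨a', rfl⟩
    simp only [hinv]
    by_cases hne : a = a'
    · subst hne
      simp
    · obtain ⟨J, hJ, hJ'⟩ := hfirst a a' hne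
      have h1 := (Real.abs_ofDigits_sub_ofDigits_le hJ).trans (hξ a a' J hJ hJ')
      rw [← Real.dist_eq] at h1
      rw [edist_dist, edist_dist, ENNReal.ofReal_rpow_of_nonneg dist_nonneg r.coe_nonneg,
        ← ENNReal.ofReal_coe_nnreal, ← ENNReal.ofReal_mul K.coe_nonneg]
      exact ENNReal.ofReal_le_ofReal h1
  have h1 := hH.dimH_image_le hr
  have h2 : Set.Icc (0 : ℝ) 1 ⊆
      (fun x => Real.ofDigits (Function.invFun ξ x)) '' Set.range ξ := by
    intro y hy
    obtain ⟨a, -, ha⟩ := Real.ofDigits_SurjOn hb hy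
    exact ⟨ξ a, ⟨a, rfl⟩, by simp only [hinv, ha]⟩
  have h3 : dimH (Set.Icc (0 : ℝ) 1) = 1 := by
    rw [Real.dimH_of_nonempty_interior ⟨1 / 2, by rw [interior_Icc]; norm_num⟩,
      Module.finrank_self, Nat.cast_one]
  have h4 : (1 : ENNReal) ≤ dimH (Set.range ξ) / r := h3 ▸ (dimH_mono h2).trans h1
  rwa [ENNReal.le_div_iff_mul_le (Or.inl (by exact_mod_cast hr.ne')) (Or.inl ENNReal.coe_ne_top),
    one_mul] at h4

/-- A slowly growing sequence whose increments are unbounded. -/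
def slowSum (w J : ℕ) : ℕ := Nat.sqrt (J / w) ^ 2

theorem slowSum_mono (w : ℕ) : Monotone (slowSum w) := fun _ _ h =>
  Nat.pow_le_pow_left (Nat.sqrt_le_sqrt (Nat.div_le_div_right h)) 2

theorem mul_slowSum_le (w J : ℕ) : w * slowSum w J ≤ J :=
  (Nat.mul_le_mul_left w (Nat.sqrt_le' _)).trans (Nat.mul_div_le J w)

theorem exists_le_slowSum_sub {w : ℕ} (hw : 0 < w) (K : ℕ) :
    ∃ J, K ≤ slowSum w (J + 1) - slowSum w J := by
  have h0 : 0 < w * (K + 1) ^ 2 := by positivity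
  refine ⟨w * (K + 1) ^ 2 - 1, ?_⟩
  have h1 : slowSum w (w * (K + 1) ^ 2 - 1 + 1) = (K + 1) ^ 2 := by
    rw [Nat.sub_add_cancel h0, slowSum, Nat.mul_div_cancel_left _ hw, Nat.sqrt_eq']
  have h2 : slowSum w (w * (K + 1) ^ 2 - 1) ≤ K ^ 2 := by
    refine Nat.pow_le_pow_left (Nat.lt_succ_iff.mp (Nat.sqrt_lt'.mpr ?_)) 2
    rw [Nat.div_lt_iff_lt_mul hw, mul_comm (K.succ ^ 2)]
    exact Nat.sub_lt h0 one_pos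
  rw [h1]
  have h3 : (K + 1) ^ 2 = K ^ 2 + 2 * K + 1 := by ring
  omega

theorem startTime_slowSum (m n w J : ℕ) :
    startTime m n (fun i => slowSum w (i + 1) - slowSum w i) J = J + (m + n) * slowSum w J := by
  induction J with
  | zero => simp [startTime, slowSum]
  | succ J ih =>
    have h1 := slowSum_mono w J.le_succ
    rw [startTime, ih, Nat.mul_sub]
    have h2 := Nat.mul_le_mul_left (m + n) h1
    simp only [Nat.succ_eq_add_one] at h2
    omega

/-- The matrices in question contain families of Hausdorff dimension close to `m * n`. -/
theorem exists_forall_le_dimH {m n : ℕ} (hm : 2 ≤ m) (hn : 2 ≤ n) :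
    ∃ l₀ : ℕ, ∀ l ≥ l₀, 1 ≤ l → ∃ S : Set (Fin n → Fin m → ℝ), S.Nonempty ∧
      ENNReal.ofReal ((m * n : ℕ) * ((l : ℝ) / (l + 5)) * ((l : ℝ) / (l + 1))) ≤ dimH S ∧
      ∀ A ∈ S, ∃ (N : ℝ) (E : ℕ → ℕ),
        FollowsProfile (Matrix.of A) N ((m + n) * (m + n - 1)) E ∧
        ∀ K, ∃ k, E k + K ≤ (k + 1) * (n * (m + n - 1)) := by
  obtain ⟨l₀, H⟩ := exists_followsProfile hm hn
  refine ⟨l₀, fun l hl hl1 => ?_⟩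
  set w := l * (m + n) with hw
  have hw0 : 0 < w := Nat.mul_pos hl1 (by omega)
  set dep : ℕ → ℕ := fun i => slowSum w (i + 1) - slowSum w i with hdep
  obtain ⟨ξ, hsep, hξ⟩ := H l hl dep
  have hb : 1 < 2 ^ (l * (m * n)) := Nat.one_lt_two_pow (by positivity)
  set ζ : (ℕ → Fin (2 ^ (l * (m * n)))) → Fin n → Fin m → ℝ := fun a => ξ a with hζ
  have hl0 : (0 : ℝ) < l := by exact_mod_cast hl1
  have hmn0 : (0 : ℝ) < (m * n : ℕ) := by exact_mod_cast (by positivity : 0 < m * n)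
  set r : ℝ := (m * n : ℕ) * ((l : ℝ) / (l + 5)) * ((l : ℝ) / (l + 1)) with hr
  have hr0 : 0 < r := by positivity
  refine ⟨Set.range ζ, ⟨ζ fun _ => ⟨0, by omega⟩, Set.mem_range_self _⟩, ?_, ?_⟩
  · refine le_dimH_range hb (r := r.toNNReal) (K := 2 ^ (l * (m * n)))
      (Real.toNNReal_pos.mpr hr0) fun a a' J hJ hJ' => ?_
    obtain ⟨k, i, hki⟩ := hsep a a' J hJ hJ'
    have h1 : |ξ a k i - ξ a' k i| ≤ dist (ζ a) (ζ a') := by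
      rw [← Real.dist_eq]
      exact (dist_le_pi_dist (ζ a k) (ζ a' k) i).trans (dist_le_pi_dist (ζ a) (ζ a') k)
    have h2 := Real.rpow_le_rpow (by positivity) (hki.trans h1) hr0.le
    rw [Real.coe_toNNReal _ hr0.le]
    refine le_trans ?_ (mul_le_mul_of_nonneg_left h2 (NNReal.coe_nonneg _))
    rw [hdep, startTime_slowSum]
    have h3 : (l : ℝ) * ((m + n : ℕ) * slowSum w J) ≤ J := by
      have := mul_slowSum_le w J
      rw [hw, mul_assoc] at this
      exact_mod_cast this
    push_cast at h3 ⊢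
    rw [one_div, ← pow_mul, ← pow_mul, Real.inv_rpow (by positivity), ← Real.rpow_natCast,
      ← Real.rpow_natCast 2 (l * (m * n)), ← Real.rpow_natCast 2, ← Real.rpow_mul (by norm_num),
      ← Real.rpow_neg (by norm_num), ← Real.rpow_neg (by norm_num), ← Real.rpow_add (by norm_num)]
    refine Real.rpow_le_rpow_of_exponent_le (by norm_num) ?_
    have h4 : ((l + 5 : ℕ) : ℝ) * r = l * (m * n : ℕ) * (l / (l + 1)) := by
      rw [hr]
      push_cast
      field_simp
    generalize slowSum w J = σ at *
    have h5 : (l / (l + 1) : ℝ) * (J + (m + n) * σ + 1) ≤ J + 1 := by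
      rw [div_mul_eq_mul_div, div_le_iff₀ (by positivity)]
      have : (0 : ℝ) ≤ J := by positivity
      nlinarith
    have h6 := mul_le_mul_of_nonneg_left h5 (by positivity : (0 : ℝ) ≤ l * (m * n : ℕ))
    push_cast at h4 h6 ⊢
    linear_combination h6 + (J + (m + n) * σ + 1) * h4
  · rintro _ ⟨a, rfl⟩
    refine ⟨2 ^ (l + 5), profile m n dep, hξ a, fun K => ?_⟩
    obtain ⟨J, hJ⟩ := exists_le_slowSum_sub hw0 K
    have h1 := profile_deep (by omega : 1 ≤ m) (by omega : 1 ≤ n) dep J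
    exact ⟨_, le_trans (Nat.add_le_add_left hJ _) h1⟩

end

end LatticeFlow

/-- For `m, n ≥ 2`, the set of totally irrational `ξ ∈ ℝ^{n×m}`
satisfying (B) and (C) but not (A) is nonempty of full Hausdorff dimension `mn`. -/
theorem stmt_4 (m n : ℕ) (hm : 2 ≤ m) (hn : 2 ≤ n) :
    ({A : Fin n → Fin m → ℝ | TotallyIrrational (Matrix.of A) ∧
        (∃ (x : ℕ → Fin m → ℤ) (y : ℕ → Fin n → ℤ),
          IsBestApproxSeq (Matrix.of A) x y ∧ PropB x ∧ PropC (Matrix.of A) x y) ∧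
        ¬ PropA (Matrix.of A)} : Set (Fin n → Fin m → ℝ)).Nonempty ∧
    dimH ({A : Fin n → Fin m → ℝ | TotallyIrrational (Matrix.of A) ∧
        (∃ (x : ℕ → Fin m → ℤ) (y : ℕ → Fin n → ℤ),
          IsBestApproxSeq (Matrix.of A) x y ∧ PropB x ∧ PropC (Matrix.of A) x y) ∧
        ¬ PropA (Matrix.of A)} : Set (Fin n → Fin m → ℝ)) = ((m * n : ℕ) : ENNReal) := by
  obtain ⟨l₀, H⟩ := LatticeFlow.exists_forall_le_dimH hm hn
  set T : Set (Fin n → Fin m → ℝ) := {A | TotallyIrrational (Matrix.of A) ∧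
    (∃ (x : ℕ → Fin m → ℤ) (y : ℕ → Fin n → ℤ),
      IsBestApproxSeq (Matrix.of A) x y ∧ PropB x ∧ PropC (Matrix.of A) x y) ∧
    ¬ PropA (Matrix.of A)} with hT
  have hsub : ∀ S : Set (Fin n → Fin m → ℝ), (∀ A ∈ S, ∃ (N : ℝ) (E : ℕ → ℕ),
      LatticeFlow.FollowsProfile (Matrix.of A) N ((m + n) * (m + n - 1)) E ∧
      ∀ K, ∃ k, E k + K ≤ (k + 1) * (n * (m + n - 1))) → S ⊆ T := by
    intro S hS A hA
    obtain ⟨N, E, hE, hK⟩ := hS A hA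
    obtain ⟨x, y, hxy⟩ := hE.exists_isBestApproxSeq (by omega)
    exact ⟨hE.totallyIrrational, ⟨x, y, hxy, hE.propB hxy, hE.propC hxy⟩, hE.not_propA hK⟩
  refine ⟨?_, le_antisymm ?_ ?_⟩
  · obtain ⟨S, hne, -, hS⟩ := H (max l₀ 1) (le_max_left _ _) (le_max_right _ _)
    exact hne.mono (hsub S hS)
  · refine (dimH_mono (Set.subset_univ T)).trans (le_of_eq ?_)
    rw [Real.dimH_univ_eq_finrank, Module.finrank_pi_fintype]
    simp [mul_comm]
  · have hlim : Tendsto (fun l : ℕ => ENNReal.ofReal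
        ((m * n : ℕ) * ((l : ℝ) / (l + 5)) * ((l : ℝ) / (l + 1)))) atTop
        (nhds ((m * n : ℕ) : ENNReal)) := by
      have h1 := ((tendsto_natCast_div_add_atTop (5 : ℝ)).const_mul ((m * n : ℕ) : ℝ)).mul
        (tendsto_natCast_div_add_atTop (1 : ℝ))
      rw [mul_one, mul_one] at h1
      have h2 := ENNReal.tendsto_ofReal h1
      rwa [ENNReal.ofReal_natCast] at h2
    refine le_of_tendsto hlim ?_
    filter_upwards [eventually_ge_atTop l₀, eventually_ge_atTop 1] with l hl hl1
    obtain ⟨S, -, hdim, hS⟩ := H l hl hl1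
    exact hdim.trans (dimH_mono (hsub S hS))
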